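/- Let m ≥ 1 be an integer and let u be a classical m-equivariant solution of CSS on I = (−1,0) such that ‖u(t,·)‖_{L²}² = 8π(m+1) for all t ∈ (−1,0) and ‖∂_r u(t,·)‖_{L²} → ∞ as t ↗ 0. Then for every t ∈ (−1,0) the variance is finite and satisfies the exact identity 2π·∫₀^∞ r²·|u(t,r)|²·r dr = 8·E[u(t,·)]·t². -/

import Mathlib

open MeasureTheory Set Filter

noncomputable section

/-- The Jackiw–Pi vortex `Q(r) = √8 (m+1) r^m / (1 + r^(2m+2))`. -/
def Q (m : ℕ) (r : ℝ) : ℝ :=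
  Real.sqrt 8 * (m + 1) * r ^ m / (1 + r ^ (2 * m + 2))

/-- `A_θ[u](r) = -(1/2) ∫₀^r |u(r')|² r' dr'`. -/
def Atheta (u : ℝ → ℂ) (r : ℝ) : ℝ :=
  -(1 / 2) * ∫ s in (0:ℝ)..r, ‖u s‖ ^ 2 * s

/-- Bilinear version `A_θ[f,g](r) = -(1/2) ∫₀^r Re(conj f g) r' dr'`. -/
def Atheta2 (f g : ℝ → ℂ) (r : ℝ) : ℝ :=
  -(1 / 2) * ∫ s in (0:ℝ)..r, ((starRingEnd ℂ) (f s) * g s).re * s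

/-- `A_t[u](r) = -∫_r^∞ (m + A_θ[u](r')) |u(r')|² / r' dr'`. -/
def At (m : ℕ) (u : ℝ → ℂ) (r : ℝ) : ℝ :=
  -∫ s in Set.Ioi r, ((m : ℝ) + Atheta u s) * ‖u s‖ ^ 2 / s

/-- Squared (2D radial) `L²` norm: `‖u‖² = 2π ∫₀^∞ |u(r)|² r dr`. -/
def L2sq (u : ℝ → ℂ) : ℝ :=
  2 * Real.pi * ∫ r in Set.Ioi (0:ℝ), ‖u r‖ ^ 2 * r

/-- Squared equivariant `Ḣ¹_m` norm. -/
def H1msq (m : ℕ) (u : ℝ → ℂ) : ℝ :=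
  2 * Real.pi * ∫ r in Set.Ioi (0:ℝ), (‖deriv u r‖ ^ 2 + (m : ℝ) ^ 2 * ‖u r‖ ^ 2 / r ^ 2) * r

/-- The energy functional. -/
def Energy (m : ℕ) (u : ℝ → ℂ) : ℝ :=
  2 * Real.pi * ∫ r in Set.Ioi (0:ℝ),
    ((1 / 2) * ‖deriv u r‖ ^ 2
      + (1 / 2) * (((m : ℝ) + Atheta u r) / r) ^ 2 * ‖u r‖ ^ 2
      - (1 / 4) * ‖u r‖ ^ 4) * r

/-- The Chern–Simons–Schrödinger equation at the point `(t, r)`: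
`i ∂_t u - A_t[u] u + ∂_r² u + (1/r) ∂_r u - ((m + A_θ[u])/r)² u + |u|² u = 0`. -/
def CSSeq (m : ℕ) (u : ℝ → ℝ → ℂ) (t r : ℝ) : Prop :=
  Complex.I * deriv (fun s => u s r) t
    - (At m (u t) r : ℂ) * u t r
    + deriv (deriv (u t)) r
    + (1 / (r : ℂ)) * deriv (u t) r
    - ((((m : ℝ) + Atheta (u t) r) / r : ℝ) : ℂ) ^ 2 * u t r
    + ((‖u t r‖ : ℝ) : ℂ) ^ 2 * u t r = 0

/-- A classical `m`-equivariant solution of CSS on the open interval `I`. -/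
structure IsCSS (m : ℕ) (I : Set ℝ) (u : ℝ → ℝ → ℂ) : Prop where
  smooth : ContDiffOn ℝ (⊤ : ℕ∞) (fun p : ℝ × ℝ => u p.1 p.2) (I ×ˢ Set.Ioi (0:ℝ))
  integrable : ∀ t ∈ I, IntegrableOn (fun r => ‖u t r‖ ^ 2 * r) (Set.Ioi (0:ℝ))
  equivariant : ∃ U : ℝ → ℝ × ℝ → ℂ,
    ContDiffOn ℝ (⊤ : ℕ∞) (fun p : ℝ × (ℝ × ℝ) => U p.1 p.2) (I ×ˢ (Set.univ : Set (ℝ × ℝ))) ∧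
    ∀ t ∈ I, ∀ x : ℝ × ℝ, x ≠ 0 →
      U t x = u t (Real.sqrt (x.1 ^ 2 + x.2 ^ 2)) *
        (((x.1 : ℂ) + (x.2 : ℂ) * Complex.I) / ((Real.sqrt (x.1 ^ 2 + x.2 ^ 2) : ℝ) : ℂ)) ^ m
  bounded : ∀ J : Set ℝ, J ⊆ I → IsCompact J → ∃ C : ℝ, ∀ t ∈ J,
    Real.sqrt (L2sq (u t)) + Real.sqrt (H1msq m (u t)) ≤ C
  eq : ∀ t ∈ I, ∀ r : ℝ, 0 < r → CSSeq m u t r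

/-- Tightness: uniformly small mass near spatial infinity. -/
def Tight (I : Set ℝ) (u : ℝ → ℝ → ℂ) : Prop :=
  ∀ η : ℝ, 0 < η → ∃ R : ℝ, ∀ t ∈ I,
    2 * Real.pi * ∫ r in Set.Ioi R, ‖u t r‖ ^ 2 * r < η

/-- The real inner product `(f,g)_r = Re (2π ∫₀^∞ f conj(g) r dr)`. -/
def iprod (f g : ℝ → ℂ) : ℝ :=
  2 * Real.pi * (∫ r in Set.Ioi (0:ℝ), f r * (starRingEnd ℂ) (g r) * (r : ℂ)).re

/-- `ΛQ = r Q' + Q`. -/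
def LamQ (m : ℕ) (r : ℝ) : ℝ := r * deriv (Q m) r + Q m r

/-- The linearized Bogomol'nyi operator `L_Q`. -/
def LQ (m : ℕ) (f : ℝ → ℂ) (r : ℝ) : ℂ :=
  deriv f r - ((((m : ℝ) + Atheta (fun s => (Q m s : ℂ)) r) / r : ℝ) : ℂ) * f r
    - ((2 * Atheta2 (fun s => (Q m s : ℂ)) f r / r : ℝ) : ℂ) * (Q m r : ℂ)

end

namespace CSSP
set_option hygiene false
notation "SSr" => rho (SS m ν c d) (SS m ν d (-c)) (t, r)
notation "rpq" => rho p q (t, r)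
notation "rPQ" => rho P Q (t, r)
notation "apq" => av m p q (t, r)
notation "ypq" => YY p q (t, r)
notation "gpq" => gg m p q (t, r)
notation "zr" => (t, r)
notation "zs" => (t, s)
notation "rn" => (1 - r / n)
notation "mm2" => (2 * m + 2)
set_option hygiene true


lemma mI {a : ℝ} : MeasurableSet (Ioi a) := measurableSet_Ioi
lemma aeI {a : ℝ} {P : ℝ → Prop} (h : ∀ r ∈ Ioi a, P r) : ∀ᵐ r ∂volume.restrict (Ioi a), P r :=
  (ae_restrict_iff' mI).2 (Eventually.of_forall h)

end CSSP

namespace CSSP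
noncomputable section
open scoped ContDiff Topology

def dT (F : ℝ × ℝ → ℝ) (p : ℝ × ℝ) : ℝ := fderiv ℝ F p (1, 0)
def dR (F : ℝ × ℝ → ℝ) (p : ℝ × ℝ) : ℝ := fderiv ℝ F p (0, 1)

variable {Ω : Set (ℝ × ℝ)} {F : ℝ × ℝ → ℝ}

lemma dT_smooth (hΩ : IsOpen Ω) (hF : ContDiffOn ℝ (⊤ : ℕ∞) F Ω) :
    ContDiffOn ℝ (⊤ : ℕ∞) (dT F) Ω := by
  have h := ((contDiffOn_infty_iff_fderiv_of_isOpen hΩ).1 hF).2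
  exact h.clm_apply contDiffOn_const

lemma dR_smooth (hΩ : IsOpen Ω) (hF : ContDiffOn ℝ (⊤ : ℕ∞) F Ω) :
    ContDiffOn ℝ (⊤ : ℕ∞) (dR F) Ω := by
  have h := ((contDiffOn_infty_iff_fderiv_of_isOpen hΩ).1 hF).2
  exact h.clm_apply contDiffOn_const

lemma dat (hΩ : IsOpen Ω) (hF : ContDiffOn ℝ (⊤ : ℕ∞) F Ω) {p : ℝ × ℝ} (hp : p ∈ Ω) :
    DifferentiableAt ℝ F p :=
  (hF.differentiableOn (by simp)).differentiableAt (hΩ.mem_nhds hp)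

lemma hdT (hΩ : IsOpen Ω) (hF : ContDiffOn ℝ (⊤ : ℕ∞) F Ω) {t r : ℝ} (hp : zr ∈ Ω) :
    HasDerivAt (fun s => F (s, r)) (dT F zr) t := by
  have h1 := (dat hΩ hF hp).hasFDerivAt
  have h2 : HasDerivAt (fun s : ℝ => (s, r)) ((1 : ℝ), (0 : ℝ)) t :=
    (hasDerivAt_id t).prodMk (hasDerivAt_const t r)
  exact h1.comp_hasDerivAt t h2

lemma hdR (hΩ : IsOpen Ω) (hF : ContDiffOn ℝ (⊤ : ℕ∞) F Ω) {t r : ℝ} (hp : zr ∈ Ω) :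
    HasDerivAt (fun s => F zs) (dR F zr) r := by
  have h1 := (dat hΩ hF hp).hasFDerivAt
  have h2 : HasDerivAt (fun s : ℝ => zs) ((0 : ℝ), (1 : ℝ)) r :=
    (hasDerivAt_const r t).prodMk (hasDerivAt_id r)
  exact h1.comp_hasDerivAt r h2

lemma dTR (hΩ : IsOpen Ω) (hF : ContDiffOn ℝ (⊤ : ℕ∞) F Ω) {p : ℝ × ℝ} (hp : p ∈ Ω) :
    dT (dR F) p = dR (dT F) p := by
  have h := ((contDiffOn_infty_iff_fderiv_of_isOpen hΩ).1 hF).2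
  have hd : DifferentiableAt ℝ (fderiv ℝ F) p :=
    (h.differentiableOn (by simp)).differentiableAt (hΩ.mem_nhds hp)
  have hs : IsSymmSndFDerivAt ℝ F p := by
    apply ContDiffAt.isSymmSndFDerivAt (n := (⊤ : ℕ∞)) (hF.contDiffAt (hΩ.mem_nhds hp))
    rw [minSmoothness_of_isRCLikeNormedField]; exact WithTop.coe_le_coe.2 le_top
  have e1 : fderiv ℝ (dR F) p = (fderiv ℝ (fderiv ℝ F) p).flip (0, 1) := by
    have := (hd.hasFDerivAt.clm_apply (hasFDerivAt_const ((0:ℝ),(1:ℝ)) p)).fderiv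
    unfold dR
    rw [this]; simp
  have e2 : fderiv ℝ (dT F) p = (fderiv ℝ (fderiv ℝ F) p).flip (1, 0) := by
    have := (hd.hasFDerivAt.clm_apply (hasFDerivAt_const ((1:ℝ),(0:ℝ)) p)).fderiv
    unfold dT
    rw [this]; simp
  rw [dT, dR, e1, e2]
  simpa using hs.eq (1, 0) (0, 1)

lemma param_bound {I : Set ℝ} (hI : IsOpen I) {α β : ℝ} {F' : ℝ → ℝ → ℝ}
    (hF' : ContinuousOn (fun p : ℝ × ℝ => F' p.1 p.2) (I ×ˢ Icc α β)) {t : ℝ} (ht : t ∈ I) :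
    ∃ s ∈ 𝓝 t, s ⊆ I ∧ ∃ C : ℝ, ∀ x ∈ s, ∀ r ∈ Icc α β, ‖F' x r‖ ≤ C := by
  obtain ⟨ε, hε, hb⟩ := Metric.isOpen_iff.1 hI t ht
  have hsub : Metric.closedBall t (ε / 2) ⊆ I :=
    (Metric.closedBall_subset_ball (by linarith)).trans hb
  refine ⟨Metric.closedBall t (ε/2), Metric.closedBall_mem_nhds t (by linarith), hsub, ?_⟩
  have hK : IsCompact (Metric.closedBall t (ε / 2) ×ˢ Icc α β) :=
    (isCompact_closedBall _ _).prod isCompact_Icc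
  obtain ⟨C, hC⟩ := hK.exists_bound_of_continuousOn (hF'.mono (prod_mono hsub le_rfl))
  exact ⟨C, fun x hx r hr => hC (x, r) ⟨hx, hr⟩⟩

lemma slice_cont {I S : Set ℝ} {F' : ℝ → ℝ → ℝ}
    (hF' : ContinuousOn (fun p : ℝ × ℝ => F' p.1 p.2) (I ×ˢ S)) {t : ℝ} (ht : t ∈ I) :
    ContinuousOn (F' t) S :=
  hF'.comp (f := fun r => zr) (by fun_prop) (fun r hr => ⟨ht, hr⟩)

lemma param_deriv {I : Set ℝ} (hI : IsOpen I) {α β : ℝ} (hab : α ≤ β) {F F' : ℝ → ℝ → ℝ}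
    (hF : ∀ t ∈ I, ContinuousOn (F t) (Icc α β))
    (hF' : ContinuousOn (fun p : ℝ × ℝ => F' p.1 p.2) (I ×ˢ Icc α β))
    (hd : ∀ t ∈ I, ∀ r ∈ Icc α β, HasDerivAt (fun s => F s r) (F' t r) t) {t : ℝ} (ht : t ∈ I) :
    HasDerivAt (fun s => ∫ r in α..β, F s r) (∫ r in α..β, F' t r) t := by
  obtain ⟨s, hs, hsI, C, hC⟩ := param_bound hI hF' ht
  have hu : uIcc α β = Icc α β := uIcc_of_le hab
  have hsub : Set.uIoc α β ⊆ Icc α β := by rw [uIoc_of_le hab]; exact Ioc_subset_Icc_self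
  have hint : ∀ x ∈ I, IntervalIntegrable (F x) volume α β := fun x hx =>
    ContinuousOn.intervalIntegrable (by rw [hu]; exact hF x hx)
  refine (intervalIntegral.hasDerivAt_integral_of_dominated_loc_of_deriv_le (bound := fun _ => C)
    hs ?_ (hint t ht) ?_ ?_ (by simp) ?_).2
  · filter_upwards [hI.mem_nhds ht] with x hx
    exact (intervalIntegrable_iff.1 (hint x hx)).aestronglyMeasurable
  · exact (intervalIntegrable_iff.1 (ContinuousOn.intervalIntegrable
      (by rw [hu]; exact slice_cont hF' ht))).aestronglyMeasurable
  · exact Eventually.of_forall fun r hr x hx => hC x hx r (hsub hr)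
  · exact Eventually.of_forall fun r hr x hx => hd x (hsI hx) r (hsub hr)

lemma param_cont {I : Set ℝ} (hI : IsOpen I) {α β : ℝ} (hab : α ≤ β) {F' : ℝ → ℝ → ℝ}
    (hF' : ContinuousOn (fun p : ℝ × ℝ => F' p.1 p.2) (I ×ˢ Icc α β)) :
    ContinuousOn (fun t => ∫ r in α..β, F' t r) I := by
  intro t ht
  obtain ⟨s, hs, hsI, C, hC⟩ := param_bound hI hF' ht
  have hu : uIcc α β = Icc α β := uIcc_of_le hab
  have hsub : Set.uIoc α β ⊆ Icc α β := by rw [uIoc_of_le hab]; exact Ioc_subset_Icc_self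
  apply ContinuousAt.continuousWithinAt
  refine intervalIntegral.continuousAt_of_dominated_interval (bound := fun _ => C) ?_ ?_ (by simp) ?_
  · filter_upwards [hI.mem_nhds ht] with x hx
    exact (intervalIntegrable_iff.1 (ContinuousOn.intervalIntegrable
      (by rw [hu]; exact slice_cont hF' hx))).aestronglyMeasurable
  · filter_upwards [hs] with x hx
    exact Eventually.of_forall fun r hr => hC x hx r (hsub hr)
  · refine Eventually.of_forall fun r hr => ?_
    have h1 : ContinuousWithinAt (fun x => F' x r) I t :=
      (hF' zr ⟨ht, hsub hr⟩).comp (f := fun x => (x, r)) (by fun_prop)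
        (fun x hx => ⟨hx, hsub hr⟩)
    exact h1.continuousAt (hI.mem_nhds ht)

end
end CSSP

namespace CSSP
noncomputable section
open scoped ContDiff Topology

abbrev II : Set ℝ := Ioo (-1 : ℝ) 0

def rho (p q : ℝ × ℝ → ℝ) (z : ℝ × ℝ) : ℝ := p z ^ 2 + q z ^ 2
def Jc (p q : ℝ × ℝ → ℝ) (z : ℝ × ℝ) : ℝ := p z * dR q z - q z * dR p z
def Mf (p q : ℝ × ℝ → ℝ) (t r : ℝ) : ℝ := 1 / 2 * ∫ s in (0:ℝ)..r, rho p q zs * s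
def av (m : ℕ) (p q : ℝ × ℝ → ℝ) (z : ℝ × ℝ) : ℝ := m - Mf p q z.1 z.2
def Av (m : ℕ) (p q : ℝ × ℝ → ℝ) (z : ℝ × ℝ) : ℝ :=
  -∫ s in Ioi z.2, av m p q (z.1, s) * rho p q (z.1, s) / s
def Wv (m : ℕ) (p q : ℝ × ℝ → ℝ) (z : ℝ × ℝ) : ℝ :=
  (av m p q z) ^ 2 / z.2 ^ 2 + Av m p q z - rho p q z

structure Dat (m : ℕ) (p q : ℝ × ℝ → ℝ) : Prop where
  hm : 1 ≤ m
  ps : ContDiffOn ℝ (⊤ : ℕ∞) p (II ×ˢ univ)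
  qs : ContDiffOn ℝ (⊤ : ℕ∞) q (II ×ˢ univ)
  p0 : ∀ t ∈ II, p (t, 0) = 0
  q0 : ∀ t ∈ II, q (t, 0) = 0
  int : ∀ t ∈ II, IntegrableOn (fun r => rpq * r) (Ioi 0)
  mass : ∀ t ∈ II, ∫ r in Ioi (0:ℝ), rpq * r = 4 * (m + 1)
  eqp : ∀ t ∈ II, ∀ r : ℝ, 0 < r → dT p zr =
    -dR (dR q) zr - dR q zr / r + Wv m p q zr * q zr
  eqq : ∀ t ∈ II, ∀ r : ℝ, 0 < r → dT q zr =
    dR (dR p) zr + dR p zr / r - Wv m p q zr * p zr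

lemma isOpen_IU : IsOpen (II ×ˢ (univ : Set ℝ)) := isOpen_Ioo.prod isOpen_univ

structure Link (p q : ℝ × ℝ → ℝ) (u : ℝ → ℝ → ℂ) : Prop where
  eq : ∀ t ∈ II, ∀ r : ℝ, 0 < r → u t r = (p zr : ℂ) + (q zr : ℂ) * Complex.I

section
variable {p q : ℝ × ℝ → ℝ} {u : ℝ → ℝ → ℂ} {m : ℕ}

lemma hasDerivAt_mk {f g : ℝ → ℝ} {f' g' x : ℝ} (hf : HasDerivAt f f' x) (hg : HasDerivAt g g' x) :
    HasDerivAt (fun y => (f y : ℂ) + (g y : ℂ) * Complex.I) ((f' : ℂ) + (g' : ℂ) * Complex.I) x :=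
  hf.ofReal_comp.add (hg.ofReal_comp.mul_const _)

lemma Link.deriv (h : Link p q u) (ps : ContDiffOn ℝ (⊤ : ℕ∞) p (II ×ˢ univ))
    (qs : ContDiffOn ℝ (⊤ : ℕ∞) q (II ×ˢ univ)) : ∀ t ∈ II, ∀ r : ℝ, 0 < r →
    deriv (u t) r = (dR p zr : ℂ) + (dR q zr : ℂ) * Complex.I := by
  intro t ht r hr
  have hz : zr ∈ II ×ˢ (univ : Set ℝ) := ⟨ht, trivial⟩
  have := hasDerivAt_mk (hdR isOpen_IU ps hz) (hdR isOpen_IU qs hz)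
  rw [← this.deriv]
  apply Filter.EventuallyEq.deriv_eq
  filter_upwards [Ioi_mem_nhds hr] with s hs
  exact h.eq t ht s hs

lemma Link.norm (h : Link p q u) : ∀ t ∈ II, ∀ r : ℝ, 0 < r → ‖u t r‖ ^ 2 = rpq := by
  intro t ht r hr
  rw [h.eq t ht r hr, Complex.sq_norm, Complex.normSq_add_mul_I]; rfl

lemma Link.norm_deriv (h : Link p q u) (ps : ContDiffOn ℝ (⊤ : ℕ∞) p (II ×ˢ univ))
    (qs : ContDiffOn ℝ (⊤ : ℕ∞) q (II ×ˢ univ)) : ∀ t ∈ II, ∀ r : ℝ, 0 < r →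
    ‖_root_.deriv (u t) r‖ ^ 2 = dR p zr ^ 2 + dR q zr ^ 2 := by
  intro t ht r hr
  rw [h.deriv ps qs t ht r hr, Complex.sq_norm, Complex.normSq_add_mul_I]

lemma Link.Atheta (h : Link p q u) : ∀ t ∈ II, ∀ r : ℝ, 0 < r →
    (m : ℝ) + Atheta (u t) r = apq := by
  intro t ht r hr
  unfold _root_.Atheta av Mf
  have : ∫ s in (0:ℝ)..r, ‖u t s‖ ^ 2 * s = ∫ s in (0:ℝ)..r, rho p q zs * s := by
    rw [intervalIntegral.integral_of_le hr.le, intervalIntegral.integral_of_le hr.le]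
    refine setIntegral_congr_fun measurableSet_Ioc fun s hs => ?_
    simp only [h.norm t ht s hs.1]
  rw [this]; ring

lemma Link.At (h : Link p q u) : ∀ t ∈ II, ∀ r : ℝ, 0 < r →
    At m (u t) r = Av m p q zr := by
  intro t ht r hr
  unfold _root_.At Av
  congr 1
  refine setIntegral_congr_fun mI fun s hs => ?_
  have hs0 : 0 < s := hr.trans hs
  simp only [h.norm t ht s hs0, h.Atheta t ht s hs0]

lemma exists_dat (hm : 1 ≤ m) (hu : IsCSS m (Set.Ioo (-1 : ℝ) 0) u)
    (hmass : ∀ t ∈ Set.Ioo (-1 : ℝ) 0, L2sq (u t) = 8 * Real.pi * (m + 1)) :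
    ∃ p q, Dat m p q ∧ Link p q u := by
  obtain ⟨U, hU, hUu⟩ := hu.equivariant
  set w : ℝ × ℝ → ℂ := fun z => U z.1 (z.2, 0) with hw
  have hws : ContDiffOn ℝ (⊤ : ℕ∞) w (II ×ˢ univ) := by
    have : ContDiff ℝ (⊤ : ℕ∞) (fun z : ℝ × ℝ => (z.1, (z.2, (0:ℝ)))) := by fun_prop
    exact hU.comp this.contDiffOn (fun z hz => ⟨hz.1, trivial⟩)
  have hwu : ∀ t ∈ II, ∀ r : ℝ, 0 < r → u t r = w zr := by
    intro t ht r hr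
    have := hUu t ht (r, 0) (by simp [hr.ne'])
    have h2 : Real.sqrt (r ^ 2 + 0 ^ 2) = r := by simp [Real.sqrt_sq hr.le]
    simp only [hw, this, h2]
    have : (r : ℂ) ≠ 0 := by exact_mod_cast hr.ne'
    simp [this]
  have hw0 : ∀ t ∈ II, w (t, 0) = 0 := by
    intro t ht
    have hUc : Continuous (fun x => U t x) := by
      rw [← continuousOn_univ]
      exact hU.continuousOn.comp (f := fun x : ℝ × ℝ => (t, x)) (by fun_prop) (fun x _ => ⟨ht, trivial⟩)
    have hm0 : (m : ℝ) ≠ 0 := by positivity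
    have key : ∀ r : ℝ, 0 < r →
        U t (r * Real.cos (Real.pi / m), r * Real.sin (Real.pi / m)) = - U t (r, 0) := by
      intro r hr
      have hsq : Real.sqrt ((r * Real.cos (Real.pi / m)) ^ 2 + (r * Real.sin (Real.pi / m)) ^ 2) = r := by
        rw [show (r * Real.cos (Real.pi / m)) ^ 2 + (r * Real.sin (Real.pi / m)) ^ 2
          = r ^ 2 * (Real.sin (Real.pi / m) ^ 2 + Real.cos (Real.pi / m) ^ 2) by ring,
          Real.sin_sq_add_cos_sq, mul_one, Real.sqrt_sq hr.le]
      have hne : (r * Real.cos (Real.pi / m), r * Real.sin (Real.pi / m)) ≠ (0 : ℝ × ℝ) := by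
        intro h
        rw [Prod.ext_iff] at h
        simp only [Prod.fst_zero, Prod.snd_zero] at h
        rw [h.1, h.2] at hsq
        simp at hsq; exact hr.ne hsq
      have hrc : (r : ℂ) ≠ 0 := by exact_mod_cast hr.ne'
      have := hUu t ht _ hne
      rw [this, hsq]
      have h3 := hwu t ht r hr
      simp only [hw] at h3
      rw [← h3]
      have : (((r * Real.cos (Real.pi / m) : ℝ) : ℂ) + ((r * Real.sin (Real.pi / m) : ℝ) : ℂ) * Complex.I) / (r : ℂ)
          = Complex.exp ((Real.pi / m : ℝ) * Complex.I) := by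
        rw [Complex.exp_mul_I]
        push_cast; field_simp
      rw [this, ← Complex.exp_nat_mul]
      have : (m : ℂ) * (((Real.pi / m : ℝ) : ℂ) * Complex.I) = Real.pi * Complex.I := by
        have : (m : ℂ) ≠ 0 := by exact_mod_cast hm0
        push_cast; field_simp
      rw [this, Complex.exp_pi_mul_I]; ring
    have l1 : Tendsto (fun r : ℝ => U t (r * Real.cos (Real.pi / m), r * Real.sin (Real.pi / m)))
        (𝓝[>] 0) (𝓝 (U t (0, 0))) := by
      have : Continuous (fun r : ℝ => U t (r * Real.cos (Real.pi / m), r * Real.sin (Real.pi / m))) := by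
        fun_prop
      simpa using (this.tendsto 0).mono_left nhdsWithin_le_nhds
    have l2 : Tendsto (fun r : ℝ => - U t (r, 0)) (𝓝[>] 0) (𝓝 (- U t (0, 0))) := by
      have : Continuous (fun r : ℝ => - U t (r, 0)) := by fun_prop
      exact (this.tendsto 0).mono_left nhdsWithin_le_nhds
    have l3 := tendsto_nhds_unique (l1.congr' (by
      filter_upwards [self_mem_nhdsWithin] with r hr using key r hr)) l2
    simp only [hw]
    have : (2:ℂ) * U t (0, 0) = 0 := by linear_combination l3
    simpa using this
  refine ⟨fun z => (w z).re, fun z => (w z).im, ?_⟩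
  have hps : ContDiffOn ℝ (⊤ : ℕ∞) (fun z => (w z).re) (II ×ˢ univ) :=
    Complex.reCLM.contDiff.comp_contDiffOn hws
  have hqs : ContDiffOn ℝ (⊤ : ℕ∞) (fun z => (w z).im) (II ×ˢ univ) :=
    Complex.imCLM.contDiff.comp_contDiffOn hws
  set p : ℝ × ℝ → ℝ := fun z => (w z).re with hp
  set q : ℝ × ℝ → ℝ := fun z => (w z).im with hq
  have L : Link p q u := ⟨fun t ht r hr => by
    rw [hwu t ht r hr, hp, hq]; simp [Complex.re_add_im]⟩
  have hEq : ∀ t ∈ II, ∀ r : ℝ, 0 < r → dT p zr =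
    -dR (dR q) zr - dR q zr / r + Wv m p q zr * q zr ∧ dT q zr =
    dR (dR p) zr + dR p zr / r - Wv m p q zr * p zr := by
    intro t ht r hr
    have hz : zr ∈ II ×ˢ (univ : Set ℝ) := ⟨ht, trivial⟩
    have e := hu.eq t ht r hr
    unfold CSSeq at e
    have d1 : deriv (fun s => u s r) t = (dT p zr : ℂ) + (dT q zr : ℂ) * Complex.I := by
      rw [← (hasDerivAt_mk (hdT isOpen_IU hps hz) (hdT isOpen_IU hqs hz)).deriv]
      apply Filter.EventuallyEq.deriv_eq
      filter_upwards [isOpen_Ioo.mem_nhds ht] with s hs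
      exact L.eq s hs r hr
    have d2 : deriv (deriv (u t)) r
        = (dR (dR p) zr : ℂ) + (dR (dR q) zr : ℂ) * Complex.I := by
      rw [← (hasDerivAt_mk (hdR isOpen_IU (dR_smooth isOpen_IU hps) hz)
        (hdR isOpen_IU (dR_smooth isOpen_IU hqs) hz)).deriv]
      apply Filter.EventuallyEq.deriv_eq
      filter_upwards [Ioi_mem_nhds hr] with s hs
      exact L.deriv hps hqs t ht s hs
    have hn : ((‖u t r‖ : ℝ) : ℂ) ^ 2 = (rpq : ℂ) := by
      rw [← L.norm t ht r hr]; push_cast; rfl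
    have hrc : (1 / (r : ℂ)) = ((1 / r : ℝ) : ℂ) := by push_cast; rfl
    rw [d1, d2, L.deriv hps hqs t ht r hr, hn, L.Atheta t ht r hr, L.At t ht r hr, L.eq t ht r hr,
      hrc, ← Complex.ofReal_pow] at e
    have er := congrArg Complex.re e
    have ei := congrArg Complex.im e
    simp only [Complex.add_re, Complex.sub_re, Complex.mul_re, Complex.I_re, Complex.I_im,
      Complex.ofReal_re, Complex.ofReal_im, Complex.add_im, Complex.sub_im, Complex.mul_im,
      Complex.zero_re, Complex.zero_im] at er ei
    unfold Wv
    simp only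
    constructor
    · linear_combination ei
    · linear_combination -er
  refine ⟨⟨hm, hps, hqs, fun t ht => by simp [hp, hw0 t ht], fun t ht => by simp [hq, hw0 t ht],
    ?_, ?_, fun t ht r hr => (hEq t ht r hr).1, fun t ht r hr => (hEq t ht r hr).2⟩, L⟩
  · intro t ht
    refine (hu.integrable t ht).congr_fun (fun r hr => ?_) mI
    simp only [L.norm t ht r hr]
  · intro t ht
    have h1 := hmass t ht
    have h2 : ∫ r in Ioi (0:ℝ), ‖u t r‖ ^ 2 * r = ∫ r in Ioi (0:ℝ), rpq * r := by
      refine setIntegral_congr_fun mI fun r hr => ?_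
      simp only [L.norm t ht r hr]
    rw [L2sq, h2] at h1
    have := Real.pi_pos
    have h3 : 2 * Real.pi * ((∫ r in Ioi (0:ℝ), rpq * r) - 4 * (m + 1)) = 0 := by
      linear_combination h1
    rcases mul_eq_zero.1 h3 with h | h
    · linarith
    · linarith

end
end
end CSSP

namespace CSSP
noncomputable section
open scoped ContDiff Topology

lemma smooth_of_partials {Ω : Set (ℝ × ℝ)} (hΩ : IsOpen Ω) {F f1 f2 : ℝ × ℝ → ℝ}
    (h1 : ∀ z ∈ Ω, HasDerivAt (fun s => F (s, z.2)) (f1 z) z.1)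
    (h2 : ∀ z ∈ Ω, HasDerivAt (fun s => F (z.1, s)) (f2 z) z.2)
    (s1 : ContDiffOn ℝ (⊤ : ℕ∞) f1 Ω) (s2 : ContDiffOn ℝ (⊤ : ℕ∞) f2 Ω) :
    ContDiffOn ℝ (⊤ : ℕ∞) F Ω ∧ ∀ z ∈ Ω, dT F z = f1 z ∧ dR F z = f2 z := by
  have c1 : ContDiff ℝ (⊤ : ℕ∞) (fun x : ℝ => ContinuousLinearMap.toSpanSingleton ℝ x) :=
    (ContinuousLinearMap.toSpanSingletonCLE (𝕜 := ℝ) (E := ℝ)).contDiff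
  have key : ∀ z ∈ Ω, HasFDerivAt F ((ContinuousLinearMap.toSpanSingleton ℝ (f1 z)).coprod
      (ContinuousLinearMap.toSpanSingleton ℝ (f2 z))) z := by
    intro z hz
    have := hasStrictFDerivAt_uncurry_coprod (𝕜 := ℝ) (u := z) (f := fun a b => F (a, b))
      (f₁ := fun a b => ContinuousLinearMap.toSpanSingleton ℝ (f1 (a, b)))
      (f₂ := fun a b => ContinuousLinearMap.toSpanSingleton ℝ (f2 (a, b))) ?_ ?_ ?_ ?_
    · exact this.hasFDerivAt
    · filter_upwards [hΩ.mem_nhds hz] with v hv using (h1 v hv).hasFDerivAt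
    · filter_upwards [hΩ.mem_nhds hz] with v hv using (h2 v hv).hasFDerivAt
    · exact c1.continuous.continuousAt.comp (s1.continuousOn.continuousAt (hΩ.mem_nhds hz))
    · exact c1.continuous.continuousAt.comp (s2.continuousOn.continuousAt (hΩ.mem_nhds hz))
  refine ⟨?_, fun z hz => ?_⟩
  · refine (contDiffOn_infty_iff_fderiv_of_isOpen hΩ).2
      ⟨fun z hz => (key z hz).differentiableAt.differentiableWithinAt, ?_⟩
    have : ContDiffOn ℝ (⊤ : ℕ∞) (fun z => (f1 z) • ContinuousLinearMap.fst ℝ ℝ ℝ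
      + (f2 z) • ContinuousLinearMap.snd ℝ ℝ ℝ) Ω := by
      exact (s1.smul contDiffOn_const).add (s2.smul contDiffOn_const)
    refine this.congr fun z hz => ?_
    rw [(key z hz).fderiv]
    ext <;> simp
  · rw [dT, dR, (key z hz).fderiv]; simp

section gen
variable {I S : Set ℝ} {p q W W1 : ℝ × ℝ → ℝ} {α β c0 : ℝ}

structure Gen (I S : Set ℝ) (p q W : ℝ × ℝ → ℝ) : Prop where
  hI : IsOpen I
  hS : IsOpen S
  ps : ContDiffOn ℝ (⊤ : ℕ∞) p (I ×ˢ S)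
  qs : ContDiffOn ℝ (⊤ : ℕ∞) q (I ×ˢ S)
  eqp : ∀ t ∈ I, ∀ r ∈ S, 0 < r → dT p zr =
    -dR (dR q) zr - dR q zr / r + W zr * q zr
  eqq : ∀ t ∈ I, ∀ r ∈ S, 0 < r → dT q zr =
    dR (dR p) zr + dR p zr / r - W zr * p zr

lemma Gen.op (h : Gen I S p q W) : IsOpen (I ×ˢ S) := h.hI.prod h.hS

lemma Gen.cont (h : Gen I S p q W) :
    ContinuousOn p (I ×ˢ S) ∧ ContinuousOn q (I ×ˢ S) ∧
    ContinuousOn (dR p) (I ×ˢ S) ∧ ContinuousOn (dR q) (I ×ˢ S) ∧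
    ContinuousOn (dT p) (I ×ˢ S) ∧ ContinuousOn (dT q) (I ×ˢ S) ∧
    ContinuousOn (dR (dR p)) (I ×ˢ S) ∧ ContinuousOn (dR (dR q)) (I ×ˢ S) ∧
    ContinuousOn (dT (dR p)) (I ×ˢ S) ∧ ContinuousOn (dT (dR q)) (I ×ˢ S) :=
  ⟨h.ps.continuousOn, h.qs.continuousOn, (dR_smooth h.op h.ps).continuousOn,
    (dR_smooth h.op h.qs).continuousOn, (dT_smooth h.op h.ps).continuousOn,
    (dT_smooth h.op h.qs).continuousOn, (dR_smooth h.op (dR_smooth h.op h.ps)).continuousOn,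
    (dR_smooth h.op (dR_smooth h.op h.qs)).continuousOn,
    (dT_smooth h.op (dR_smooth h.op h.ps)).continuousOn,
    (dT_smooth h.op (dR_smooth h.op h.qs)).continuousOn⟩

lemma csnd {f : ℝ → ℝ} (hf : Continuous f) (A : Set (ℝ × ℝ)) :
    ContinuousOn (fun z : ℝ × ℝ => f z.2) A := (hf.comp continuous_snd).continuousOn

lemma Gen.J_deriv (h : Gen I S p q W) {t r : ℝ} (ht : t ∈ I) (hr : r ∈ S) :
    HasDerivAt (fun s => Jc p q zs)
      (p zr * dR (dR q) zr - q zr * dR (dR p) zr) r := by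
  have hz : zr ∈ I ×ˢ S := ⟨ht, hr⟩
  have := ((hdR h.op h.ps hz).mul (hdR h.op (dR_smooth h.op h.qs) hz)).sub
    ((hdR h.op h.qs hz).mul (hdR h.op (dR_smooth h.op h.ps) hz))
  exact this.congr_deriv (by ring)

lemma Gen.I1 (h : Gen I S p q W) (hα : 0 ≤ α) (hab : α ≤ β) (hsub : Icc α β ⊆ S)
    {θ θ' : ℝ → ℝ} (hθ : ∀ r, HasDerivAt θ (θ' r) r) (hθ' : Continuous θ') {t : ℝ} (ht : t ∈ I) :
    HasDerivAt (fun s => ∫ r in α..β, θ r * rho p q (s, r) * r)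
      (2 * (∫ r in α..β, θ' r * r * Jc p q zr)
        - 2 * (θ β * β * Jc p q (t, β) - θ α * α * Jc p q (t, α))) t := by
  obtain ⟨c1, c2, c3, c4, c5, c6, c7, c8, c9, c10⟩ := h.cont
  have cθ : Continuous θ := continuous_iff_continuousAt.2 fun r => (hθ r).continuousAt
  have hs2 : I ×ˢ Icc α β ⊆ I ×ˢ S := prod_mono le_rfl hsub
  have cθ2 := csnd cθ (I ×ˢ S)
  have cθ2' := csnd hθ' (I ×ˢ S)
  have D := param_deriv (F := fun s r => θ r * rho p q (s, r) * r)
    (F' := fun s r => θ r * (2 * p (s, r) * dT p (s, r) + 2 * q (s, r) * dT q (s, r)) * r)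
    h.hI hab ?_ ?_ ?_ ht
  · refine D.congr_deriv ?_
    have cJ : ContinuousOn (fun z => Jc p q z) (I ×ˢ S) := by unfold Jc; fun_prop
    have cJ' : ContinuousOn (fun r => Jc p q zr) (Icc α β) :=
      (slice_cont (F' := fun a b => Jc p q (a, b)) cJ ht).mono hsub
    have i1 : IntervalIntegrable (fun r => 2 * (θ' r * r * Jc p q zr)) volume α β := by
      apply ContinuousOn.intervalIntegrable
      rw [uIcc_of_le hab]; fun_prop
    have c11 : ContinuousOn (fun r => θ r *
        (2 * p zr * dT p zr + 2 * q zr * dT q zr) * r) (Icc α β) := by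
      refine (slice_cont (S := S) (F' := fun s r => θ r *
        (2 * p (s, r) * dT p (s, r) + 2 * q (s, r) * dT q (s, r)) * r) ?_ ht).mono hsub
      show ContinuousOn (fun z : ℝ × ℝ => θ z.2 * (2 * p z * dT p z + 2 * q z * dT q z) * z.2) _
      fun_prop
    have i2 : IntervalIntegrable (fun r => θ r *
        (2 * p zr * dT p zr + 2 * q zr * dT q zr) * r) volume α β := by
      apply ContinuousOn.intervalIntegrable
      rwa [uIcc_of_le hab]
    have F := intervalIntegral.integral_eq_sub_of_hasDerivAt_of_le
      (f := fun r => -2 * (θ r * r * Jc p q zr)) (f' := fun r => θ r *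
        (2 * p zr * dT p zr + 2 * q zr * dT q zr) * r
          - 2 * (θ' r * r * Jc p q zr))
      hab ?_ ?_ (i2.sub i1)
    · rw [intervalIntegral.integral_sub i2 i1, intervalIntegral.integral_const_mul] at F
      linarith
    · fun_prop
    · intro r hr
      have hrS : r ∈ S := hsub (Ioo_subset_Icc_self hr)
      have hr0 : 0 < r := hα.trans_lt hr.1
      have := (((hθ r).mul (hasDerivAt_id r)).mul (h.J_deriv ht hrS)).const_mul (-2)
      refine this.congr_deriv ?_
      rw [h.eqp t ht r hrS hr0, h.eqq t ht r hrS hr0]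
      unfold Jc; simp only [id, Pi.mul_apply]; field_simp; ring
  · intro s hs
    refine (slice_cont (S := S) (F' := fun s r => θ r * rho p q (s, r) * r) ?_ hs).mono hsub
    show ContinuousOn (fun z : ℝ × ℝ => θ z.2 * rho p q z * z.2) _
    unfold rho; fun_prop
  · refine ContinuousOn.mono ?_ hs2
    show ContinuousOn (fun z : ℝ × ℝ => θ z.2 * (2 * p z * dT p z + 2 * q z * dT q z) * z.2) _
    fun_prop
  · intro s hs r hr
    have hz : (s, r) ∈ I ×ˢ S := ⟨hs, hsub hr⟩
    have := (((((hdT h.op h.ps hz).pow 2).add ((hdT h.op h.qs hz).pow 2)).const_mul (θ r)).mul_const r)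
    exact this.congr_deriv (by push_cast; ring)

def Jt (p q : ℝ × ℝ → ℝ) (z : ℝ × ℝ) : ℝ :=
  dT p z * dR q z + p z * dT (dR q) z - dT q z * dR p z - q z * dT (dR p) z

def Bv (c0 : ℝ) (ψ ψ' : ℝ → ℝ) (p q : ℝ × ℝ → ℝ) (z : ℝ × ℝ) : ℝ :=
  ψ z.2 * (p z * dT q z - q z * dT p z) - ψ' z.2 * (p z * dR p z + q z * dR q z)
    - ψ z.2 * (dR p z ^ 2 + dR q z ^ 2) - 1 / 2 * c0 * ψ z.2 * rho p q z ^ 2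

def Gv (c0 : ℝ) (ψ ψ' ψ'' : ℝ → ℝ) (W1 p q : ℝ × ℝ → ℝ) (z : ℝ × ℝ) : ℝ :=
  2 * (ψ' z.2 - ψ z.2 / z.2) * (dR p z ^ 2 + dR q z ^ 2)
    + (ψ'' z.2 - ψ' z.2 / z.2) * (p z * dR p z + q z * dR q z)
    + W1 z * (ψ' z.2 * rho p q z + 2 * ψ z.2 * (p z * dR p z + q z * dR q z))
    - 1 / 2 * c0 * ψ' z.2 * rho p q z ^ 2

lemma Gen.Jt_cont (h : Gen I S p q W) : ContinuousOn (Jt p q) (I ×ˢ S) := by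
  obtain ⟨c1, c2, c3, c4, c5, c6, c7, c8, c9, c10⟩ := h.cont
  unfold Jt; fun_prop

lemma Gen.J_cont (h : Gen I S p q W) : ContinuousOn (Jc p q) (I ×ˢ S) := by
  obtain ⟨c1, c2, c3, c4, c5, c6, c7, c8, c9, c10⟩ := h.cont
  unfold Jc; fun_prop

lemma Gen.sl {F : ℝ × ℝ → ℝ} (hF : ContinuousOn F (I ×ˢ S)) {t : ℝ} (ht : t ∈ I)
    (hsub : Icc α β ⊆ S) : ContinuousOn (fun r => F zr) (Icc α β) :=
  (slice_cont (F' := fun a b => F (a, b)) hF ht).mono hsub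

lemma Gen.I2 (h : Gen I S p q W) (hab : α ≤ β) (hsub : Icc α β ⊆ S)
    {ψ : ℝ → ℝ} (cψ : Continuous ψ) {t : ℝ} (ht : t ∈ I) :
    HasDerivAt (fun s => ∫ r in α..β, ψ r * Jc p q (s, r))
      (∫ r in α..β, ψ r * Jt p q zr) t := by
  have hs2 : I ×ˢ Icc α β ⊆ I ×ˢ S := prod_mono le_rfl hsub
  refine param_deriv (F := fun s r => ψ r * Jc p q (s, r))
    (F' := fun s r => ψ r * Jt p q (s, r)) h.hI hab ?_ ?_ ?_ ht
  · intro s hs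
    have := Gen.sl h.J_cont hs hsub
    fun_prop
  · exact (csnd cψ _).mul (h.Jt_cont.mono hs2)
  · intro s hs r hr
    have hz : (s, r) ∈ I ×ˢ S := ⟨hs, hsub hr⟩
    have := (((hdT h.op h.ps hz).mul (hdT h.op (dR_smooth h.op h.qs) hz)).sub
      ((hdT h.op h.qs hz).mul (hdT h.op (dR_smooth h.op h.ps) hz))).const_mul (ψ r)
    exact this.congr_deriv (by unfold Jt; ring)

lemma Gen.I2' (h : Gen I S p q W) (hab : α ≤ β) (hsub : Icc α β ⊆ S)
    {ψ ψ' ψ'' : ℝ → ℝ} (hψ : ∀ r, HasDerivAt ψ (ψ' r) r) (hψ' : ∀ r, HasDerivAt ψ' (ψ'' r) r)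
    (cψ'' : Continuous ψ'') (hW : ∀ t ∈ I, ∀ r ∈ S, 0 < r → W zr = W1 zr - c0 * rpq)
    {t : ℝ} (ht : t ∈ I) :
    ∃ G : ℝ → ℝ, ContinuousOn G (Icc α β) ∧
      (∀ r ∈ Icc α β, 0 < r → G r = Gv c0 ψ ψ' ψ'' W1 p q zr) ∧
      ∫ r in α..β, ψ r * Jt p q zr =
        Bv c0 ψ ψ' p q (t, β) - Bv c0 ψ ψ' p q (t, α) + ∫ r in α..β, G r := by
  obtain ⟨c1, c2, c3, c4, c5, c6, c7, c8, c9, c10⟩ := h.cont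
  have cψ : Continuous ψ := continuous_iff_continuousAt.2 fun r => (hψ r).continuousAt
  have cψ' : Continuous ψ' := continuous_iff_continuousAt.2 fun r => (hψ' r).continuousAt
  have d11 := Gen.sl h.Jt_cont ht hsub
  set B' : ℝ → ℝ := fun r =>
    ψ' r * (p zr * dT q zr - q zr * dT p zr)
    + ψ r * (dR p zr * dT q zr + p zr * dT (dR q) zr
       - dR q zr * dT p zr - q zr * dT (dR p) zr)
    - ψ'' r * (p zr * dR p zr + q zr * dR q zr)
    - ψ' r * (dR p zr ^ 2 + dR q zr ^ 2
        + p zr * dR (dR p) zr + q zr * dR (dR q) zr)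
    - ψ' r * (dR p zr ^ 2 + dR q zr ^ 2)
    - ψ r * (2 * dR p zr * dR (dR p) zr + 2 * dR q zr * dR (dR q) zr)
    - 1 / 2 * c0 * ψ' r * (p zr ^ 2 + q zr ^ 2) ^ 2
    - c0 * ψ r * (p zr ^ 2 + q zr ^ 2)
        * (2 * p zr * dR p zr + 2 * q zr * dR q zr) with hB'
  have cB' : ContinuousOn B' (Icc α β) := by
    have k0 := csnd cψ (I ×ˢ S)
    have k1 := csnd cψ' (I ×ˢ S)
    have k2 := csnd cψ'' (I ×ˢ S)
    have : ContinuousOn (fun z : ℝ × ℝ =>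
    ψ' z.2 * (p z * dT q z - q z * dT p z)
    + ψ z.2 * (dR p z * dT q z + p z * dT (dR q) z
       - dR q z * dT p z - q z * dT (dR p) z)
    - ψ'' z.2 * (p z * dR p z + q z * dR q z)
    - ψ' z.2 * (dR p z ^ 2 + dR q z ^ 2
        + p z * dR (dR p) z + q z * dR (dR q) z)
    - ψ' z.2 * (dR p z ^ 2 + dR q z ^ 2)
    - ψ z.2 * (2 * dR p z * dR (dR p) z + 2 * dR q z * dR (dR q) z)
    - 1 / 2 * c0 * ψ' z.2 * (p z ^ 2 + q z ^ 2) ^ 2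
    - c0 * ψ z.2 * (p z ^ 2 + q z ^ 2)
        * (2 * p z * dR p z + 2 * q z * dR q z)) (I ×ˢ S) := by fun_prop
    exact Gen.sl this ht hsub
  have hB : ∀ r ∈ Icc α β, HasDerivAt (fun s => Bv c0 ψ ψ' p q zs) (B' r) r := by
    intro r hr
    have hz : zr ∈ I ×ˢ S := ⟨ht, hsub hr⟩
    have hp := hdR h.op h.ps hz
    have hq := hdR h.op h.qs hz
    have hpr := hdR h.op (dR_smooth h.op h.ps) hz
    have hqr := hdR h.op (dR_smooth h.op h.qs) hz
    have hpt := hdR h.op (dT_smooth h.op h.ps) hz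
    have hqt := hdR h.op (dT_smooth h.op h.qs) hz
    rw [← dTR h.op h.ps hz] at hpt
    rw [← dTR h.op h.qs hz] at hqt
    have := ((((hψ r).mul ((hp.mul hqt).sub (hq.mul hpt))).sub
      ((hψ' r).mul ((hp.mul hpr).add (hq.mul hqr)))).sub
      ((hψ r).mul ((hpr.pow 2).add (hqr.pow 2)))).sub
      (((hψ r).const_mul (1 / 2 * c0)).mul (((hp.pow 2).add (hq.pow 2)).pow 2))
    refine this.congr_deriv ?_
    simp only [hB', Pi.add_apply, Pi.mul_apply, Pi.sub_apply, Pi.pow_apply]; push_cast; ring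
  refine ⟨fun r => ψ r * Jt p q zr - B' r, by fun_prop, ?_, ?_⟩
  · intro r hr hr0
    have e1 := h.eqp t ht r (hsub hr) hr0
    have e2 := h.eqq t ht r (hsub hr) hr0
    rw [hW t ht r (hsub hr) hr0] at e1 e2
    simp only [hB', Gv, Jt, rho] at e1 e2 ⊢
    rw [e1, e2]
    field_simp
    ring
  · have i1 : IntervalIntegrable B' volume α β := by
      apply ContinuousOn.intervalIntegrable
      rwa [uIcc_of_le hab]
    have i2 : IntervalIntegrable (fun r => ψ r * Jt p q zr) volume α β := by
      apply ContinuousOn.intervalIntegrable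
      rw [uIcc_of_le hab]; fun_prop
    rw [intervalIntegral.integral_sub i2 i1,
      intervalIntegral.integral_eq_sub_of_hasDerivAt (f := fun s => Bv c0 ψ ψ' p q zs)
      (by rw [uIcc_of_le hab]; exact hB) i1]
    ring

end gen
end
end CSSP

namespace CSSP
noncomputable section
open scoped ContDiff Topology

abbrev OM : Set (ℝ × ℝ) := II ×ˢ Ioi (0:ℝ)
lemma isOpen_OM : IsOpen OM := isOpen_Ioo.prod isOpen_Ioi

section
variable {p q : ℝ × ℝ → ℝ} {m : ℕ}

lemma rho_nonneg (z : ℝ × ℝ) : 0 ≤ rho p q z := by unfold rho; positivity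

lemma Dat.gen (h : Dat m p q) : Gen II univ p q (Wv m p q) where
  hI := isOpen_Ioo
  hS := isOpen_univ
  ps := h.ps
  qs := h.qs
  eqp := fun t ht r _ hr => h.eqp t ht r hr
  eqq := fun t ht r _ hr => h.eqq t ht r hr

lemma Dat.rho_sm (h : Dat m p q) : ContDiffOn ℝ (⊤ : ℕ∞) (rho p q) (II ×ˢ univ) :=
  (h.ps.pow 2).add (h.qs.pow 2)

lemma Dat.J_sm (h : Dat m p q) : ContDiffOn ℝ (⊤ : ℕ∞) (Jc p q) (II ×ˢ univ) :=
  (h.ps.mul (dR_smooth isOpen_IU h.qs)).sub (h.qs.mul (dR_smooth isOpen_IU h.ps))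

lemma slice_univ {F : ℝ × ℝ → ℝ} (hF : ContinuousOn F (II ×ˢ univ)) {t : ℝ} (ht : t ∈ II) :
    Continuous (fun r => F zr) := by
  rw [← continuousOn_univ]
  exact slice_cont (F' := fun a b => F (a, b)) hF ht

lemma slice_pos {F : ℝ × ℝ → ℝ} (hF : ContinuousOn F OM) {t : ℝ} (ht : t ∈ II) :
    ContinuousOn (fun r => F zr) (Ioi 0) :=
  slice_cont (F' := fun a b => F (a, b)) hF ht

lemma Dat.cr (h : Dat m p q) {t : ℝ} (ht : t ∈ II) : Continuous (fun r => rpq) :=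
  slice_univ h.rho_sm.continuousOn ht

lemma Dat.M_r (h : Dat m p q) {t : ℝ} (ht : t ∈ II) (r : ℝ) :
    HasDerivAt (fun r => Mf p q t r) (1 / 2 * (rpq * r)) r := by
  have hc : Continuous (fun s => rho p q zs * s) := (h.cr ht).mul continuous_id
  exact (intervalIntegral.integral_hasDerivAt_right (hc.intervalIntegrable _ _)
    (hc.stronglyMeasurableAtFilter _ _) hc.continuousAt).const_mul (1 / 2)

lemma Dat.M_t (h : Dat m p q) {t r : ℝ} (ht : t ∈ II) (hr : 0 < r) :
    HasDerivAt (fun s => Mf p q s r) (-(r * Jc p q zr)) t := by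
  have := (h.gen.I1 le_rfl hr.le (subset_univ _) (θ := fun _ => 1) (θ' := fun _ => 0)
    (fun r => hasDerivAt_const r 1) continuous_const ht).const_mul (1 / 2)
  simp only [one_mul] at this
  refine this.congr_deriv ?_
  simp

lemma Dat.a_sm (h : Dat m p q) : ContDiffOn ℝ (⊤ : ℕ∞) (av m p q) OM ∧ ∀ z ∈ OM,
    dT (av m p q) z = z.2 * Jc p q z ∧ dR (av m p q) z = -(1 / 2 * (rho p q z * z.2)) := by
  have hsub : OM ⊆ II ×ˢ univ := prod_mono le_rfl (subset_univ _)
  refine smooth_of_partials isOpen_OM (fun z hz => ?_) (fun z hz => ?_) ?_ ?_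
  · exact ((h.M_t hz.1 hz.2).const_sub (m:ℝ)).congr_deriv (by ring)
  · exact (h.M_r hz.1 z.2).const_sub (m:ℝ)
  · exact contDiffOn_snd.mul (h.J_sm.mono hsub)
  · exact (contDiffOn_const.mul ((h.rho_sm.mono hsub).mul contDiffOn_snd)).neg

lemma Dat.mass_le (h : Dat m p q) {t α β : ℝ} (ht : t ∈ II) (hα : 0 ≤ α) (hab : α ≤ β) :
    ∫ r in α..β, rpq * r ≤ 4 * (m + 1) := by
  rw [← h.mass t ht, intervalIntegral.integral_of_le hab]
  refine setIntegral_mono_set (h.int t ht) ?_ ?_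
  · refine aeI (fun r hr => ?_)
    exact mul_nonneg (rho_nonneg _) (le_of_lt hr)
  · exact LE.le.eventuallyLE fun r hr => hα.trans_lt hr.1

lemma Dat.M_le (h : Dat m p q) {t r : ℝ} (ht : t ∈ II) (hr : 0 ≤ r) : Mf p q t r ≤ 2 * m + 2 := by
  have := h.mass_le ht le_rfl hr
  unfold Mf; linarith

lemma Dat.M_mono (h : Dat m p q) {t : ℝ} (ht : t ∈ II) : MonotoneOn (Mf p q t) (Ici 0) := by
  refine monotoneOn_of_hasDerivWithinAt_nonneg (f' := fun r => 1 / 2 * (rpq * r))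
    (convex_Ici 0) (fun r _ => (h.M_r ht r).continuousAt.continuousWithinAt)
    (fun r _ => (h.M_r ht r).hasDerivWithinAt) (fun r hr => ?_)
  rw [interior_Ici] at hr
  have := rho_nonneg (p := p) (q := q) zr
  have : 0 < r := hr
  positivity

lemma M_zero (t : ℝ) : Mf p q t 0 = 0 := by simp [Mf]

lemma Dat.M_nonneg (h : Dat m p q) {t r : ℝ} (ht : t ∈ II) (hr : 0 ≤ r) : 0 ≤ Mf p q t r := by
  rw [← M_zero (p := p) (q := q) t]
  exact h.M_mono ht (mem_Ici.2 le_rfl) hr hr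

lemma Dat.M_lim (h : Dat m p q) {t : ℝ} (ht : t ∈ II) :
    Tendsto (fun r => Mf p q t r) atTop (𝓝 mm2) := by
  have := (intervalIntegral_tendsto_integral_Ioi 0 (h.int t ht) tendsto_id).const_mul (1 / 2)
  rw [h.mass t ht] at this
  rw [show (2 * (m:ℝ) + 2) = 1 / 2 * (4 * (m + 1)) by ring]
  exact this

lemma Dat.a_abs (h : Dat m p q) {t r : ℝ} (ht : t ∈ II) (hr : 0 ≤ r) :
    |apq| ≤ 2 * m + 2 := by
  have h1 := h.M_le ht hr
  have h2 := h.M_nonneg ht hr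
  have : (1:ℝ) ≤ m := by exact_mod_cast h.hm
  unfold av; rw [abs_le]; constructor <;> simp only <;> linarith

lemma bdd_on {F : ℝ × ℝ → ℝ} (hF : ContinuousOn F (II ×ˢ univ)) {t1 t2 : ℝ} (h1 : -1 < t1)
    (h2 : t2 < 0) (L : ℝ) : ∃ C : ℝ, 0 ≤ C ∧ ∀ t ∈ Icc t1 t2, ∀ r ∈ Icc (-L) L, |F zr| ≤ C := by
  have hK : IsCompact (Icc t1 t2 ×ˢ Icc (-L) L) := isCompact_Icc.prod isCompact_Icc
  obtain ⟨C, hC⟩ := hK.exists_bound_of_continuousOn (hF.mono (prod_mono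
    (Icc_subset_Ioo h1 h2) (subset_univ _)))
  exact ⟨max C 0, le_max_right _ _, fun t ht r hr => (hC zr ⟨ht, hr⟩).trans (le_max_left _ _)⟩

/-- smooth functions vanishing at `r = 0`. -/
lemma near_zero {F : ℝ × ℝ → ℝ} (hF : ContDiffOn ℝ (⊤ : ℕ∞) F (II ×ˢ univ))
    (F0 : ∀ t ∈ II, F (t, 0) = 0) {t1 t2 : ℝ} (h1 : -1 < t1) (h2 : t2 < 0) :
    ∃ C : ℝ, 0 ≤ C ∧ ∀ t ∈ Icc t1 t2, ∀ r ∈ Icc (0:ℝ) 1, |F zr| ≤ C * r ∧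
      |dR F zr| ≤ C ∧ |dR (dR F) zr| ≤ C ∧ |dT F zr| ≤ C ∧
      |r * dR F zr - F zr| ≤ C * r ^ 2 := by
  have sR := dR_smooth isOpen_IU hF
  obtain ⟨C1, hC1, b1⟩ := bdd_on sR.continuousOn h1 h2 1
  obtain ⟨C2, hC2, b2⟩ := bdd_on (dR_smooth isOpen_IU sR).continuousOn h1 h2 1
  obtain ⟨C3, hC3, b3⟩ := bdd_on (dT_smooth isOpen_IU hF).continuousOn h1 h2 1
  refine ⟨C1 + C2 + C3, by positivity, fun t ht r hr => ?_⟩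
  have htI : t ∈ II := Icc_subset_Ioo h1 h2 ht
  have hsub : ∀ s ∈ Icc (0:ℝ) r, s ∈ Icc (-1:ℝ) 1 := fun s hs => ⟨by linarith [hs.1], hs.2.trans hr.2⟩
  have k1 : |F zr| ≤ C1 * r := by
    have := (convex_Icc 0 r).norm_image_sub_le_of_norm_hasDerivWithin_le
      (f := fun s => F zs) (f' := fun s => dR F zs) (x := 0) (y := r) (C := C1)
      (fun s hs => (hdR isOpen_IU hF ⟨htI, trivial⟩).hasDerivWithinAt)
      (fun s hs => b1 t ht s (hsub s hs)) ⟨le_rfl, hr.1⟩ ⟨hr.1, le_rfl⟩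
    simpa [F0 t htI, abs_of_nonneg hr.1] using this
  have k2 : |r * dR F zr - F zr| ≤ (C2 * r) * r := by
    have := (convex_Icc 0 r).norm_image_sub_le_of_norm_hasDerivWithin_le
      (f := fun s => s * dR F zs - F zs) (f' := fun s => s * dR (dR F) zs)
      (x := 0) (y := r) (C := C2 * r)
      (fun s hs => ((((hasDerivAt_id s).mul (hdR isOpen_IU sR (t := t) ⟨htI, trivial⟩)).sub
        (hdR isOpen_IU hF ⟨htI, trivial⟩)).congr_deriv (by simp)).hasDerivWithinAt)
      (fun s hs => by
        rw [Real.norm_eq_abs, abs_mul, abs_of_nonneg hs.1, mul_comm]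
        exact mul_le_mul (b2 t ht s (hsub s hs)) hs.2 hs.1 hC2) ⟨le_rfl, hr.1⟩ ⟨hr.1, le_rfl⟩
    simpa [F0 t htI, abs_of_nonneg hr.1] using this
  have hr' := hsub r ⟨hr.1, le_rfl⟩
  have hr0 := hr.1
  refine ⟨k1.trans ?_, (b1 t ht r hr').trans ?_, (b2 t ht r hr').trans ?_, (b3 t ht r hr').trans ?_,
    k2.trans ?_⟩
  · gcongr; linarith
  · linarith
  · linarith
  · linarith
  · rw [mul_assoc, ← sq]; gcongr; linarith

lemma Dat.rho_near (h : Dat m p q) {t1 t2 : ℝ} (h1 : -1 < t1) (h2 : t2 < 0) :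
    ∃ C : ℝ, 0 ≤ C ∧ ∀ t ∈ Icc t1 t2, ∀ r ∈ Icc (0:ℝ) 1, rpq ≤ C * r ^ 2 := by
  obtain ⟨C1, hC1, b1⟩ := near_zero h.ps h.p0 h1 h2
  obtain ⟨C2, hC2, b2⟩ := near_zero h.qs h.q0 h1 h2
  refine ⟨C1 ^ 2 + C2 ^ 2, by positivity, fun t ht r hr => ?_⟩
  have k1 := sq_le_sq' (by linarith [(abs_le.1 (b1 t ht r hr).1).1]) (abs_le.1 (b1 t ht r hr).1).2
  have k2 := sq_le_sq' (by linarith [(abs_le.1 (b2 t ht r hr).1).1]) (abs_le.1 (b2 t ht r hr).1).2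
  unfold rho; nlinarith

lemma maj_int (h : Dat m p q) {t : ℝ} (ht : t ∈ II) (C : ℝ) :
    IntegrableOn (fun s => (Ioc (0:ℝ) 1).indicator (fun _ => C) s + rho p q zs * s) (Ioi 0) ∧
    ∫ s in Ioi (0:ℝ), ((Ioc (0:ℝ) 1).indicator (fun _ => C) s + rho p q zs * s)
      = C + 4 * (m + 1) := by
  have i1 : IntegrableOn ((Ioc (0:ℝ) 1).indicator (fun _ => C)) (Ioi 0) := by
    rw [integrableOn_indicator_iff measurableSet_Ioc]
    refine integrableOn_const ?_
    rw [inter_eq_left.2 Ioc_subset_Ioi_self]; simp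
  refine ⟨i1.add (h.int t ht), ?_⟩
  rw [integral_add i1 (h.int t ht), h.mass t ht, setIntegral_indicator measurableSet_Ioc,
    inter_eq_right.2 Ioc_subset_Ioi_self]
  simp

lemma maj_le {t C : ℝ}
    (hb : ∀ r ∈ Icc (0:ℝ) 1, rpq ≤ C * r ^ 2) {s : ℝ} (hs : 0 < s) :
    rho p q zs / s ≤ (Ioc (0:ℝ) 1).indicator (fun _ => C) s + rho p q zs * s := by
  have h0 := rho_nonneg (p := p) (q := q) zs
  by_cases hs1 : s ≤ 1
  · rw [indicator_of_mem (show s ∈ Ioc (0:ℝ) 1 from ⟨hs, hs1⟩)]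
    have := hb s ⟨hs.le, hs1⟩
    have h2 : rho p q zs / s ≤ C := by
      rw [div_le_iff₀ hs]; nlinarith
    have := mul_nonneg h0 hs.le
    linarith
  · rw [indicator_of_notMem (by simp [hs1])]
    push Not at hs1
    rw [zero_add, div_le_iff₀ hs]
    nlinarith [mul_le_mul hs1.le hs1.le zero_le_one hs.le]

lemma Dat.cM (h : Dat m p q) {t : ℝ} (ht : t ∈ II) : Continuous (fun r => Mf p q t r) :=
  continuous_iff_continuousAt.2 fun r => (h.M_r ht r).continuousAt

lemma Dat.ca (h : Dat m p q) {t : ℝ} (ht : t ∈ II) : Continuous (fun r => apq) :=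
  continuous_const.sub (h.cM ht)

lemma Dat.arho_int (h : Dat m p q) {t : ℝ} (ht : t ∈ II) :
    IntegrableOn (fun s => av m p q zs * rho p q zs / s) (Ioi 0) := by
  obtain ⟨C, hC, hb⟩ := h.rho_near (t1 := t) (t2 := t) ht.1 ht.2
  refine ((maj_int h ht C).1.const_mul mm2).mono' ?_ ?_
  · apply ContinuousOn.aestronglyMeasurable _ mI
    have := h.ca ht
    have := h.cr ht
    exact ContinuousOn.div (by fun_prop) (by fun_prop) (fun s hs => (ne_of_gt hs))
  · refine aeI (fun s hs => ?_)
    have hs : 0 < s := hs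
    rw [Real.norm_eq_abs, mul_div_assoc, abs_mul,
      abs_of_nonneg (div_nonneg (rho_nonneg (p := p) (q := q) zs) hs.le)]
    exact mul_le_mul (h.a_abs ht hs.le) (maj_le (hb t ⟨le_rfl, le_rfl⟩) hs)
      (div_nonneg (rho_nonneg _) hs.le) (by positivity)

lemma Dat.A_bdd (h : Dat m p q) {t1 t2 : ℝ} (h1 : -1 < t1) (h2 : t2 < 0) :
    ∃ C : ℝ, 0 ≤ C ∧ ∀ t ∈ Icc t1 t2, ∀ r : ℝ, 0 < r → |Av m p q zr| ≤ C := by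
  obtain ⟨C, hC, hb⟩ := h.rho_near h1 h2
  refine ⟨mm2 * (C + 4 * (m + 1)), by positivity, fun t ht r hr => ?_⟩
  have htI : t ∈ II := Icc_subset_Ioo h1 h2 ht
  unfold Av
  rw [abs_neg, ← (maj_int h htI C).2, ← integral_const_mul]
  have hi : IntegrableOn (fun s => (2 * (m:ℝ) + 2) *
      ((Ioc (0:ℝ) 1).indicator (fun _ => C) s + rho p q zs * s)) (Ioi 0) := ((maj_int h htI C).1.const_mul (2 * (m:ℝ) + 2))
  have hsub : Ioi r ⊆ Ioi 0 := Ioi_subset_Ioi hr.le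
  have hnn : ∀ s : ℝ, 0 < s → 0 ≤ (2 * (m:ℝ) + 2) *
      ((Ioc (0:ℝ) 1).indicator (fun _ => C) s + rho p q zs * s) := by
    intro s hs
    have := indicator_nonneg (s := Ioc (0:ℝ) 1) (f := fun _ => C) (fun _ _ => hC) s
    have := rho_nonneg (p := p) (q := q) zs
    positivity
  calc _ ≤ ∫ s in Ioi r, (2 * (m:ℝ) + 2) *
          ((Ioc (0:ℝ) 1).indicator (fun _ => C) s + rho p q zs * s) := by
        rw [← Real.norm_eq_abs]
        refine norm_integral_le_of_norm_le (hi.mono_set hsub) ?_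
        refine aeI (fun s hs => ?_)
        have hs : 0 < s := hsub hs
        rw [Real.norm_eq_abs, mul_div_assoc, abs_mul,
          abs_of_nonneg (div_nonneg (rho_nonneg (p := p) (q := q) _) hs.le)]
        exact mul_le_mul (h.a_abs htI hs.le) (maj_le (hb t ht) hs)
          (div_nonneg (rho_nonneg _) hs.le) (by positivity)
    _ ≤ _ := by
        refine setIntegral_mono_set hi ?_ (LE.le.eventuallyLE hsub)
        exact aeI (fun s hs => hnn s hs)

lemma Dat.A_r (h : Dat m p q) {t r : ℝ} (ht : t ∈ II) (hr : 0 < r) :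
    HasDerivAt (fun s => Av m p q zs) (apq * rpq / r) r := by
  have hi := h.arho_int ht
  have hcont : ContinuousOn (fun s => av m p q zs * rho p q zs / s) (Ioi 0) := by
    have := h.ca ht
    have := h.cr ht
    exact ContinuousOn.div (by fun_prop) (by fun_prop) (fun s hs => (ne_of_gt hs))
  have h2 : HasDerivAt (fun s => ∫ x in r..s, av m p q (t, x) * rho p q (t, x) / x)
      (apq * rpq / r) r := by
    refine intervalIntegral.integral_hasDerivAt_right (by simp) ?_
      (hcont.continuousAt (Ioi_mem_nhds hr))
    exact hcont.stronglyMeasurableAtFilter isOpen_Ioi r hr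
  have h3 := h2.add_const (Av m p q zr)
  refine h3.congr_of_eventuallyEq ?_
  filter_upwards [Ioi_mem_nhds hr] with s hs
  have := intervalIntegral.integral_Ioi_sub_Ioi' (hi.mono_set (Ioi_subset_Ioi hr.le))
    (hi.mono_set (Ioi_subset_Ioi (le_of_lt hs)))
  unfold Av
  rw [← this]; ring

end
end
end CSSP

namespace CSSP
noncomputable section
open scoped ContDiff Topology

def Kn (p q : ℝ × ℝ → ℝ) (n t : ℝ) : ℝ :=
  ∫ r in (1:ℝ)..n, r * (rn / n) ^ 2 * (dR p zr ^ 2 + dR q zr ^ 2)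

lemma amgm (k c x y x' y' : ℝ) :
    k * c * |x * x' + y * y'| ≤ c ^ 2 * (x' ^ 2 + y' ^ 2) + k ^ 2 / 4 * (x ^ 2 + y ^ 2) := by
  rcases abs_cases (x * x' + y * y') with ⟨h, _⟩ | ⟨h, _⟩ <;> rw [h]
  · nlinarith [sq_nonneg (c * x' - k / 2 * x), sq_nonneg (c * y' - k / 2 * y)]
  · nlinarith [sq_nonneg (c * x' + k / 2 * x), sq_nonneg (c * y' + k / 2 * y)]

section
variable {I S : Set ℝ} {p q W W1 : ℝ × ℝ → ℝ} {c0 : ℝ}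

lemma Gen.slices (h : Gen I S p q W) (hS : Ici 1 ⊆ S) {t : ℝ} (ht : t ∈ I) (n : ℝ) :
    ContinuousOn (fun r => rpq) (Icc 1 n) ∧
    ContinuousOn (fun r => dR p zr ^ 2 + dR q zr ^ 2) (Icc 1 n) ∧
    ContinuousOn (fun r => p zr * dR p zr + q zr * dR q zr) (Icc 1 n) := by
  obtain ⟨c1, c2, c3, c4, -⟩ := h.cont
  have hsub : Icc 1 n ⊆ S := Icc_subset_Ici_self.trans hS
  refine ⟨Gen.sl (F := rho p q) ?_ ht hsub, Gen.sl (F := fun z => dR p z ^ 2 + dR q z ^ 2) ?_ ht hsub,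
    Gen.sl (F := fun z => p z * dR p z + q z * dR q z) ?_ ht hsub⟩
  · unfold rho; fun_prop
  · fun_prop
  · fun_prop

lemma Kn_cont (h : Gen I S p q W) (hS : Ici 1 ⊆ S) {n : ℝ} (hn : 1 ≤ n) :
    ContinuousOn (Kn p q n) I := by
  obtain ⟨c1, c2, c3, c4, -⟩ := h.cont
  have hsub : I ×ˢ Icc 1 n ⊆ I ×ˢ S := prod_mono le_rfl (Icc_subset_Ici_self.trans hS)
  refine param_cont (F' := fun t r => r * (rn / n) ^ 2 * (dR p zr ^ 2 + dR q zr ^ 2))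
    h.hI hn (ContinuousOn.mono ?_ hsub)
  have := csnd (f := fun r => r * (rn / n) ^ 2) (by fun_prop) (I ×ˢ S)
  show ContinuousOn (fun z : ℝ × ℝ => z.2 * ((1 - z.2 / n) / n) ^ 2 * (dR p z ^ 2 + dR q z ^ 2)) _
  fun_prop

lemma Kn_nonneg {n : ℝ} (hn : 1 ≤ n) (t : ℝ) : 0 ≤ Kn p q n t :=
  intervalIntegral.integral_nonneg hn fun r hr => by
    have := hr.1
    positivity

lemma rho_r (h : Gen I S p q W) {t r : ℝ} (ht : t ∈ I) (hr : r ∈ S) :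
    HasDerivAt (fun s => rho p q zs) (2 * (p zr * dR p zr + q zr * dR q zr)) r := by
  have hz : zr ∈ I ×ˢ S := ⟨ht, hr⟩
  exact (((hdR h.op h.ps hz).pow 2).add ((hdR h.op h.qs hz).pow 2)).congr_deriv (by push_cast; ring)

/-- weighted pointwise bound. -/
lemma ptw (h : Gen I S p q W) (hS : Ici 1 ⊆ S) {t n μ ε : ℝ} (ht : t ∈ I) (hn : 1 ≤ n) (hε : 0 < ε)
    (hμ : ∫ r in (1:ℝ)..n, rpq * r ≤ μ) {r : ℝ} (hr : r ∈ Icc 1 n) :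
    rn / n * r * rpq ≤ μ + μ / ε + ε * Kn p q n t := by
  have hn0 : 0 < n := by linarith
  have hS' : Icc 1 n ⊆ S := Icc_subset_Ici_self.trans hS
  obtain ⟨k1, k2, k3⟩ := h.slices hS ht n
  set R := fun r => rpq with hR
  set Y := fun r => dR p zr ^ 2 + dR q zr ^ 2 with hY
  set D := fun r => p zr * dR p zr + q zr * dR q zr with hD
  have hd : ∀ s ∈ Icc 1 n, HasDerivAt (fun s => (1 - s / n) / n * s * R s)
      ((1 - 2 * s / n) / n * R s + 2 * ((1 - s / n) / n * s) * D s) s := by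
    intro s hs
    have e : HasDerivAt (fun s => (1 - s / n) / n * s) ((1 - 2 * s / n) / n) s := by
      have := ((((hasDerivAt_id s).div_const n).const_sub 1).div_const n).mul (hasDerivAt_id s)
      exact this.congr_deriv (by simp only [id]; ring)
    exact (e.mul (rho_r h ht (hS' hs))).congr_deriv (by simp only [hR, hD]; ring)
  set H := fun s => (R s * s) + (1 / ε) * (R s * s) + ε * (s * ((1 - s / n) / n) ^ 2 * Y s) with hH
  have cH : ContinuousOn H (Icc 1 n) := by simp only [hH]; fun_prop
  have hH0 : ∀ s ∈ Icc 1 n, 0 ≤ H s := by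
    intro s hs
    have := rho_nonneg (p := p) (q := q) zs
    have hs1 := hs.1
    simp only [hH, hR, hY]; positivity
  have hle : ∀ s ∈ Icc 1 n, -((1 - 2 * s / n) / n * R s + 2 * ((1 - s / n) / n * s) * D s) ≤ H s := by
    intro s hs
    have hs1 := hs.1
    have hx : s / n ≤ 1 := (div_le_one hn0).2 hs.2
    have hx0 : 0 ≤ s / n := by positivity
    set c := (1 - s / n) / n with hc
    have hc0 : 0 ≤ c := div_nonneg (by linarith) hn0.le
    have hR0 : 0 ≤ R s := rho_nonneg _
    have h1 : -((1 - 2 * s / n) / n * R s) ≤ R s * s := by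
      have : -((1 - 2 * s / n) / n) ≤ s := by
        rw [← neg_div, div_le_iff₀ hn0, mul_div_assoc]; nlinarith
      nlinarith
    have h2 : -(2 * (c * s) * D s) ≤ (1 / ε) * (R s * s) + ε * (s * c ^ 2 * Y s) := by
      have a := amgm (2 / ε) c (p zs) (q zs) (dR p zs) (dR q zs)
      have b := neg_abs_le (D s)
      have e1 : 2 / ε * c * |D s| ≤ c ^ 2 * Y s + (2 / ε) ^ 2 / 4 * R s := a
      have e2 := mul_le_mul_of_nonneg_left e1 (show 0 ≤ ε * s by positivity)
      have e3 : ε * s * (2 / ε * c * |D s|) = 2 * (c * s) * |D s| := by field_simp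
      have e4 : ε * s * (c ^ 2 * Y s + (2 / ε) ^ 2 / 4 * R s)
        = (1 / ε) * (R s * s) + ε * (s * c ^ 2 * Y s) := by field_simp; ring
      rw [e3, e4] at e2
      nlinarith [mul_nonneg hc0 (show 0 ≤ s by linarith)]
    simp only [hH]; linarith
  have cd : ContinuousOn (fun s => (1 - 2 * s / n) / n * R s + 2 * ((1 - s / n) / n * s) * D s)
      (Icc 1 n) := by fun_prop
  have hrn : Icc r n ⊆ Icc 1 n := Icc_subset_Icc_left hr.1
  have F := intervalIntegral.integral_eq_sub_of_hasDerivAt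
    (f := fun s => (1 - s / n) / n * s * R s) (a := r) (b := n)
    (f' := fun s => (1 - 2 * s / n) / n * R s + 2 * ((1 - s / n) / n * s) * D s)
    (by rw [uIcc_of_le hr.2]; exact fun s hs => hd s (hrn hs))
    (ContinuousOn.intervalIntegrable (by rw [uIcc_of_le hr.2]; exact cd.mono hrn))
  have F2 : ∫ s in r..n, -((1 - 2 * s / n) / n * R s + 2 * ((1 - s / n) / n * s) * D s)
      ≤ ∫ s in r..n, H s := by
    refine intervalIntegral.integral_mono_on hr.2 ?_ ?_ (fun s hs => hle s (hrn hs))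
    · exact ContinuousOn.intervalIntegrable (by rw [uIcc_of_le hr.2]; exact (cd.mono hrn).neg)
    · exact ContinuousOn.intervalIntegrable (by rw [uIcc_of_le hr.2]; exact (cH.mono hrn))
  rw [intervalIntegral.integral_neg, F] at F2
  have F3 : ∫ s in r..n, H s ≤ ∫ s in (1:ℝ)..n, H s := by
    refine intervalIntegral.integral_mono_interval hr.1 hr.2 le_rfl ?_ ?_
    · refine (ae_restrict_iff' measurableSet_Ioc).2 (Eventually.of_forall fun s hs => ?_)
      exact hH0 s (Ioc_subset_Icc_self hs)
    · exact ContinuousOn.intervalIntegrable (by rw [uIcc_of_le hn]; exact cH)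
  have i1 : IntervalIntegrable (fun s => R s * s) volume 1 n :=
    ContinuousOn.intervalIntegrable (by rw [uIcc_of_le hn]; fun_prop)
  have i2 : IntervalIntegrable (fun s => s * ((1 - s / n) / n) ^ 2 * Y s) volume 1 n :=
    ContinuousOn.intervalIntegrable (by rw [uIcc_of_le hn]; fun_prop)
  have F4 : ∫ s in (1:ℝ)..n, H s = (∫ s in (1:ℝ)..n, R s * s) + 1 / ε * (∫ s in (1:ℝ)..n, R s * s)
      + ε * Kn p q n t := by
    simp only [hH]
    rw [intervalIntegral.integral_add (i1.add (i1.const_mul _)) (i2.const_mul _),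
      intervalIntegral.integral_add i1 (i1.const_mul _), intervalIntegral.integral_const_mul,
      intervalIntegral.integral_const_mul]
    rfl
  rw [F4] at F3
  have F5 : (1 - n / n) / n * n * R n = 0 := by rw [div_self hn0.ne']; ring
  have F6 : 1 / ε * (∫ s in (1:ℝ)..n, R s * s) ≤ μ / ε := by
    rw [div_mul_eq_mul_div, one_mul]; gcongr
  simp only [F5] at F2
  linarith

def ψm (n r : ℝ) : ℝ := -(r / n) * rn ^ 3
def ψm1 (n r : ℝ) : ℝ := (rn / n) ^ 2 * (4 * r - n)
def ψm2 (n r : ℝ) : ℝ := rn / n / n * (6 - 12 * (r / n))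
def φm (n r : ℝ) : ℝ := 1 / 4 * rn ^ 4

lemma hψm {n : ℝ} (hn : 0 < n) (r : ℝ) : HasDerivAt (ψm n) (ψm1 n r) r := by
  have e := (hasDerivAt_id r).div_const n
  have := e.neg.mul ((e.const_sub 1).pow 3)
  refine this.congr_deriv ?_
  simp only [ψm1, id, Pi.pow_apply, Pi.neg_apply]; norm_num; field_simp; ring

lemma hψm1 {n : ℝ} (hn : 0 < n) (r : ℝ) : HasDerivAt (ψm1 n) (ψm2 n r) r := by
  have e := (hasDerivAt_id r).div_const n
  have := (((e.const_sub 1).div_const n).pow 2).mul (((hasDerivAt_id r).const_mul 4).sub_const n)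
  refine this.congr_deriv ?_
  simp only [ψm2, id, Pi.pow_apply]; norm_num; field_simp; ring

lemma hφm {n : ℝ} (hn : 0 < n) (r : ℝ) : HasDerivAt (φm n) (-(1 / n) * rn ^ 3) r := by
  have e := (hasDerivAt_id r).div_const n
  have := ((e.const_sub 1).pow 4).const_mul (1 / 4)
  refine this.congr_deriv ?_
  simp only [id]; norm_num; field_simp

lemma psi_facts {n r : ℝ} (hn : 2 ≤ n) (hr : r ∈ Icc 1 n) :
    |ψm n r| ≤ r * (rn / n) ∧ |ψm1 n r| ≤ 3 ∧ ψm1 n r ≤ 4 * r * (rn / n) ^ 2 ∧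
    |ψm2 n r - ψm1 n r / r| ≤ 9 * (rn / n) ∧
    2 * (ψm1 n r - ψm n r / r) = 6 * r * (rn / n) ^ 2 ∧
    0 ≤ rn / n ∧ rn / n ≤ 1 := by
  have hn0 : 0 < n := by linarith
  have hr1 := hr.1
  have hr2 := hr.2
  have hr0 : 0 < r := by linarith
  have hx : r / n ≤ 1 := (div_le_one hn0).2 hr.2
  have hx0 : 0 ≤ r / n := by positivity
  have hψ' : ψm n r = -((rn / n) * r) * rn ^ 2 := by
    simp only [ψm]; ring
  have hdiff : 2 * (ψm1 n r - ψm n r / r) = 6 * r * (rn / n) ^ 2 := by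
    simp only [ψm1, ψm]; field_simp; ring
  have hdd : ψm2 n r - ψm1 n r / r = (rn / n) * (1 / n * (1 - 8 * (r / n)) + 1 / r) := by
    simp only [ψm1, ψm2]; field_simp; ring
  have hψ1' : ψm1 n r = (rn / n) ^ 2 * (4 * r - n) := rfl
  set c := rn / n with hc
  have hc00 : 0 ≤ c := div_nonneg (by linarith) hn0.le
  have hcl : c ≤ 1 := by rw [hc, div_le_one hn0]; linarith
  have hcn : c * n ≤ 1 := by rw [hc, div_mul_cancel₀ _ hn0.ne']; linarith
  have hccn : c * (c * n) ≤ 1 := by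
    calc c * (c * n) ≤ 1 * 1 := mul_le_mul hcl hcn (by positivity) zero_le_one
      _ = 1 := by ring
  refine ⟨?_, ?_, ?_, ?_, hdiff, hc00, hcl⟩
  · rw [hψ', abs_mul, abs_neg, abs_of_nonneg (by positivity), abs_of_nonneg (by positivity), mul_comm r c]
    have : rn ^ 2 ≤ 1 := by nlinarith
    exact mul_le_of_le_one_right (by positivity) this
  · rw [hψ1', abs_le]
    have h1 : c ^ 2 * (4 * r - n) ≤ c ^ 2 * (3 * n) := by
      apply mul_le_mul_of_nonneg_left _ (sq_nonneg c); linarith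
    have h2 : c ^ 2 * (-n) ≤ c ^ 2 * (4 * r - n) := by
      apply mul_le_mul_of_nonneg_left _ (sq_nonneg c); linarith
    constructor <;> linarith
  · rw [hψ1']
    have : c ^ 2 * (4 * r - n) ≤ c ^ 2 * (4 * r) := by
      apply mul_le_mul_of_nonneg_left _ (sq_nonneg c); linarith
    linarith
  · rw [hdd, abs_mul, abs_of_nonneg hc00, mul_comm]
    refine mul_le_mul_of_nonneg_right ?_ hc00
    have a1 : 1 / n ≤ 1 := by rw [div_le_one hn0]; linarith
    have a2 : 1 / r ≤ 1 := by rw [div_le_one hr0]; linarith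
    have a3 : 0 < 1 / n := by positivity
    have a4 : 0 < 1 / r := by positivity
    rw [abs_le]; constructor <;> nlinarith

/-- lower bound for the Morawetz bulk. -/
lemma mor_bulk (h : Gen I S p q W) (hS : Ici 1 ⊆ S) (hc0 : 0 ≤ c0) (hc1 : c0 ≤ 1) {t n μ C1 : ℝ}
    (ht : t ∈ I) (hn : 2 ≤ n) (hμ0 : 0 < μ) (hC1 : 0 ≤ C1)
    (hμ : ∫ r in (1:ℝ)..n, rpq * r ≤ μ) (hW1 : ∀ r, 1 ≤ r → |W1 zr| ≤ C1)
    {G : ℝ → ℝ} (cG : ContinuousOn G (Icc 1 n))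
    (hG : ∀ r ∈ Icc 1 n, 0 < r → G r = Gv c0 (ψm n) (ψm1 n) (ψm2 n) W1 p q zr) :
    4 * Kn p q n t - (((9 + 2 * C1) ^ 2 / 4 + 3 * C1) * μ + 2 * μ ^ 2 + 4 * μ ^ 3)
      ≤ ∫ r in (1:ℝ)..n, G r := by
  have hn0 : 0 < n := by linarith
  have hn1 : 1 ≤ n := by linarith
  obtain ⟨k1, k2, k3⟩ := h.slices hS ht n
  set R := fun r => rpq with hR
  set Y := fun r => dR p zr ^ 2 + dR q zr ^ 2 with hY
  set D := fun r => p zr * dR p zr + q zr * dR q zr with hD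
  set X := μ + μ / (1 / (2 * μ)) + 1 / (2 * μ) * Kn p q n t with hX
  set C2 := (9 + 2 * C1) ^ 2 / 4 + 3 * C1 with hC2
  have hX' : 2 * μ * X = 2 * μ ^ 2 + 4 * μ ^ 3 + Kn p q n t := by
    rw [hX]; field_simp; ring
  have i1 : IntervalIntegrable (fun s => R s * s) volume 1 n :=
    ContinuousOn.intervalIntegrable (by rw [uIcc_of_le hn1]; fun_prop)
  have i2 : IntervalIntegrable (fun s => s * ((1 - s / n) / n) ^ 2 * Y s) volume 1 n :=
    ContinuousOn.intervalIntegrable (by rw [uIcc_of_le hn1]; fun_prop)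
  have i3 : IntervalIntegrable G volume 1 n :=
    ContinuousOn.intervalIntegrable (by rw [uIcc_of_le hn1]; exact cG)
  have hX0 : 0 ≤ X := by
    have := Kn_nonneg (p := p) (q := q) hn1 t
    rw [hX]; positivity
  have key : ∀ r ∈ Icc 1 n, 5 * (r * (rn / n) ^ 2 * Y r) - (C2 + 2 * X) * (R r * r) ≤ G r := by
    intro r hr
    have hr1 := hr.1
    have hr0 : 0 < r := by linarith
    have hx : r / n ≤ 1 := (div_le_one hn0).2 hr.2
    have hx0 : 0 ≤ r / n := by positivity
    have P := ptw h hS ht hn1 (show 0 < 1 / (2 * μ) by positivity) hμ hr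
    rw [hG r hr hr0]
    obtain ⟨b1, b2, b3, b4, hdiff, hc00, hcl⟩ := psi_facts hn hr
    set c := rn / n with hc
    have hR0 : 0 ≤ R r := rho_nonneg _
    have hY0 : 0 ≤ Y r := by simp only [hY]; positivity
    have am := amgm (9 + 2 * C1) c (p zr) (q zr) (dR p zr) (dR q zr)
    have am' : (9 + 2 * C1) * c * |D r| ≤ c ^ 2 * Y r + (9 + 2 * C1) ^ 2 / 4 * R r := am
    have w := hW1 r hr1
    have t1 : -(9 * c * |D r|) ≤ (ψm2 n r - ψm1 n r / r) * D r := by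
      have := abs_mul (ψm2 n r - ψm1 n r / r) (D r)
      have := neg_abs_le ((ψm2 n r - ψm1 n r / r) * D r)
      have := mul_le_mul_of_nonneg_right b4 (abs_nonneg (D r))
      linarith
    have t2 : -(C1 * (3 * R r + 2 * (r * c) * |D r|)) ≤ W1 zr * (ψm1 n r * R r + 2 * ψm n r * D r) := by
      have e1 : |ψm1 n r * R r + 2 * ψm n r * D r| ≤ 3 * R r + 2 * (r * c) * |D r| := by
        refine (abs_add_le _ _).trans ?_
        rw [abs_mul, abs_mul, abs_mul, abs_of_nonneg hR0, abs_two]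
        gcongr
      have e2 := abs_mul (W1 zr) (ψm1 n r * R r + 2 * ψm n r * D r)
      have e3 := neg_abs_le (W1 zr * (ψm1 n r * R r + 2 * ψm n r * D r))
      have e4 := mul_le_mul w e1 (abs_nonneg _) hC1
      linarith
    have t3 : 1 / 2 * c0 * ψm1 n r * R r ^ 2 ≤ 2 * X * (R r * r) := by
      have e1 : c0 * ψm1 n r ≤ 4 * r * c ^ 2 := by
        have : 0 ≤ 4 * r * c ^ 2 := by positivity
        rcases le_total (ψm1 n r) 0 with hh | hh
        · have := mul_nonpos_of_nonneg_of_nonpos hc0 hh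
          linarith
        · have := mul_le_of_le_one_left hh hc1
          linarith
      have e2 : c * r * R r ≤ X := P
      have e3 : c * R r ≤ R r * r := by nlinarith
      calc _ = 1 / 2 * (c0 * ψm1 n r) * R r ^ 2 := by ring
        _ ≤ 1 / 2 * (4 * r * c ^ 2) * R r ^ 2 := by gcongr
        _ = 2 * ((c * r * R r) * (c * R r)) := by ring
        _ ≤ 2 * (X * (R r * r)) := by gcongr
        _ = _ := by ring
    have t4 : r * ((9 + 2 * C1) * c * |D r|) ≤ r * (c ^ 2 * Y r + (9 + 2 * C1) ^ 2 / 4 * R r) :=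
      mul_le_mul_of_nonneg_left am' hr0.le
    have t5 : 9 * c * |D r| ≤ r * (9 * c * |D r|) :=
      le_mul_of_one_le_left (by positivity) hr1
    have t6 : C1 * (3 * R r) ≤ C1 * (3 * (R r * r)) := by
      have : R r ≤ R r * r := le_mul_of_one_le_right hR0 hr1
      gcongr
    have : Gv c0 (ψm n) (ψm1 n) (ψm2 n) W1 p q zr = 2 * (ψm1 n r - ψm n r / r) * Y r
      + (ψm2 n r - ψm1 n r / r) * D r + W1 zr * (ψm1 n r * R r + 2 * ψm n r * D r)
      - 1 / 2 * c0 * ψm1 n r * R r ^ 2 := rfl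
    rw [this, hdiff]
    rw [hC2]
    generalize hg : (ψm2 n r - ψm1 n r / r) * D r = g1 at *
    generalize W1 zr * (ψm1 n r * R r + 2 * ψm n r * D r) = g2 at *
    generalize 1 / 2 * c0 * ψm1 n r * R r ^ 2 = g3 at *
    linarith
  have := intervalIntegral.integral_mono_on hn1 ((i2.const_mul 5).sub (i1.const_mul (C2 + 2 * X))) i3 key
  rw [intervalIntegral.integral_sub (i2.const_mul 5) (i1.const_mul (C2 + 2 * X)),
    intervalIntegral.integral_const_mul, intervalIntegral.integral_const_mul] at this
  have e : ∫ s in (1:ℝ)..n, s * ((1 - s / n) / n) ^ 2 * Y s = Kn p q n t := rfl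
  rw [e] at this
  have e2 : (C2 + 2 * X) * ∫ s in (1:ℝ)..n, R s * s ≤ (C2 + 2 * X) * μ :=
    mul_le_mul_of_nonneg_left hμ (by positivity)
  linarith

end
end
end CSSP

namespace CSSP
noncomputable section
open scoped ContDiff Topology

section
variable {I S : Set ℝ} {p q W W1 : ℝ × ℝ → ℝ} {c0 : ℝ}

theorem morawetz (h : Gen I S p q W) (hS : Ici 1 ⊆ S) (hc0 : 0 ≤ c0) (hc1 : c0 ≤ 1)
    {s1 t1 t2 s2 μ C1 : ℝ} (h1 : s1 < t1) (h12 : t1 ≤ t2) (h2 : t2 < s2) (hI : Icc s1 s2 ⊆ I)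
    (hW : ∀ t ∈ I, ∀ r ∈ S, 0 < r → W zr = W1 zr - c0 * rpq)
    (hμ0 : 0 < μ) (hC1 : 0 ≤ C1)
    (hμ : ∀ t ∈ Icc s1 s2, ∀ n, 1 ≤ n → ∫ r in (1:ℝ)..n, rpq * r ≤ μ)
    (hW1 : ∀ t ∈ Icc s1 s2, ∀ r, 1 ≤ r → |W1 zr| ≤ C1) :
    ∃ C, 0 ≤ C ∧ ∀ n, 2 ≤ n → ∫ t in t1..t2, Kn p q n t ≤ C := by
  obtain ⟨c1, c2, c3, c4, c5, c6, -⟩ := h.cont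
  have hs12 : s1 ≤ s2 := by linarith
  have h1S : (1:ℝ) ∈ S := hS (mem_Ici.2 le_rfl)
  -- traces at r = 1
  have tr : ∀ {F : ℝ × ℝ → ℝ}, ContinuousOn F (I ×ˢ S) → ContinuousOn (fun t => F (t, 1)) (Icc s1 s2) := by
    intro F hF
    exact hF.comp (by fun_prop) fun t ht => ⟨hI ht, h1S⟩
  have bd : ∀ {f : ℝ → ℝ}, ContinuousOn f (Icc s1 s2) → ∃ C, 0 ≤ C ∧ ∀ t ∈ Icc s1 s2, |f t| ≤ C := by
    intro f hf
    obtain ⟨C, hC⟩ := isCompact_Icc.exists_bound_of_continuousOn hf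
    exact ⟨max C 0, le_max_right _ _, fun t ht => (hC t ht).trans (le_max_left _ _)⟩
  obtain ⟨B1, hB1, b1⟩ := bd (tr (F := fun z => p z * dT q z - q z * dT p z) (by fun_prop))
  obtain ⟨B2, hB2, b2⟩ := bd (tr (F := fun z => p z * dR p z + q z * dR q z) (by fun_prop))
  obtain ⟨B3, hB3, b3⟩ := bd (tr (F := fun z => dR p z ^ 2 + dR q z ^ 2) (by fun_prop))
  obtain ⟨B4, hB4, b4⟩ := bd (tr (F := fun z => rho p q z ^ 2) (by unfold rho; fun_prop))
  obtain ⟨B5, hB5, b5⟩ := bd (tr h.J_cont)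
  set η : ℝ → ℝ := fun t => (t - s1) ^ 2 * (s2 - t) ^ 2 with hη
  set η1 : ℝ → ℝ := fun t => 2 * (t - s1) * (s2 - t) ^ 2 - 2 * (t - s1) ^ 2 * (s2 - t) with hη1
  set η2 : ℝ → ℝ := fun t => 2 * (s2 - t) ^ 2 - 8 * (t - s1) * (s2 - t) + 2 * (t - s1) ^ 2 with hη2
  have dA : ∀ t, HasDerivAt (fun t => t - s1) 1 t := fun t => (hasDerivAt_id t).sub_const s1
  have dB : ∀ t, HasDerivAt (fun t => s2 - t) (-1) t := fun t => (hasDerivAt_id t).const_sub s2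
  have dη : ∀ t, HasDerivAt η (η1 t) t := fun t =>
    (((dA t).pow 2).mul ((dB t).pow 2)).congr_deriv (by
      simp only [hη1, Pi.pow_apply]; norm_num; ring)
  have dη1 : ∀ t, HasDerivAt η1 (η2 t) t := fun t =>
    ((((dA t).const_mul 2).mul ((dB t).pow 2)).sub ((((dA t).pow 2).const_mul 2).mul (dB t))).congr_deriv (by
      simp only [hη2, Pi.pow_apply]; norm_num; ring)
  obtain ⟨H0, hH0, e0⟩ := bd (f := η) (by fun_prop)
  obtain ⟨H1, hH1, e1⟩ := bd (f := η1) (by fun_prop)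
  obtain ⟨H2, hH2, e2⟩ := bd (f := η2) (by fun_prop)
  set C5 := ((9 + 2 * C1) ^ 2 / 4 + 3 * C1) * μ + 2 * μ ^ 2 + 4 * μ ^ 3 with hC5
  have hC50 : 0 ≤ C5 := by positivity
  set C6 := H0 * (B1 + 3 * B2 + B3 + B4 + C5) + H2 * μ + H1 * B5 with hC6
  have hC60 : 0 ≤ C6 := by positivity
  set η0 := (t1 - s1) ^ 2 * (s2 - t2) ^ 2 with hη0
  have hη0p : 0 < η0 := by
    have : 0 < t1 - s1 := by linarith
    have : 0 < s2 - t2 := by linarith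
    positivity
  refine ⟨C6 * (s2 - s1) / (4 * η0), div_nonneg (mul_nonneg hC60 (by linarith)) (by positivity), fun n hn => ?_⟩
  have hn0 : 0 < n := by linarith
  have hn1 : 1 ≤ n := by linarith
  have hsub : Icc 1 n ⊆ S := Icc_subset_Ici_self.trans hS
  have cψ2 : Continuous (ψm2 n) := by unfold ψm2; fun_prop
  have cψ : Continuous (ψm n) := by unfold ψm; fun_prop
  set P : ℝ → ℝ := fun t => ∫ r in (1:ℝ)..n, ψm n r * Jc p q zr with hP
  set P' : ℝ → ℝ := fun t => ∫ r in (1:ℝ)..n, ψm n r * Jt p q zr with hP'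
  set N : ℝ → ℝ := fun t => ∫ r in (1:ℝ)..n, φm n r * rpq * r with hN
  set J1 : ℝ → ℝ := fun t => φm n 1 * Jc p q (t, 1) with hJ1
  have dP : ∀ t ∈ I, HasDerivAt P (P' t) t := fun t ht => h.I2 hn1 hsub cψ ht
  have hφn : φm n n = 0 := by simp [φm, div_self hn0.ne']
  have dN : ∀ t ∈ I, HasDerivAt N (2 * P t + 2 * J1 t) t := by
    intro t ht
    have := h.I1 (zero_le_one) hn1 hsub (fun r => hφm hn0 r) (by fun_prop) ht
    refine this.congr_deriv ?_
    rw [hφn]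
    have e : ∫ r in (1:ℝ)..n, -(1 / n) * rn ^ 3 * r * Jc p q zr = P t := by
      simp only [hP]; congr 1; ext r; unfold ψm; ring
    rw [e]; simp only [hJ1]; ring
  have cP' : ContinuousOn P' I := by
    refine param_cont (F' := fun t r => ψm n r * Jt p q zr) h.hI hn1 ?_
    have h1 := h.Jt_cont.mono (prod_mono (le_refl I) hsub)
    have h2 := csnd cψ (I ×ˢ Icc 1 n)
    exact h2.mul h1
  have cN : ContinuousOn N I := fun t ht => (dN t ht).continuousAt.continuousWithinAt
  set F' : ℝ → ℝ := fun t => η t * P' t - 1 / 2 * η2 t * N t - η1 t * J1 t with hF'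
  have dF : ∀ t ∈ I, HasDerivAt (fun t => η t * P t - 1 / 2 * (η1 t * N t)) (F' t) t := by
    intro t ht
    exact (((dη t).mul (dP t ht)).sub (((dη1 t).mul (dN t ht)).const_mul (1 / 2))).congr_deriv (by
      simp only [hF']; ring)
  have cF' : ContinuousOn F' (Icc s1 s2) := by
    have a1 := cP'.mono hI
    have a2 := cN.mono hI
    have a3 : ContinuousOn J1 (Icc s1 s2) := (tr h.J_cont).const_smul (φm n 1)
    have a4 : Continuous η := by fun_prop
    have a5 : Continuous η1 := by fun_prop
    have a6 : Continuous η2 := by fun_prop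
    simp only [hF']; fun_prop
  have iF' : IntervalIntegrable F' volume s1 s2 :=
    ContinuousOn.intervalIntegrable (by rwa [uIcc_of_le hs12])
  have I0 : ∫ t in s1..s2, F' t = 0 := by
    rw [intervalIntegral.integral_eq_sub_of_hasDerivAt (f := fun t => η t * P t - 1 / 2 * (η1 t * N t))
      (by rw [uIcc_of_le hs12]; exact fun t ht => dF t (hI ht)) iF']
    simp [hη, hη1]
  have hη_nn : ∀ t, 0 ≤ η t := fun t => by simp only [hη]; positivity
  have cK : ContinuousOn (Kn p q n) (Icc s1 s2) := (Kn_cont h hS hn1).mono hI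
  have key : ∀ t ∈ Icc s1 s2, 4 * (η t * Kn p q n t) - C6 ≤ F' t := by
    intro t ht
    obtain ⟨G, cG, hG, hint⟩ := h.I2' hn1 hsub (hψm hn0) (hψm1 hn0) cψ2 hW (hI ht)
    have mb := mor_bulk h hS hc0 hc1 (hI ht) hn hμ0 hC1 (hμ t ht n hn1) (hW1 t ht) cG hG
    obtain ⟨f1, f2, -, -, -, f6, f7⟩ := psi_facts hn (r := 1) ⟨le_rfl, hn1⟩
    have f1' : |ψm n 1| ≤ 1 := by linarith
    have hBn : Bv c0 (ψm n) (ψm1 n) p q (t, n) = 0 := by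
      simp [Bv, ψm, ψm1, div_self hn0.ne']
    have hB1' : Bv c0 (ψm n) (ψm1 n) p q (t, 1) ≤ B1 + 3 * B2 + B3 + B4 := by
      have ab : ∀ {x y X Y : ℝ}, |x| ≤ X → |y| ≤ Y → |x * y| ≤ X * Y := by
        intro x y X Y hx hy
        rw [abs_mul]; exact mul_le_mul hx hy (abs_nonneg _) ((abs_nonneg _).trans hx)
      have g1 := abs_le.1 (ab f1' (b1 t ht))
      have g2 := abs_le.1 (ab f2 (b2 t ht))
      have g3 := abs_le.1 (ab f1' (b3 t ht))
      have hc0' : |c0| ≤ 1 := by rw [abs_of_nonneg hc0]; exact hc1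
      have g4 := abs_le.1 (ab hc0' (ab f1' (b4 t ht)))
      simp only [Bv]
      linarith [g1.2, g2.1, g3.1, g4.1]
    have hPl : 4 * Kn p q n t - C5 - (B1 + 3 * B2 + B3 + B4) ≤ P' t := by
      simp only [hP']; rw [hint, hBn]; linarith
    have hN0 : 0 ≤ N t := by
      refine intervalIntegral.integral_nonneg hn1 fun r hr => ?_
      have := rho_nonneg (p := p) (q := q) zr
      have := hr.1
      unfold φm; positivity
    have hNμ : N t ≤ μ := by
      refine le_trans ?_ (hμ t ht n hn1)
      have k1 := (h.slices hS (hI ht) n).1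
      have cφ : Continuous (φm n) := by unfold φm; fun_prop
      refine intervalIntegral.integral_mono_on hn1 ?_ ?_ fun r hr => ?_
      · exact ContinuousOn.intervalIntegrable (by rw [uIcc_of_le hn1]; fun_prop)
      · exact ContinuousOn.intervalIntegrable (by rw [uIcc_of_le hn1]; fun_prop)
      · have hr1 := hr.1
        have : φm n r ≤ 1 := by
          have hx : r / n ≤ 1 := (div_le_one hn0).2 hr.2
          have hx0 : 0 ≤ r / n := by positivity
          have : rn ^ 4 ≤ 1 := pow_le_one₀ (by linarith) (by linarith)
          unfold φm; linarith
        have := mul_le_of_le_one_left (rho_nonneg (p := p) (q := q) zr) this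
        exact mul_le_mul_of_nonneg_right this (by linarith)
    have hJ1' : |J1 t| ≤ B5 := by
      have : |φm n 1| ≤ 1 := by
        have hx : 1 / n ≤ 1 := (div_le_one hn0).2 hn1
        have hx0 : 0 ≤ 1 / n := by positivity
        have : (1 - 1 / n) ^ 4 ≤ 1 := pow_le_one₀ (by linarith) (by linarith)
        have : 0 ≤ (1 - 1 / n) ^ 4 := by positivity
        unfold φm; rw [abs_le]; constructor <;> linarith
      simp only [hJ1]; rw [abs_mul]
      calc _ ≤ 1 * B5 := mul_le_mul this (b5 t ht) (abs_nonneg _) zero_le_one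
        _ = B5 := one_mul _
    have u1 : η t * (4 * Kn p q n t - C5 - (B1 + 3 * B2 + B3 + B4)) ≤ η t * P' t :=
      mul_le_mul_of_nonneg_left hPl (hη_nn t)
    have u2 : η t * (C5 + (B1 + 3 * B2 + B3 + B4)) ≤ H0 * (C5 + (B1 + 3 * B2 + B3 + B4)) :=
      mul_le_mul_of_nonneg_right ((le_abs_self _).trans (e0 t ht)) (by positivity)
    have u3 : η2 t * N t ≤ H2 * μ :=
      mul_le_mul ((le_abs_self _).trans (e2 t ht)) hNμ hN0 hH2
    have u4 : η1 t * J1 t ≤ H1 * B5 := by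
      refine (le_abs_self _).trans ?_
      rw [abs_mul]; exact mul_le_mul (e1 t ht) hJ1' (abs_nonneg _) hH1
    have u5 : 0 ≤ H2 * μ := by positivity
    simp only [hF', hC6]
    linarith
  have cη : Continuous η := by fun_prop
  have cηK : ContinuousOn (fun t => 4 * (η t * Kn p q n t)) (Icc s1 s2) := by fun_prop
  have iηK : IntervalIntegrable (fun t => 4 * (η t * Kn p q n t)) volume s1 s2 :=
    ContinuousOn.intervalIntegrable (by rwa [uIcc_of_le hs12])
  have L1 := intervalIntegral.integral_mono_on hs12
    (iηK.sub (intervalIntegrable_const (c := C6))) iF' key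
  rw [intervalIntegral.integral_sub iηK intervalIntegrable_const, I0, intervalIntegral.integral_const,
    smul_eq_mul] at L1
  have L2 : ∫ t in t1..t2, 4 * (η t * Kn p q n t) ≤ ∫ t in s1..s2, 4 * (η t * Kn p q n t) := by
    refine intervalIntegral.integral_mono_interval h1.le h12 h2.le ?_ iηK
    refine Eventually.of_forall fun t => ?_
    have := Kn_nonneg (p := p) (q := q) hn1 t
    have := hη_nn t
    simp only [Pi.zero_apply]
    positivity
  have ht12 : Icc t1 t2 ⊆ Icc s1 s2 := Icc_subset_Icc h1.le h2.le
  have L3 : ∫ t in t1..t2, 4 * η0 * Kn p q n t ≤ ∫ t in t1..t2, 4 * (η t * Kn p q n t) := by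
    refine intervalIntegral.integral_mono_on h12 ?_ ?_ fun t ht => ?_
    · exact ContinuousOn.intervalIntegrable (by rw [uIcc_of_le h12]; exact (cK.mono ht12).const_smul (4 * η0))
    · exact ContinuousOn.intervalIntegrable (by rw [uIcc_of_le h12]; exact (cηK.mono ht12))
    · have a := Kn_nonneg (p := p) (q := q) hn1 t
      have : η0 ≤ η t := by
        simp only [hη, hη0]
        have := ht.1
        have := ht.2
        gcongr <;> linarith
      rw [mul_assoc]; gcongr
  rw [intervalIntegral.integral_const_mul] at L3
  rw [le_div_iff₀ (by positivity)]
  linarith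
end
end
end CSSP

namespace CSSP
noncomputable section
open scoped ContDiff Topology

def gv (m : ℕ) (p q f : ℝ × ℝ → ℝ) (z : ℝ × ℝ) : ℝ := dR f z - av m p q z * f z / z.2

def Wg (m : ℕ) (p q : ℝ × ℝ → ℝ) (z : ℝ × ℝ) : ℝ :=
  (1 + av m p q z) ^ 2 / z.2 ^ 2 + Av m p q z - rho p q z

section
variable {p q f : ℝ × ℝ → ℝ} {m : ℕ}

lemma OM_sub : OM ⊆ II ×ˢ (univ : Set ℝ) := prod_mono le_rfl (subset_univ _)

lemma Dat.gv_sm (h : Dat m p q) (hf : ContDiffOn ℝ (⊤ : ℕ∞) f (II ×ˢ univ)) :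
    ContDiffOn ℝ (⊤ : ℕ∞) (gv m p q f) OM := by
  have h2 : ContDiffOn ℝ (⊤ : ℕ∞) (fun z : ℝ × ℝ => z.2) OM := contDiff_snd.contDiffOn
  exact ((dR_smooth isOpen_IU hf).mono OM_sub).sub
    ((h.a_sm.1.mul (hf.mono OM_sub)).div h2 (fun z hz => (ne_of_gt hz.2)))

lemma Dat.gv_R (h : Dat m p q) (hf : ContDiffOn ℝ (⊤ : ℕ∞) f (II ×ˢ univ)) {t r : ℝ}
    (ht : t ∈ II) (hr : 0 < r) :
    dR (gv m p q f) zr = dR (dR f) zr + 1 / 2 * rpq * f zr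
      - apq * dR f zr / r + apq * f zr / r ^ 2 := by
  have hz : zr ∈ OM := ⟨ht, hr⟩
  have hz' := OM_sub hz
  have h1 := hdR isOpen_OM (h.gv_sm hf) hz
  have ha := hdR isOpen_OM h.a_sm.1 hz
  rw [(h.a_sm.2 _ hz).2] at ha
  have h2 := (hdR isOpen_IU (dR_smooth isOpen_IU hf) hz').sub
    ((ha.mul (hdR isOpen_IU hf hz')).div (hasDerivAt_id r) hr.ne')
  rw [h1.unique h2]
  simp only [id, Pi.mul_apply]
  field_simp
  ring

lemma Dat.gv_T (h : Dat m p q) (hf : ContDiffOn ℝ (⊤ : ℕ∞) f (II ×ˢ univ)) {t r : ℝ}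
    (ht : t ∈ II) (hr : 0 < r) :
    dT (gv m p q f) zr = dR (dT f) zr - Jc p q zr * f zr
      - apq * dT f zr / r := by
  have hz : zr ∈ OM := ⟨ht, hr⟩
  have hz' := OM_sub hz
  have h1 := hdT isOpen_OM (h.gv_sm hf) hz
  have ha := hdT isOpen_OM h.a_sm.1 hz
  rw [(h.a_sm.2 _ hz).1] at ha
  have h2 := (hdT isOpen_IU (dR_smooth isOpen_IU hf) hz').sub
    ((ha.mul (hdT isOpen_IU hf hz')).div_const r)
  rw [h1.unique h2, dTR isOpen_IU hf hz']
  simp only []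
  field_simp
  ring

lemma Dat.gv_RR (h : Dat m p q) (hf : ContDiffOn ℝ (⊤ : ℕ∞) f (II ×ˢ univ)) {t r : ℝ}
    (ht : t ∈ II) (hr : 0 < r) :
    dR (dR (gv m p q f)) zr = dR (dR (dR f)) zr
      + (p zr * dR p zr + q zr * dR q zr) * f zr
      + rpq * dR f zr
      - apq * dR (dR f) zr / r + 2 * apq * dR f zr / r ^ 2
      - 1 / 2 * rpq * f zr / r - 2 * apq * f zr / r ^ 3 := by
  have hz : zr ∈ OM := ⟨ht, hr⟩
  have hz' := OM_sub hz
  have h1 := hdR isOpen_OM (dR_smooth isOpen_OM (h.gv_sm hf)) hz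
  have ha := hdR isOpen_OM h.a_sm.1 hz
  rw [(h.a_sm.2 _ hz).2] at ha
  have f0 := hdR isOpen_IU hf hz'
  have f1 := hdR isOpen_IU (dR_smooth isOpen_IU hf) hz'
  have f2 := hdR isOpen_IU (dR_smooth isOpen_IU (dR_smooth isOpen_IU hf)) hz'
  have hrho := rho_r h.gen ht (mem_univ r)
  have hi := hasDerivAt_id r
  have h2 := ((f2.add ((hrho.const_mul (1/2)).mul f0)).sub ((ha.mul f1).div hi hr.ne')).add
    ((ha.mul f0).div (hi.pow 2) (pow_ne_zero 2 hr.ne'))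
  have ev : (fun s => dR (gv m p q f) zs) =ᶠ[𝓝 r] fun s => dR (dR f) zs
      + 1 / 2 * rho p q zs * f zs
      - av m p q zs * dR f zs / s + av m p q zs * f zs / s ^ 2 := by
    filter_upwards [Ioi_mem_nhds hr] with s hs
    exact h.gv_R hf ht hs
  have h3 := (h1.congr_of_eventuallyEq ev.symm).unique h2
  rw [h3]
  simp only [id, Pi.mul_apply, Pi.pow_apply]
  norm_num
  field_simp
  ring

lemma Dat.W_r (h : Dat m p q) {t r : ℝ} (ht : t ∈ II) (hr : 0 < r) :
    HasDerivAt (fun s => Wv m p q zs) (-(2 * apq ^ 2 / r ^ 3)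
      - 2 * (p zr * dR p zr + q zr * dR q zr)) r := by
  have hz : zr ∈ OM := ⟨ht, hr⟩
  have ha := hdR isOpen_OM h.a_sm.1 hz
  rw [(h.a_sm.2 _ hz).2] at ha
  have hrho := rho_r h.gen ht (mem_univ r)
  have h2 := (((ha.pow 2).div ((hasDerivAt_id r).pow 2) (pow_ne_zero 2 hr.ne')).add (h.A_r ht hr)).sub hrho
  refine h2.congr_deriv ?_
  simp only [id, Pi.pow_apply]
  norm_num
  field_simp
  ring

lemma Dat.ggen (h : Dat m p q) : Gen II (Ioi 0) (gv m p q p) (gv m p q q) (Wg m p q) where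
  hI := isOpen_Ioo
  hS := isOpen_Ioi
  ps := h.gv_sm h.ps
  qs := h.gv_sm h.qs
  eqp := by
    intro t ht r _ hr
    have hz' : zr ∈ II ×ˢ (univ : Set ℝ) := ⟨ht, trivial⟩
    rw [h.gv_T h.ps ht hr, h.gv_RR h.qs ht hr, h.gv_R h.qs ht hr]
    have f0 := hdR isOpen_IU h.qs hz'
    have f1 := hdR isOpen_IU (dR_smooth isOpen_IU h.qs) hz'
    have f2 := hdR isOpen_IU (dR_smooth isOpen_IU (dR_smooth isOpen_IU h.qs)) hz'
    have hT := hdR isOpen_IU (dT_smooth isOpen_IU h.ps) hz'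
    have ev : (fun s => dT p zs) =ᶠ[𝓝 r] fun s =>
        -dR (dR q) zs - dR q zs / s + Wv m p q zs * q zs := by
      filter_upwards [Ioi_mem_nhds hr] with s hs
      exact h.eqp t ht s hs
    have h2 := (f2.neg.sub (f1.div (hasDerivAt_id r) hr.ne')).add ((h.W_r ht hr).mul f0)
    rw [(hT.congr_of_eventuallyEq ev.symm).unique h2, h.eqp t ht r hr]
    simp only [Wg, Wv, Jc, gv, rho, id]
    field_simp
    ring
  eqq := by
    intro t ht r _ hr
    have hz' : zr ∈ II ×ˢ (univ : Set ℝ) := ⟨ht, trivial⟩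
    rw [h.gv_T h.qs ht hr, h.gv_RR h.ps ht hr, h.gv_R h.ps ht hr]
    have f0 := hdR isOpen_IU h.ps hz'
    have f1 := hdR isOpen_IU (dR_smooth isOpen_IU h.ps) hz'
    have f2 := hdR isOpen_IU (dR_smooth isOpen_IU (dR_smooth isOpen_IU h.ps)) hz'
    have hT := hdR isOpen_IU (dT_smooth isOpen_IU h.qs) hz'
    have ev : (fun s => dT q zs) =ᶠ[𝓝 r] fun s =>
        dR (dR p) zs + dR p zs / s - Wv m p q zs * p zs := by
      filter_upwards [Ioi_mem_nhds hr] with s hs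
      exact h.eqq t ht s hs
    have h2 := (f2.add (f1.div (hasDerivAt_id r) hr.ne')).sub ((h.W_r ht hr).mul f0)
    rw [(hT.congr_of_eventuallyEq ev.symm).unique h2, h.eqq t ht r hr]
    simp only [Wg, Wv, Jc, gv, rho, id]
    field_simp
    ring
end
end
end CSSP

namespace CSSP
noncomputable section
open scoped ContDiff Topology

lemma cut_lim {F : ℕ → ℝ → ℝ} {F0 B : ℝ → ℝ} {a : ℕ → ℝ} (ha0 : ∀ n, 0 ≤ a n)
    (han : ∀ n : ℕ, 1 ≤ n → a n ≤ n) (ha : Tendsto a atTop (𝓝 0))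
    (cF : ∀ n : ℕ, 1 ≤ n → ContinuousOn (F n) (Ioc (a n) n)) (hB : IntegrableOn B (Ioi 0))
    (hB0 : ∀ r, 0 < r → 0 ≤ B r)
    (hle : ∀ n : ℕ, 1 ≤ n → ∀ r ∈ Ioc (a n) (n : ℝ), |F n r| ≤ B r)
    (hl : ∀ r, 0 < r → Tendsto (fun n => F n r) atTop (𝓝 (F0 r))) :
    Tendsto (fun n : ℕ => ∫ r in a n..(n : ℝ), F n r) atTop (𝓝 (∫ r in Ioi (0:ℝ), F0 r)) := by
  have e : ∀ᶠ n : ℕ in atTop, ∫ r in Ioi (0:ℝ), (Ioc (a n) (n:ℝ)).indicator (F n) r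
      = ∫ r in a n..(n : ℝ), F n r := by
    filter_upwards [eventually_ge_atTop 1] with n hn
    rw [intervalIntegral.integral_of_le (han n hn), setIntegral_indicator measurableSet_Ioc]
    congr 2
    rw [inter_eq_right]
    exact fun r hr => lt_of_le_of_lt (ha0 n) hr.1
  refine Tendsto.congr' e ?_
  refine tendsto_integral_filter_of_dominated_convergence B ?_ ?_ hB ?_
  · filter_upwards [eventually_ge_atTop 1] with n hn
    exact ((aestronglyMeasurable_indicator_iff measurableSet_Ioc).2
      ((cF n hn).aestronglyMeasurable measurableSet_Ioc)).mono_measure Measure.restrict_le_self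
  · filter_upwards [eventually_ge_atTop 1] with n hn
    refine aeI (fun r hr => ?_)
    by_cases hm : r ∈ Ioc (a n) (n:ℝ)
    · rw [indicator_of_mem hm]; exact hle n hn r hm
    · rw [indicator_of_notMem hm, norm_zero]; exact hB0 r hr
  · refine aeI (fun r hr => ?_)
    refine (hl r hr).congr' ?_
    filter_upwards [ha.eventually (gt_mem_nhds hr), eventually_ge_atTop ⌈r⌉₊] with n h1 h2
    rw [indicator_of_mem]
    exact ⟨h1, (Nat.le_ceil r).trans (by exact_mod_cast h2)⟩

lemma abs_sub_le_int {f f' b : ℝ → ℝ} {t1 t2 : ℝ} (h12 : t1 ≤ t2)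
    (hd : ∀ t ∈ Icc t1 t2, HasDerivAt f (f' t) t) (cb : ContinuousOn b (Icc t1 t2))
    (hb : ∀ t ∈ Icc t1 t2, |f' t| ≤ b t) : |f t2 - f t1| ≤ ∫ t in t1..t2, b t := by
  have hI : IntegrableOn b (Icc t1 t2) := cb.integrableOn_Icc
  have c : ContinuousOn f (Icc t1 t2) := fun t ht => (hd t ht).continuousAt.continuousWithinAt
  have h1 := intervalIntegral.sub_le_integral_of_hasDeriv_right_of_le h12 c
    (fun t ht => (hd t (Ioo_subset_Icc_self ht)).hasDerivWithinAt) hI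
    (fun t ht => (le_abs_self _).trans (hb t (Ioo_subset_Icc_self ht)))
  have h2 := intervalIntegral.sub_le_integral_of_hasDeriv_right_of_le h12 c.neg
    (fun t ht => (hd t (Ioo_subset_Icc_self ht)).neg.hasDerivWithinAt) hI
    (fun t ht => (neg_le_abs _).trans (hb t (Ioo_subset_Icc_self ht)))
  simp only [Pi.neg_apply] at h2
  rw [abs_le]; constructor <;> linarith

def YY (p q : ℝ × ℝ → ℝ) (z : ℝ × ℝ) : ℝ := dR p z ^ 2 + dR q z ^ 2

structure Good (p q : ℝ × ℝ → ℝ) (T0 : ℝ) : Prop where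
  h1 : -1 ≤ T0
  h0 : T0 < 0
  int : ∀ t ∈ Ioo T0 0, IntegrableOn (fun r => ypq * r) (Ioi 0)
  bdd : ∀ s1 s2, T0 < s1 → s2 < 0 → ∃ C, ∀ t ∈ Icc s1 s2, ∫ r in Ioi (0:ℝ), ypq * r ≤ C
  blow : Tendsto (fun t => ∫ r in Ioi (0:ℝ), ypq * r) (𝓝[<] 0) atTop

section
variable {p q f : ℝ × ℝ → ℝ} {m : ℕ} {u : ℝ → ℝ → ℂ} {T0 : ℝ}

lemma YY_nonneg (z : ℝ × ℝ) : 0 ≤ YY p q z := by unfold YY; positivity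

lemma Dat.cY (h : Dat m p q) {t : ℝ} (ht : t ∈ II) : Continuous (fun r => ypq) := by
  have h1 := (dR_smooth isOpen_IU h.ps).continuousOn
  have h2 := (dR_smooth isOpen_IU h.qs).continuousOn
  exact slice_univ (F := YY p q) (by unfold YY; fun_prop) ht

lemma Dat.rhor_int (h : Dat m p q) {t : ℝ} (ht : t ∈ II) :
    IntegrableOn (fun r => rpq / r) (Ioi 0) := by
  obtain ⟨C, hC, hb⟩ := h.rho_near (t1 := t) (t2 := t) ht.1 ht.2
  refine (maj_int h ht C).1.mono' ?_ ?_
  · apply ContinuousOn.aestronglyMeasurable _ mI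
    exact (h.cr ht).continuousOn.div continuousOn_id fun r hr => ne_of_gt hr
  · refine aeI (fun r hr => ?_)
    rw [Real.norm_eq_abs, abs_of_nonneg (div_nonneg (rho_nonneg _) (le_of_lt hr))]
    exact maj_le (hb t ⟨le_rfl, le_rfl⟩) hr

lemma Dat.rhor_bdd (h : Dat m p q) {t1 t2 : ℝ} (h1 : -1 < t1) (h2 : t2 < 0) :
    ∃ C, 0 ≤ C ∧ ∀ t ∈ Icc t1 t2, ∫ r in Ioi (0:ℝ), rpq / r ≤ C := by
  obtain ⟨C, hC, hb⟩ := h.rho_near h1 h2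
  refine ⟨C + 4 * (m + 1), by positivity, fun t ht => ?_⟩
  have htI : t ∈ II := Icc_subset_Ioo h1 h2 ht
  rw [← (maj_int h htI C).2]
  exact setIntegral_mono_on (h.rhor_int htI) (maj_int h htI C).1 mI
    fun r hr => maj_le (hb t ht) hr

lemma exists_good (h : Dat m p q) (hl : Link p q u) (hu : IsCSS m (Set.Ioo (-1 : ℝ) 0) u)
    (hblow : Tendsto
      (fun t => Real.sqrt (2 * Real.pi * ∫ r in Set.Ioi (0:ℝ), ‖deriv (u t) r‖ ^ 2 * r))
      (nhdsWithin 0 (Set.Ioo (-1 : ℝ) 0)) atTop) : ∃ T0, Good p q T0 := by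
  have hY : ∀ t ∈ II, ∫ r in Set.Ioi (0:ℝ), ‖deriv (u t) r‖ ^ 2 * r
      = ∫ r in Ioi (0:ℝ), ypq * r := fun t ht =>
    setIntegral_congr_fun mI fun r hr => by
      simp only [hl.norm_deriv h.ps h.qs t ht r hr, YY]
  have hnh : 𝓝[Ioo (-1:ℝ) 0] 0 = 𝓝[<] 0 := nhdsWithin_Ioo_eq_nhdsLT (by norm_num)
  rw [hnh] at hblow
  have hpi := Real.pi_pos
  have hII : ∀ᶠ t in 𝓝[<] (0:ℝ), t ∈ II := by
    rw [← hnh]; exact self_mem_nhdsWithin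
  have hb : Tendsto (fun t => ∫ r in Ioi (0:ℝ), ypq * r) (𝓝[<] 0) atTop := by
    rw [tendsto_atTop] at hblow ⊢
    intro b
    filter_upwards [hblow (Real.sqrt (2 * Real.pi * (max b 0 + 1))), hII] with t h1 h2
    rw [hY t h2] at h1
    by_contra hc
    push Not at hc
    have : 2 * Real.pi * ∫ r in Ioi (0:ℝ), ypq * r < 2 * Real.pi * (max b 0 + 1) := by
      have := le_max_left b 0
      gcongr; linarith
    have := Real.sqrt_lt_sqrt ?_ this
    · linarith
    · have : 0 ≤ ∫ r in Ioi (0:ℝ), ypq * r :=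
        setIntegral_nonneg mI fun r hr => mul_nonneg (YY_nonneg _) (le_of_lt hr)
      positivity
  have hev : ∀ᶠ t in 𝓝[<] (0:ℝ), IntegrableOn (fun r => ypq * r) (Ioi 0) := by
    filter_upwards [hb.eventually (eventually_ge_atTop 1)] with t ht
    by_contra hc
    rw [integral_undef hc] at ht
    linarith
  obtain ⟨l, hl0, hl1⟩ := (mem_nhdsLT_iff_exists_Ioo_subset' (show (-1:ℝ) < 0 by norm_num)).1
    (hev.and hII)
  have hint : ∀ t ∈ Ioo (max l (-1)) (0:ℝ), IntegrableOn (fun r => ypq * r) (Ioi 0) :=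
    fun t ht => (hl1 ⟨(le_max_left _ _).trans_lt ht.1, ht.2⟩).1
  refine ⟨max l (-1), le_max_right _ _, max_lt hl0 (by norm_num), hint, ?_, hb⟩
  intro s1 s2 h1 h2
  have h1' : -1 < s1 := (le_max_right _ _).trans_lt h1
  obtain ⟨C, hC⟩ := hu.bounded (Icc s1 s2) (Icc_subset_Ioo h1' h2) isCompact_Icc
  refine ⟨C ^ 2, fun t ht => ?_⟩
  have htI : t ∈ II := Icc_subset_Ioo h1' h2 ht
  have htg : t ∈ Ioo (max l (-1)) (0:ℝ) := ⟨h1.trans_le ht.1, ht.2.trans_lt h2⟩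
  have hCt : Real.sqrt (H1msq m (u t)) ≤ C := by
    have := hC t ht
    have := Real.sqrt_nonneg (L2sq (u t))
    linarith
  have hC2 := (Real.sqrt_le_left ((Real.sqrt_nonneg _).trans hCt)).1 hCt
  have e : H1msq m (u t) = 2 * Real.pi * ∫ r in Ioi (0:ℝ), (ypq * r + m ^ 2 * (rpq / r)) := by
    unfold H1msq
    congr 1
    refine setIntegral_congr_fun mI fun r hr => ?_
    have hr0 : 0 < r := hr
    simp only [hl.norm_deriv h.ps h.qs t htI r hr, hl.norm t htI r hr, YY]
    field_simp
  rw [e] at hC2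
  have i1 := hint t htg
  have i2 := (h.rhor_int htI).const_mul ((m:ℝ) ^ 2)
  rw [integral_add i1 i2] at hC2
  have n1 : 0 ≤ ∫ r in Ioi (0:ℝ), ypq * r :=
    setIntegral_nonneg mI fun r hr => mul_nonneg (YY_nonneg _) (le_of_lt hr)
  have n2 : 0 ≤ ∫ r in Ioi (0:ℝ), (m:ℝ) ^ 2 * (rpq / r) :=
    setIntegral_nonneg mI fun r hr =>
      mul_nonneg (by positivity) (div_nonneg (rho_nonneg _) (le_of_lt hr))
  have := Real.pi_gt_three
  nlinarith

lemma Good.mem (hg : Good p q T0) {t : ℝ} (ht : t ∈ Ioo T0 0) : t ∈ II := ⟨hg.h1.trans_lt ht.1, ht.2⟩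

lemma Good.rho_le (hg : Good p q T0) (h : Dat m p q) {t : ℝ} (ht : t ∈ Ioo T0 0) {r : ℝ} (hr : 0 ≤ r) :
    rpq ≤ (∫ r in Ioi (0:ℝ), ypq * r) + ∫ r in Ioi (0:ℝ), rpq / r := by
  have htI := hg.mem ht
  have i1 := hg.int t ht
  have i2 := h.rhor_int htI
  rw [← integral_add i1 i2]
  have c1 := slice_univ (dR_smooth isOpen_IU h.ps).continuousOn htI
  have c2 := slice_univ (dR_smooth isOpen_IU h.qs).continuousOn htI
  have c3 := slice_univ h.ps.continuousOn htI
  have c4 := slice_univ h.qs.continuousOn htI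
  have ii := (i1.add i2)
  have s := intervalIntegral.sub_le_integral_of_hasDeriv_right_of_le hr (h.cr htI).continuousOn
    (fun s _ => (rho_r h.gen htI (mem_univ s)).hasDerivWithinAt)
    (φ := fun r => ypq * r + rpq / r)
    ((integrableOn_Icc_iff_integrableOn_Ioc (by simp)).2 (IntegrableOn.mono_set (s := Ioc 0 r) (t := Ioi 0) ii Ioc_subset_Ioi_self)) ?_
  · have h0 : rho p q (t, 0) = 0 := by simp [rho, h.p0 t htI, h.q0 t htI]
    rw [h0, sub_zero] at s
    refine s.trans ?_
    rw [intervalIntegral.integral_of_le hr]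
    refine setIntegral_mono_set ii ?_ (LE.le.eventuallyLE Ioc_subset_Ioi_self)
    refine aeI (fun r hr => ?_)
    exact add_nonneg (mul_nonneg (YY_nonneg _) (le_of_lt hr)) (div_nonneg (rho_nonneg _) (le_of_lt hr))
  · intro s hs
    have hs0 := hs.1
    have e : YY p q zs * s + rho p q zs / s - 2 * (p zs * dR p zs + q zs * dR q zs)
      = s * ((dR p zs - p zs / s) ^ 2 + (dR q zs - q zs / s) ^ 2) := by
      unfold YY rho; field_simp; ring
    have : 0 ≤ s * ((dR p zs - p zs / s) ^ 2 + (dR q zs - q zs / s) ^ 2) := by positivity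
    linarith

lemma Good.rho_bdd (hg : Good p q T0) (h : Dat m p q) {s1 s2 : ℝ} (h1 : T0 < s1) (h2 : s2 < 0) :
    ∃ C, 0 ≤ C ∧ ∀ t ∈ Icc s1 s2, ∀ r, 0 ≤ r → rpq ≤ C := by
  obtain ⟨C1, h1'⟩ := hg.bdd s1 s2 h1 h2
  obtain ⟨C2, hC2, h2'⟩ := h.rhor_bdd (hg.h1.trans_lt h1) h2
  refine ⟨max (C1 + C2) 0, le_max_right _ _, fun t ht r hr => ?_⟩
  refine (hg.rho_le h ⟨h1.trans_le ht.1, ht.2.trans_lt h2⟩ hr).trans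
    (le_trans ?_ (le_max_left _ _))
  linarith [h1' t ht, h2' t ht]

/-- `|g|^2`. -/
def gg (m : ℕ) (p q : ℝ × ℝ → ℝ) (z : ℝ × ℝ) : ℝ := rho (gv m p q p) (gv m p q q) z

lemma gg_nonneg (z : ℝ × ℝ) : 0 ≤ gg m p q z := rho_nonneg _

lemma gg_eq {t r : ℝ} (hr : 0 < r) : gpq = ypq
    - 2 * apq / r * (p zr * dR p zr + q zr * dR q zr)
    + apq ^ 2 * rpq / r ^ 2 := by
  unfold gg YY rho gv; field_simp; ring

lemma Dat.gg_le (h : Dat m p q) {t r : ℝ} (ht : t ∈ II) (hr : 0 < r) : gpq * r ≤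
    2 * (ypq * r) + 2 * mm2 ^ 2 * (rpq / r) := by
  have ha := h.a_abs ht hr.le
  have ha2 : apq ^ 2 ≤ mm2 ^ 2 := by
    rw [← sq_abs]; gcongr
  have e : 2 * (ypq * r) + 2 * apq ^ 2 * (rpq / r) - gpq * r
    = r * ((dR p zr + apq * p zr / r) ^ 2
      + (dR q zr + apq * q zr / r) ^ 2) := by
    unfold gg YY rho gv; field_simp; ring
  have : 0 ≤ r * ((dR p zr + apq * p zr / r) ^ 2
      + (dR q zr + apq * q zr / r) ^ 2) := by positivity
  have h0 : 0 ≤ rpq / r := div_nonneg (rho_nonneg _) hr.le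
  have := mul_le_mul_of_nonneg_right ha2 h0
  linarith

lemma Dat.gg_cont (h : Dat m p q) : ContinuousOn (gg m p q) OM :=
  (((h.gv_sm h.ps).pow 2).add ((h.gv_sm h.qs).pow 2)).continuousOn

lemma Dat.cg (h : Dat m p q) {t : ℝ} (ht : t ∈ II) : ContinuousOn (fun r => gpq) (Ioi 0) :=
  slice_pos h.gg_cont ht

def ee (m : ℕ) (p q : ℝ × ℝ → ℝ) (t : ℝ) : ℝ := ∫ r in Ioi (0:ℝ), gpq * r

lemma ee_nonneg (t : ℝ) : 0 ≤ ee m p q t :=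
  setIntegral_nonneg mI fun r hr => mul_nonneg (gg_nonneg _) (le_of_lt hr)

lemma Good.gg_int (hg : Good p q T0) (h : Dat m p q) {t : ℝ} (ht : t ∈ Ioo T0 0) :
    IntegrableOn (fun r => gpq * r) (Ioi 0) := by
  have htI := hg.mem ht
  refine (((hg.int t ht).const_mul 2).add ((h.rhor_int htI).const_mul (2 * mm2 ^ 2))).mono' ?_ ?_
  · exact ((h.cg htI).mul continuousOn_id).aestronglyMeasurable mI
  · refine aeI (fun r hr => ?_)
    rw [Real.norm_eq_abs, abs_of_nonneg (mul_nonneg (gg_nonneg _) (le_of_lt hr))]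
    exact h.gg_le htI hr

lemma Good.ee_bdd (hg : Good p q T0) (h : Dat m p q) {s1 s2 : ℝ} (h1 : T0 < s1) (h2 : s2 < 0) :
    ∃ C, 0 < C ∧ ∀ t ∈ Icc s1 s2, ee m p q t ≤ C := by
  obtain ⟨C1, h1'⟩ := hg.bdd s1 s2 h1 h2
  obtain ⟨C2, hC2, h2'⟩ := h.rhor_bdd (hg.h1.trans_lt h1) h2
  refine ⟨max (2 * C1 + 2 * mm2 ^ 2 * C2) 1, by positivity, fun t ht => ?_⟩
  have htg : t ∈ Ioo T0 0 := ⟨h1.trans_le ht.1, ht.2.trans_lt h2⟩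
  have htI := hg.mem htg
  have i1 := (hg.int t htg).const_mul 2
  have i2 := (h.rhor_int htI).const_mul (2 * mm2 ^ 2)
  have := setIntegral_mono_on (hg.gg_int h htg) (i1.add i2) mI fun r hr => h.gg_le htI hr
  simp only [Pi.add_apply] at this
  rw [integral_add i1 i2, integral_const_mul, integral_const_mul] at this
  refine le_trans ?_ (le_max_left _ _)
  have a1 := h1' t ht
  have a2 := h2' t ht
  have a3 : 2 * (2 * (m:ℝ) + 2) ^ 2 * (∫ r in Ioi (0:ℝ), rpq / r) ≤ 2 * mm2 ^ 2 * C2 := by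
    gcongr
  unfold ee; linarith

lemma Good.gg_part (hg : Good p q T0) (h : Dat m p q) {t α β : ℝ} (ht : t ∈ Ioo T0 0) (hα : 0 ≤ α)
    (hab : α ≤ β) : ∫ r in α..β, gpq * r ≤ ee m p q t := by
  rw [intervalIntegral.integral_of_le hab]
  refine setIntegral_mono_set (hg.gg_int h ht) ?_ ?_
  · refine aeI (fun r hr => ?_)
    exact mul_nonneg (gg_nonneg _) (le_of_lt hr)
  · exact LE.le.eventuallyLE fun r hr => lt_of_le_of_lt hα hr.1

lemma Dat.gv_near (h : Dat m p q) (hf : ContDiffOn ℝ (⊤ : ℕ∞) f (II ×ˢ univ))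
    (f0 : ∀ t ∈ II, f (t, 0) = 0) {t1 t2 : ℝ} (h1 : -1 < t1) (h2 : t2 < 0) :
    ∃ C, 0 ≤ C ∧ ∀ t ∈ Icc t1 t2, ∀ r ∈ Ioc (0:ℝ) 1, |gv m p q f zr| ≤ C ∧
      |dR (gv m p q f) zr| ≤ C := by
  obtain ⟨C, hC, hn⟩ := near_zero hf f0 h1 h2
  obtain ⟨D, hD, hρ⟩ := h.rho_near h1 h2
  set K : ℝ := 2 * m + 2 with hK
  have hK0 : 0 ≤ K := by positivity
  refine ⟨C + K * C + D * C, by positivity, fun t ht r hr => ?_⟩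
  have htI : t ∈ II := Icc_subset_Ioo h1 h2 ht
  obtain ⟨n1, n2, n3, n4, n5⟩ := hn t ht r ⟨hr.1.le, hr.2⟩
  have hρ' := hρ t ht r ⟨hr.1.le, hr.2⟩
  have hr0 := hr.1
  have hr1 := hr.2
  have ha := h.a_abs htI hr0.le
  have hρ0 := rho_nonneg (p := p) (q := q) zr
  constructor
  · have : |apq * f zr / r| ≤ K * C := by
      rw [abs_div, abs_mul, abs_of_pos hr0, div_le_iff₀ hr0, mul_assoc]
      exact mul_le_mul ha n1 (abs_nonneg _) hK0
    have := abs_sub (dR f zr) (apq * f zr / r)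
    have : 0 ≤ D * C := by positivity
    unfold gv; simp only; linarith
  · rw [h.gv_R hf htI hr0]
    have e : dR (dR f) zr + 1 / 2 * rpq * f zr
      - apq * dR f zr / r + apq * f zr / r ^ 2
      = dR (dR f) zr + 1 / 2 * rpq * f zr
        - apq * ((r * dR f zr - f zr) / r ^ 2) := by field_simp; ring
    rw [e]
    have b1 : |apq * ((r * dR f zr - f zr) / r ^ 2)| ≤ K * C := by
      rw [abs_mul]
      refine mul_le_mul ha ?_ (abs_nonneg _) hK0
      rw [abs_div, abs_of_pos (by positivity : 0 < r ^ 2), div_le_iff₀ (by positivity)]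
      exact n5
    have b2 : |1 / 2 * rpq * f zr| ≤ D * C := by
      rw [abs_mul, abs_of_nonneg (by positivity)]
      have : rpq ≤ D := hρ'.trans (mul_le_of_le_one_right hD (pow_le_one₀ hr0.le hr1))
      refine mul_le_mul (by linarith) ?_ (abs_nonneg _) hD
      exact n1.trans (mul_le_of_le_one_right hC hr1)
    have := abs_sub (dR (dR f) zr + 1 / 2 * rpq * f zr)
      (apq * ((r * dR f zr - f zr) / r ^ 2))
    have := abs_add_le (dR (dR f) zr) (1 / 2 * rpq * f zr)
    linarith
end
end
end CSSP

namespace CSSP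
noncomputable section
open scoped ContDiff Topology

section
variable {p q f : ℝ × ℝ → ℝ} {m : ℕ} {u : ℝ → ℝ → ℂ} {T0 : ℝ}

lemma amgmJ {δ : ℝ} (hδ : 0 < δ) (c x y x' y' : ℝ) :
    4 * c * |x * y' - y * x'| ≤ δ * (c ^ 2 * (x' ^ 2 + y' ^ 2)) + 4 / δ * (x ^ 2 + y ^ 2) := by
  have e : ∀ s : ℝ, s ^ 2 = 1 → δ * (c ^ 2 * (x' ^ 2 + y' ^ 2)) + 4 / δ * (x ^ 2 + y ^ 2)
      - 4 * c * (s * (x * y' - y * x')) = δ * ((c * y' - s * (2 / δ * x)) ^ 2 + (c * x' + s * (2 / δ * y)) ^ 2) := by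
    intro s hs
    have : δ * ((c * y' - s * (2 / δ * x)) ^ 2 + (c * x' + s * (2 / δ * y)) ^ 2)
      = δ * (c ^ 2 * (x' ^ 2 + y' ^ 2)) + s ^ 2 * (4 / δ * (x ^ 2 + y ^ 2))
      - 4 * c * (s * (x * y' - y * x')) := by field_simp; ring
    rw [this, hs, one_mul]
  rcases abs_cases (x * y' - y * x') with ⟨h, _⟩ | ⟨h, _⟩ <;> rw [h]
  · have := e 1 (by norm_num)
    have : 0 ≤ δ * ((c * y' - 1 * (2 / δ * x)) ^ 2 + (c * x' + 1 * (2 / δ * y)) ^ 2) := by positivity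
    linarith
  · have := e (-1) (by norm_num)
    have : 0 ≤ δ * ((c * y' - -1 * (2 / δ * x)) ^ 2 + (c * x' + -1 * (2 / δ * y)) ^ 2) := by positivity
    linarith

def g1 (m : ℕ) (p q : ℝ × ℝ → ℝ) := gv m p q p
def g2 (m : ℕ) (p q : ℝ × ℝ → ℝ) := gv m p q q

lemma Dat.Jg_bdd (h : Dat m p q) {t1 t2 : ℝ} (h1 : -1 < t1) (h2 : t2 < 0) (L : ℝ) :
    ∃ C, 0 ≤ C ∧ ∀ t ∈ Icc t1 t2, ∀ r ∈ Ioc (0:ℝ) L, |Jc (g1 m p q) (g2 m p q) zr| ≤ C := by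
  obtain ⟨C1, hC1, n1⟩ := h.gv_near h.ps h.p0 h1 h2
  obtain ⟨C2, hC2, n2⟩ := h.gv_near h.qs h.q0 h1 h2
  have hsub : Icc t1 t2 ×ˢ Icc 1 L ⊆ II ×ˢ Ioi (0:ℝ) :=
    prod_mono (Icc_subset_Ioo h1 h2) fun r hr => lt_of_lt_of_le one_pos hr.1
  obtain ⟨C3, hC3⟩ := (isCompact_Icc.prod isCompact_Icc).exists_bound_of_continuousOn
    (h.ggen.J_cont.mono hsub)
  refine ⟨C1 * C2 + C2 * C1 + |C3|, by positivity, fun t ht r hr => ?_⟩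
  rcases le_total r 1 with hr1 | hr1
  · obtain ⟨a1, a2⟩ := n1 t ht r ⟨hr.1, hr1⟩
    obtain ⟨b1, b2⟩ := n2 t ht r ⟨hr.1, hr1⟩
    have e1 : |gv m p q p zr * dR (gv m p q q) zr| ≤ C1 * C2 := by
      rw [abs_mul]; exact mul_le_mul a1 b2 (abs_nonneg _) hC1
    have e2 : |gv m p q q zr * dR (gv m p q p) zr| ≤ C2 * C1 := by
      rw [abs_mul]; exact mul_le_mul b1 a2 (abs_nonneg _) hC2
    have := abs_sub (gv m p q p zr * dR (gv m p q q) zr) (gv m p q q zr * dR (gv m p q p) zr)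
    have := abs_nonneg C3
    unfold Jc g1 g2; linarith
  · have := (hC3 zr ⟨ht, hr1, hr.2⟩).trans (le_abs_self C3)
    rw [Real.norm_eq_abs] at this
    have h3 : 0 ≤ C1 * C2 := by positivity
    have h4 : 0 ≤ C2 * C1 := by positivity
    unfold g1 g2; linarith

lemma Good.energy (hg : Good p q T0) (h : Dat m p q) {t1 t2 : ℝ} (h1 : T0 < t1) (h12 : t1 ≤ t2) (h2 : t2 < 0) :
    ee m p q t1 = ee m p q t2 := by
  have G : Gen II (Ioi 0) (g1 m p q) (g2 m p q) (Wg m p q) := h.ggen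
  have hS : Ici (1:ℝ) ⊆ Ioi 0 := fun r hr => mem_Ioi.2 (lt_of_lt_of_le one_pos (mem_Ici.1 hr))
  have hT0 := hg.h1
  set s1 := (T0 + t1) / 2 with hs1
  set s2 := t2 / 2 with hs2
  have a1 : T0 < s1 := by linarith
  have a2 : s1 < t1 := by linarith
  have a3 : t2 < s2 := by linarith
  have a4 : s2 < 0 := by linarith
  have hs1' : -1 < s1 := by linarith
  have hIcc : Icc s1 s2 ⊆ II := Icc_subset_Ioo hs1' a4
  have hgood : ∀ t ∈ Icc s1 s2, t ∈ Ioo T0 0 := fun t ht => ⟨a1.trans_le ht.1, ht.2.trans_lt a4⟩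
  have h12s : Icc t1 t2 ⊆ Icc s1 s2 := Icc_subset_Icc a2.le a3.le
  obtain ⟨Ce, hCe, he⟩ := hg.ee_bdd h a1 a4
  obtain ⟨Cρ, hCρ, hρ⟩ := hg.rho_bdd h a1 a4
  obtain ⟨CA, hCA, hA⟩ := h.A_bdd hs1' a4
  obtain ⟨CK, hCK, hK⟩ := morawetz (W1 := Wg m p q) (c0 := 0) G hS le_rfl zero_le_one a2 h12 a3 hIcc
    (fun t _ r _ _ => by ring) hCe (C1 := (1 + mm2) ^ 2 + CA + Cρ) (by positivity)
    (fun t ht n hn => (hg.gg_part h (hgood t ht) zero_le_one hn).trans (he t ht))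
    (by
      intro t ht r hr
      have hr0 : 0 < r := by linarith
      have b1 := h.a_abs (hIcc ht) hr0.le
      have b2 := hA t ht r hr0
      have b3 := hρ t ht r hr0.le
      have b4 := rho_nonneg (p := p) (q := q) zr
      have b5 : (1 + apq) ^ 2 / r ^ 2 ≤ (1 + mm2) ^ 2 := by
        have : 1 ≤ r ^ 2 := one_le_pow₀ hr
        refine (div_le_self (by positivity) this).trans ?_
        have := abs_add_le 1 (apq)
        rw [abs_one] at this
        rw [← sq_abs]; gcongr; linarith
      have b6 : 0 ≤ (1 + apq) ^ 2 / r ^ 2 := by positivity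
      have b7 := abs_le.1 b2
      unfold Wg; rw [abs_le]; constructor <;> simp only <;> linarith [b7.1, b7.2])
  -- tail function
  set Ψ : ℝ → ℝ := fun L => ∫ t in t1..t2, ∫ r in (1:ℝ)..L, gpq * r with hΨ
  have cgr : ContinuousOn (fun z : ℝ × ℝ => gg m p q z * z.2) (II ×ˢ Ioi 0) :=
    h.gg_cont.mul continuousOn_snd
  have cin : ∀ {α β : ℝ}, 1 ≤ α → α ≤ β →
      ContinuousOn (fun t => ∫ r in α..β, gpq * r) II := by
    intro α β hα hab
    exact param_cont (F' := fun t r => gpq * r) isOpen_Ioo hab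
      (cgr.mono (prod_mono le_rfl fun r hr => lt_of_lt_of_le one_pos (hα.trans hr.1)))
  have ht12 : Icc t1 t2 ⊆ II := h12s.trans hIcc
  have iin : ∀ {α β : ℝ}, 1 ≤ α → α ≤ β →
      IntervalIntegrable (fun t => ∫ r in α..β, gpq * r) volume t1 t2 := by
    intro α β hα hab
    exact ContinuousOn.intervalIntegrable (by rw [uIcc_of_le h12]; exact (cin hα hab).mono ht12)
  have hΨb : ∀ L, 1 ≤ L → Ψ L ≤ Ce * (t2 - t1) := by
    intro L hL
    have := intervalIntegral.integral_mono_on h12 (iin le_rfl hL) (intervalIntegrable_const (c := Ce))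
      fun t ht => (hg.gg_part h (hgood t (h12s ht)) zero_le_one hL).trans (he t (h12s ht))
    rw [intervalIntegral.integral_const, smul_eq_mul] at this
    linarith
  have hbdd : BddAbove (Ψ '' Ici 1) := ⟨Ce * (t2 - t1), by rintro _ ⟨L, hL, rfl⟩; exact hΨb L hL⟩
  have htail : ∀ ε : ℝ, 0 < ε → ∃ L, 1 ≤ L ∧ ∀ n, L ≤ n →
      ∫ t in t1..t2, ∫ r in L..n, gpq * r ≤ ε := by
    intro ε hε
    obtain ⟨_, ⟨L, hL, rfl⟩, hlt⟩ := exists_lt_of_lt_csSup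
      (⟨_, 1, mem_Ici.2 le_rfl, rfl⟩ : (Ψ '' Ici 1).Nonempty) (sub_lt_self (sSup (Ψ '' Ici 1)) hε)
    refine ⟨L, hL, fun n hn => ?_⟩
    have hL' : (1:ℝ) ≤ L := hL
    have h3 : Ψ n ≤ sSup (Ψ '' Ici 1) := le_csSup hbdd ⟨n, hL'.trans hn, rfl⟩
    have h4 : Ψ n = Ψ L + ∫ t in t1..t2, ∫ r in L..n, gpq * r := by
      simp only [hΨ]
      rw [← intervalIntegral.integral_add (iin le_rfl hL') (iin hL' hn)]
      refine intervalIntegral.integral_congr fun t ht => ?_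
      rw [uIcc_of_le h12] at ht
      have hc : ContinuousOn (fun r => gpq * r) (Ioi 0) :=
        (h.cg (ht12 ht)).mul continuousOn_id
      refine (intervalIntegral.integral_add_adjacent_intervals ?_ ?_).symm
      · exact ContinuousOn.intervalIntegrable (by
          rw [uIcc_of_le hL']; exact hc.mono fun r hr => lt_of_lt_of_le one_pos hr.1)
      · exact ContinuousOn.intervalIntegrable (by
          rw [uIcc_of_le hn]; exact hc.mono fun r hr => lt_of_lt_of_le one_pos (hL'.trans hr.1))
    linarith
  -- truncated energies
  set En : ℕ → ℝ → ℝ := fun n t => ∫ r in (1 / (n:ℝ))..(n:ℝ), rn ^ 2 * gpq * r with hEn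
  have hlim : ∀ t ∈ Icc t1 t2, Tendsto (fun n => En n t) atTop (𝓝 (ee m p q t)) := by
    intro t ht
    have htg := hgood t (h12s ht)
    have hc : ContinuousOn (fun r => gpq) (Ioi 0) := h.cg (ht12 ht)
    refine cut_lim (F := fun n r => rn ^ 2 * gpq * r)
      (B := fun r => gpq * r) (fun n => by positivity) ?_ tendsto_one_div_atTop_nhds_zero_nat ?_
      (hg.gg_int h htg) (fun r hr => mul_nonneg (gg_nonneg _) hr.le) ?_ ?_
    · intro n hn
      have : (1:ℝ) ≤ n := by exact_mod_cast hn
      exact ((div_le_one (by linarith)).2 this).trans this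
    · intro n hn
      have : ContinuousOn (fun r => gpq) (Ioc (1 / (n:ℝ)) n) :=
        hc.mono fun r hr => lt_of_le_of_lt (by positivity) hr.1
      fun_prop
    · intro n hn r hr
      have hn0 : (0:ℝ) < n := by exact_mod_cast hn
      have hr0 : 0 < r := lt_of_le_of_lt (by positivity) hr.1
      have hx : r / n ≤ 1 := (div_le_one hn0).2 hr.2
      have hx0 : 0 ≤ r / n := by positivity
      have hgg := gg_nonneg (m := m) (p := p) (q := q) zr
      rw [abs_of_nonneg (by positivity), mul_assoc]
      exact mul_le_of_le_one_left (by positivity) (pow_le_one₀ (by linarith) (by linarith))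
    · intro r hr
      have h0 : Tendsto (fun n : ℕ => r / (n:ℝ)) atTop (𝓝 0) := tendsto_const_div_atTop_nhds_zero_nat r
      have := (((h0.const_sub 1).pow 2).mul_const (gpq)).mul_const r
      simpa using this
  have hmain : ∀ δ : ℝ, 0 < δ → |ee m p q t2 - ee m p q t1| ≤ δ * (CK + 4) + δ := by
    intro δ hδ
    obtain ⟨L, hL, hLt⟩ := htail (δ ^ 2) (by positivity)
    obtain ⟨CJ, hCJ, hJ⟩ := h.Jg_bdd (t1 := t1) (t2 := t2) (by linarith) h2 L
    set CL := 4 * L * L * CJ + 2 * CJ with hCL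
    have hCL0 : 0 ≤ CL := by positivity
    have lim1 := (((hlim t2 ⟨h12, le_rfl⟩).sub (hlim t1 ⟨le_rfl, h12⟩)).abs)
    have lim2 : Tendsto (fun n : ℕ => δ * (CK + 4) + CL * (t2 - t1) / (n:ℝ)) atTop (𝓝 (δ * (CK + 4) + 0)) :=
      tendsto_const_nhds.add (tendsto_const_div_atTop_nhds_zero_nat _)
    have : |ee m p q t2 - ee m p q t1| ≤ δ * (CK + 4) + 0 := by
      refine le_of_tendsto_of_tendsto lim1 lim2 ?_
      filter_upwards [eventually_ge_atTop (max ⌈L⌉₊ 2)] with n hn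
      have hnL : L ≤ n := (Nat.le_ceil L).trans (by exact_mod_cast (le_max_left _ _).trans hn)
      have hn2 : (2:ℝ) ≤ n := by exact_mod_cast (le_max_right _ _).trans hn
      have hn0 : (0:ℝ) < n := by linarith
      have hn1 : 1 / (n:ℝ) ≤ 1 := (div_le_one hn0).2 (by linarith)
      have hn1' : 0 < 1 / (n:ℝ) := by positivity
      have hnL' : 1 / (n:ℝ) ≤ L := hn1.trans hL
      have hsub : Icc (1 / (n:ℝ)) n ⊆ Ioi 0 := fun r hr => lt_of_lt_of_le hn1' hr.1
      have dθ : ∀ r : ℝ, HasDerivAt (fun r : ℝ => (1 - r / (n:ℝ)) ^ 2) (-2 * (rn / n)) r := by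
        intro r
        exact ((((hasDerivAt_id r).div_const (n:ℝ)).const_sub 1).pow 2).congr_deriv (by
          simp only [id]; norm_num; ring)
      have dE : ∀ t ∈ Icc t1 t2, HasDerivAt (En n) _ t := fun t ht =>
        G.I1 hn1'.le (hn1.trans (by linarith)) hsub dθ (by fun_prop) (ht12 ht)
      have cK : ContinuousOn (Kn (g1 m p q) (g2 m p q) n) (Icc t1 t2) :=
        (Kn_cont G hS (by linarith)).mono ht12
      have cT := (cin hL hnL).mono ht12
      have := abs_sub_le_int (b := fun t => CL / n + δ * Kn (g1 m p q) (g2 m p q) n t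
          + 4 / δ * ∫ r in L..(n:ℝ), gpq * r) h12 dE (by fun_prop) ?_
      · refine this.trans ?_
        have i1 : IntervalIntegrable (fun t => Kn (g1 m p q) (g2 m p q) n t) volume t1 t2 :=
          ContinuousOn.intervalIntegrable (by rwa [uIcc_of_le h12])
        have i2 := iin hL hnL
        rw [intervalIntegral.integral_add (intervalIntegrable_const.add (i1.const_mul δ)) (i2.const_mul (4 / δ)),
          intervalIntegral.integral_add intervalIntegrable_const (i1.const_mul δ),
          intervalIntegral.integral_const_mul, intervalIntegral.integral_const_mul,
          intervalIntegral.integral_const, smul_eq_mul]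
        have k1 := mul_le_mul_of_nonneg_left (hK n hn2) hδ.le
        have k2 := mul_le_mul_of_nonneg_left (hLt n hnL) (show 0 ≤ 4 / δ by positivity)
        have k3 : 4 / δ * δ ^ 2 = 4 * δ := by field_simp
        have k4 : (t2 - t1) * (CL / n) = CL * (t2 - t1) / n := by ring
        linarith
      · intro t ht
        have hJt := hJ t ht
        have e0 : ((1:ℝ) - n / n) ^ 2 = 0 := by rw [div_self hn0.ne']; norm_num
        have cJ : ContinuousOn (fun r => Jc (g1 m p q) (g2 m p q) zr) (Ioi 0) :=
          slice_pos G.J_cont (ht12 ht)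
        have cg := h.cg (ht12 ht)
        have cY : ContinuousOn (fun r => dR (g1 m p q) zr ^ 2 + dR (g2 m p q) zr ^ 2) (Icc 1 n) :=
          (G.slices hS (ht12 ht) n).2.1
        set J := fun r => Jc (g1 m p q) (g2 m p q) zr with hJd
        have iJ : ∀ {α β : ℝ}, 0 < α → α ≤ β →
            IntervalIntegrable (fun r => -2 * (rn / n) * r * J r) volume α β := by
          intro α β hα hab
          refine ContinuousOn.intervalIntegrable ?_
          rw [uIcc_of_le hab]
          have := cJ.mono (show Icc α β ⊆ Ioi 0 from fun r hr => lt_of_lt_of_le hα hr.1)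
          fun_prop
        have p1 : |∫ r in (1 / (n:ℝ))..L, -2 * (rn / n) * r * J r| ≤ 2 * L * L * CJ / n := by
          have := intervalIntegral.norm_integral_le_of_norm_le_const (a := 1 / (n:ℝ)) (b := L)
            (f := fun r => -2 * (rn / n) * r * J r) (C := 2 / n * L * CJ) ?_
          · rw [Real.norm_eq_abs, abs_of_nonneg (sub_nonneg.2 hnL')] at this
            refine this.trans ?_
            have : 2 / (n:ℝ) * L * CJ * (L - 1 / n) ≤ 2 / n * L * CJ * L := by
              gcongr; linarith
            refine this.trans (le_of_eq ?_)
            ring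
          · intro r hr
            rw [uIoc_of_le hnL'] at hr
            have hr0 : 0 < r := hn1'.trans hr.1
            have hx : r / n ≤ 1 := (div_le_one hn0).2 (hr.2.trans hnL)
            have hx0 : 0 ≤ r / n := by positivity
            rw [Real.norm_eq_abs, abs_mul, abs_mul, abs_of_pos hr0, abs_mul, abs_div,
              abs_of_nonneg (by linarith : 0 ≤ 1 - r / n), abs_of_pos hn0]
            have b1 := hJt r ⟨hr0, hr.2⟩
            have b2 : |(-2:ℝ)| * (rn / n) ≤ 2 / n := by
              rw [abs_neg, abs_two, ← mul_div_assoc]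
              gcongr; linarith
            exact mul_le_mul (mul_le_mul b2 hr.2 hr0.le (by positivity)) b1 (abs_nonneg _) (by positivity)
        have p2 : |2 * ∫ r in L..(n:ℝ), -2 * (rn / n) * r * J r|
            ≤ δ * Kn (g1 m p q) (g2 m p q) n t + 4 / δ * ∫ r in L..(n:ℝ), gpq * r := by
          have iK : IntervalIntegrable (fun r => r * (rn / n) ^ 2 *
              (dR (g1 m p q) zr ^ 2 + dR (g2 m p q) zr ^ 2)) volume L n := by
            refine ContinuousOn.intervalIntegrable ?_
            rw [uIcc_of_le hnL]
            have := cY.mono (Icc_subset_Icc_left hL)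
            fun_prop
          have ig : IntervalIntegrable (fun r => gpq * r) volume L n := by
            refine ContinuousOn.intervalIntegrable ?_
            rw [uIcc_of_le hnL]
            have := cg.mono (show Icc L (n:ℝ) ⊆ Ioi 0 from fun r hr => lt_of_lt_of_le one_pos (hL.trans hr.1))
            fun_prop
          rw [← intervalIntegral.integral_const_mul, ← Real.norm_eq_abs]
          refine (intervalIntegral.norm_integral_le_of_norm_le hnL (g := fun r =>
            δ * (r * (rn / n) ^ 2 * (dR (g1 m p q) zr ^ 2 + dR (g2 m p q) zr ^ 2))
              + 4 / δ * (gpq * r)) ?_ ((iK.const_mul δ).add (ig.const_mul (4 / δ)))).trans ?_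
          · refine (Eventually.of_forall fun r hr => ?_)
            have hr0 : 0 < r := lt_of_lt_of_le one_pos (hL.trans hr.1.le)
            have hx : r / n ≤ 1 := (div_le_one hn0).2 hr.2
            have am := amgmJ hδ (rn / n) (g1 m p q zr) (g2 m p q zr)
              (dR (g1 m p q) zr) (dR (g2 m p q) zr)
            have am2 := mul_le_mul_of_nonneg_left am hr0.le
            have hc : 0 ≤ rn / n := div_nonneg (by linarith) hn0.le
            rw [Real.norm_eq_abs, show 2 * (-2 * (rn / n) * r * J r) = -(4 * (rn / n) * r) * J r by ring,
              abs_mul, abs_neg, abs_of_nonneg (by positivity)]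
            have : gpq = g1 m p q zr ^ 2 + g2 m p q zr ^ 2 := rfl
            rw [this]
            have : J r = g1 m p q zr * dR (g2 m p q) zr - g2 m p q zr * dR (g1 m p q) zr := rfl
            rw [this]
            linarith
          · rw [intervalIntegral.integral_add (iK.const_mul δ) (ig.const_mul (4 / δ)),
              intervalIntegral.integral_const_mul, intervalIntegral.integral_const_mul]
            have : ∫ r in L..(n:ℝ), r * (rn / n) ^ 2 *
              (dR (g1 m p q) zr ^ 2 + dR (g2 m p q) zr ^ 2) ≤ Kn (g1 m p q) (g2 m p q) n t := by
              refine intervalIntegral.integral_mono_interval hL hnL le_rfl ?_ ?_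
              · refine (ae_restrict_iff' measurableSet_Ioc).2 (Eventually.of_forall fun r hr => ?_)
                have : 0 < r := one_pos.trans hr.1
                simp only [Pi.zero_apply]; positivity
              · refine ContinuousOn.intervalIntegrable ?_
                rw [uIcc_of_le (hL.trans hnL)]
                fun_prop
            gcongr
        have p3 : |2 * (((1:ℝ) - 1 / n / n) ^ 2 * (1 / n) * J (1 / n))| ≤ 2 * CJ / n := by
          have hx : 1 / (n:ℝ) / n ≤ 1 := (div_le_one hn0).2 (by linarith)
          have hx0 : 0 ≤ 1 / (n:ℝ) / n := by positivity
          have b1 := hJt (1 / n) ⟨hn1', hnL'⟩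
          have b2 : ((1:ℝ) - 1 / n / n) ^ 2 ≤ 1 := pow_le_one₀ (by linarith) (by linarith)
          rw [abs_mul, abs_mul, abs_two, abs_of_nonneg (by positivity)]
          have : ((1:ℝ) - 1 / n / n) ^ 2 * (1 / n) ≤ 1 * (1 / n) := by gcongr
          have := mul_le_mul this b1 (abs_nonneg _) (by positivity)
          calc _ ≤ 2 * (1 * (1 / (n:ℝ)) * CJ) := by gcongr
            _ = _ := by ring
        rw [← intervalIntegral.integral_add_adjacent_intervals (iJ hn1' hnL') (iJ (by linarith) hnL), e0]
        have q1 := abs_le.1 p1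
        have q2 := abs_le.1 p2
        have q3 := abs_le.1 p3
        have q4 : CL / n = 2 * (2 * L * L * CJ / n) + 2 * CJ / n := by rw [hCL]; ring
        rw [q4]
        simp only [hJd] at q1 q2 q3 ⊢
        rw [abs_le]; constructor <;> linarith [q1.1, q1.2, q2.1, q2.2, q3.1, q3.2]
    linarith
  have : |ee m p q t2 - ee m p q t1| ≤ 0 := by
    refine le_of_forall_pos_le_add fun ε hε => ?_
    have := hmain (ε / (CK + 5)) (by positivity)
    refine this.trans (le_of_eq ?_)
    field_simp; ring
  have := abs_nonpos_iff.1 this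
  linarith
end
end
end CSSP

namespace CSSP
noncomputable section
open scoped ContDiff Topology

section
variable {p q f : ℝ × ℝ → ℝ} {m : ℕ} {u : ℝ → ℝ → ℂ} {T0 : ℝ}

structure Prof (K e : ℝ) (M ρ : ℝ → ℝ) : Prop where
  d : ∀ r, 0 < r → HasDerivAt M (1 / 2 * (ρ r * r)) r
  mono : ∀ r s, 0 < r → r ≤ s → M r ≤ M s
  nn : ∀ r, 0 < r → 0 ≤ M r
  le : ∀ r, 0 < r → M r ≤ K
  D : ∀ r, 0 < r → ∀ η, 0 < η → |1 / 2 * r ^ 2 * ρ r - M r * (K - M r)| ≤ r * (η * M r + e / (2 * η))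

lemma Prof.small {K e ε δ r1 r0 : ℝ} {M ρ : ℝ → ℝ} (h : Prof K e M ρ) (he : 0 ≤ e) (hε : 0 < ε)
    (hδ : 0 < δ) (hr1 : 0 < r1) (hr1ε : r1 ≤ ε) (hr1e : r1 * (8 * e * ε) ≤ δ ^ 2)
    (hr0 : r0 = r1 * Real.exp (-(8 * (K + 1) / δ))) (hK : 0 ≤ K) (hM : M ε ≤ K - δ) : M r0 ≤ 1 / 2 := by
  by_contra hc
  push Not at hc
  have hr0p : 0 < r0 := by rw [hr0]; positivity
  have h01 : r0 ≤ r1 := by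
    rw [hr0]; apply mul_le_of_le_one_right hr1.le
    rw [Real.exp_le_one_iff]; have : 0 ≤ 8 * (K + 1) / δ := by positivity
    linarith
  have key : M r0 - δ / 8 * Real.log r0 ≤ M r1 - δ / 8 * Real.log r1 := by
    have : MonotoneOn (fun r => M r - δ / 8 * Real.log r) (Icc r0 r1) := by
      refine monotoneOn_of_hasDerivWithinAt_nonneg (f' := fun r => 1 / 2 * (ρ r * r) - δ / 8 * r⁻¹)
        (convex_Icc _ _) (fun r hr => ?_) (fun r hr => ?_) (fun r hr => ?_)
      · have hr' : 0 < r := hr0p.trans_le hr.1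
        exact ((h.d r hr').sub ((Real.hasDerivAt_log hr'.ne').const_mul _)).continuousAt.continuousWithinAt
      · rw [interior_Icc] at hr
        have hr' : 0 < r := hr0p.trans hr.1
        exact ((h.d r hr').sub ((Real.hasDerivAt_log hr'.ne').const_mul _)).hasDerivWithinAt
      · rw [interior_Icc] at hr
        have hr' : 0 < r := hr0p.trans hr.1
        have hrε : r ≤ ε := hr.2.le.trans hr1ε
        have a1 := h.mono r0 r hr0p hr.1.le
        have a2 := h.mono r ε hr' hrε
        have a3 := (abs_le.1 (h.D r hr' (δ / (2 * ε)) (by positivity))).1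
        have a4 : r * (δ / (2 * ε) * M r) ≤ δ / 2 * M r := by
          have : r / ε ≤ 1 := (div_le_one hε).2 hrε
          have := mul_le_mul_of_nonneg_right this (show 0 ≤ δ / 2 * M r by have := h.nn r hr'; positivity)
          calc _ = r / ε * (δ / 2 * M r) := by field_simp
            _ ≤ _ := by linarith
        have a5 : r * (e / (2 * (δ / (2 * ε)))) ≤ δ / 8 := by
          have : r * (e / (2 * (δ / (2 * ε)))) = r * (8 * e * ε) / (8 * δ) := by field_simp; 
          rw [this, div_le_iff₀ (by positivity)]
          have : r * (8 * e * ε) ≤ r1 * (8 * e * ε) := by gcongr; exact hr.2.le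
          nlinarith
        have a6 : δ * M r ≤ M r * (K - M r) := by
          rw [mul_comm]; exact mul_le_mul_of_nonneg_left (by linarith) (h.nn r hr')
        have a7 : δ / 8 ≤ 1 / 2 * r ^ 2 * ρ r := by
          have : δ / 2 * (1 / 2) ≤ δ / 2 * M r := by gcongr; linarith
          rw [mul_add] at a3
          linarith
        have : 1 / 2 * (ρ r * r) - δ / 8 * r⁻¹ = (1 / 2 * r ^ 2 * ρ r - δ / 8) / r := by field_simp
        rw [this]; exact div_nonneg (by linarith) hr'.le
    exact this ⟨le_rfl, h01⟩ ⟨h01, le_rfl⟩ h01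
  have l1 : Real.log r0 = Real.log r1 - 8 * (K + 1) / δ := by
    rw [hr0, Real.log_mul hr1.ne' (Real.exp_pos _).ne', Real.log_exp]; ring
  rw [l1] at key
  have : δ / 8 * (8 * (K + 1) / δ) = K + 1 := by field_simp
  have := h.le r1 hr1
  linarith

lemma Prof.bound {K e ε δ : ℝ} (hK : 4 ≤ K) (he : 0 ≤ e) (hε : 0 < ε) (hδ : 0 < δ) :
    ∃ C2, 0 ≤ C2 ∧ ∀ M ρ : ℝ → ℝ, Prof K e M ρ → M ε ≤ K - δ → ∀ r, 0 < r → ρ r ≤ C2 := by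
  set r1 := min ε (δ ^ 2 / (8 * e * ε + 1)) with hr1d
  have hr1 : 0 < r1 := lt_min hε (by positivity)
  have hr1e : r1 * (8 * e * ε) ≤ δ ^ 2 := by
    have : r1 ≤ δ ^ 2 / (8 * e * ε + 1) := min_le_right _ _
    rw [le_div_iff₀ (by positivity)] at this
    linarith
  obtain ⟨r0, hr0⟩ : ∃ r0, r0 = r1 * Real.exp (-(8 * (K + 1) / δ)) := ⟨_, rfl⟩
  have hr0p : 0 < r0 := by rw [hr0]; positivity
  refine ⟨2 * ((K + 1) * (1 / r0 ^ 2 + e) + e) + 2 * ((K + 1) * K / r0 ^ 2 + e), by positivity, ?_⟩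
  intro M ρ h hM r hr
  have hs := h.small he hε hδ hr1 (min_le_left _ _) hr1e hr0 (by linarith) hM
  have hM0 := h.nn r hr
  have hMK := h.le r hr
  -- upper bound of rho
  have up : 1 / 2 * r ^ 2 * ρ r ≤ (K + 1) * M r + e * r ^ 2 := by
    have := (abs_le.1 (h.D r hr (1 / r) (by positivity))).2
    have e1 : r * (1 / r * M r + e / (2 * (1 / r))) = M r + e * r ^ 2 / 2 := by field_simp
    have : 0 ≤ M r * M r := by positivity
    have : 0 ≤ e * r ^ 2 := by positivity
    nlinarith
  have p1 : 0 ≤ 2 * ((K + 1) * (1 / r0 ^ 2 + e) + e) := by positivity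
  have p2 : 0 ≤ 2 * ((K + 1) * K / r0 ^ 2 + e) := by positivity
  rcases le_total r r0 with hrr | hrr
  · -- M ≤ r^2(1/r0^2+e)
    have key : M r / r ^ 3 - e / r ≤ M r0 / r0 ^ 3 - e / r0 := by
      have : MonotoneOn (fun r => M r / r ^ 3 - e / r) (Icc r r0) := by
        have dd : ∀ s, 0 < s → HasDerivAt (fun r => M r / r ^ 3 - e / r)
            ((1 / 2 * s ^ 2 * ρ s - 3 * M s + e * s ^ 2) / s ^ 4) s := by
          intro s hs
          have := ((h.d s hs).div ((hasDerivAt_id s).pow 3) (by simp only [id, Pi.pow_apply]; positivity)).sub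
            ((hasDerivAt_const s e).div (hasDerivAt_id s) (by simp only [id]; positivity))
          refine this.congr_deriv ?_
          simp only [id, Pi.pow_apply]; norm_num; field_simp; ring
        refine monotoneOn_of_hasDerivWithinAt_nonneg (f' := fun s => (1 / 2 * s ^ 2 * ρ s - 3 * M s + e * s ^ 2) / s ^ 4)
          (convex_Icc _ _) (fun s hs => (dd s (hr.trans_le hs.1)).continuousAt.continuousWithinAt)
          (fun s hs => ?_) (fun s hs => ?_)
        · rw [interior_Icc] at hs
          exact (dd s (hr.trans hs.1)).hasDerivWithinAt
        · rw [interior_Icc] at hs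
          have hs0 : 0 < s := hr.trans hs.1
          have := h.mono s r0 hs0 hs.2.le
          have hMs := h.nn s hs0
          have := (abs_le.1 (h.D s hs0 (1 / (2 * s)) (by positivity))).1
          have e1 : s * (1 / (2 * s) * M s + e / (2 * (1 / (2 * s)))) = M s / 2 + e * s ^ 2 := by field_simp
          have : M s * (7 / 2) ≤ M s * (K - M s) := mul_le_mul_of_nonneg_left (by linarith) hMs
          exact div_nonneg (by linarith) (by positivity)
      exact this ⟨le_rfl, hrr⟩ ⟨hrr, le_rfl⟩ hrr
    have k2 : M r ≤ r ^ 2 * (1 / r0 ^ 2 + e) := by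
      have e0 : 0 ≤ e / r0 := by positivity
      have e1 : M r0 / r0 ^ 3 ≤ 1 / r0 ^ 3 := by gcongr; linarith
      have e2 : M r / r ^ 3 ≤ 1 / r0 ^ 3 + e / r := by linarith
      rw [div_le_iff₀ (by positivity)] at e2
      have e3 : (1 / r0 ^ 3 + e / r) * r ^ 3 = r ^ 2 * (1 / r0 ^ 2 * (r / r0) + e) := by field_simp
      have e4 : r / r0 ≤ 1 := (div_le_one hr0p).2 hrr
      have e5 : 1 / r0 ^ 2 * (r / r0) ≤ 1 / r0 ^ 2 := mul_le_of_le_one_right (by positivity) e4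
      rw [e3] at e2
      refine e2.trans ?_
      gcongr
    have : r ^ 2 * ρ r ≤ r ^ 2 * (2 * ((K + 1) * (1 / r0 ^ 2 + e) + e)) := by
      have := mul_le_mul_of_nonneg_left k2 (show 0 ≤ K + 1 by linarith)
      linarith
    have := le_of_mul_le_mul_left this (by positivity)
    linarith
  · have : r ^ 2 * ρ r ≤ r ^ 2 * (2 * ((K + 1) * K / r0 ^ 2 + e)) := by
      have e1 : (K + 1) * M r ≤ (K + 1) * K := by gcongr
      have e2 : 1 ≤ r ^ 2 / r0 ^ 2 := by rw [le_div_iff₀ (by positivity), one_mul]; gcongr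
      have e3 := mul_le_mul_of_nonneg_left e2 (show 0 ≤ (K + 1) * K by positivity)
      have e4 : r ^ 2 * (2 * ((K + 1) * K / r0 ^ 2 + e)) = 2 * ((K + 1) * K * (r ^ 2 / r0 ^ 2)) + 2 * (e * r ^ 2) := by
        field_simp
      rw [e4]; linarith
    have := le_of_mul_le_mul_left this (by positivity)
    linarith

lemma Dat.D_r (h : Dat m p q) {t r : ℝ} (ht : t ∈ II) (hr : 0 < r) :
    HasDerivAt (fun r => 1 / 2 * r ^ 2 * rpq - Mf p q t r * (2 * m + 2 - Mf p q t r))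
      (r ^ 2 * (p zr * gv m p q p zr + q zr * gv m p q q zr)) r := by
  have := ((((hasDerivAt_id r).pow 2).const_mul (1 / 2 : ℝ)).mul (rho_r h.gen ht (mem_univ r))).sub
    ((h.M_r ht r).mul ((h.M_r ht r).const_sub (2 * (m:ℝ) + 2)))
  refine this.congr_deriv ?_
  simp only [id, Pi.pow_apply, gv, av, rho]
  norm_num; field_simp; ring

lemma Good.prof (hg : Good p q T0) (h : Dat m p q) {t : ℝ} (ht : t ∈ Ioo T0 0) :
    Prof mm2 (ee m p q t) (fun r => Mf p q t r) (fun r => rpq) := by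
  have htI := hg.mem ht
  refine ⟨fun r _ => h.M_r htI r, fun r s hr hrs => h.M_mono htI hr.le (hr.le.trans hrs) hrs,
    fun r hr => h.M_nonneg htI hr.le, fun r hr => h.M_le htI hr.le, fun r hr η hη => ?_⟩
  set D := fun r => 1 / 2 * r ^ 2 * rpq - Mf p q t r * (2 * m + 2 - Mf p q t r) with hD
  have cD : Continuous D := by
    have := h.cr htI
    have := h.cM htI
    fun_prop
  have D0 : D 0 = 0 := by simp [hD, M_zero]
  have step : ∀ α ∈ Ioo 0 r, |D r - D α| ≤ r * (η * Mf p q t r + ee m p q t / (2 * η)) := by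
    intro α hα
    have cr := h.cr htI
    have cg := (h.cg htI).mono (show Icc α r ⊆ Ioi 0 from fun s hs => hα.1.trans_le hs.1)
    have := abs_sub_le_int (f := D) (b := fun s => r * η / 2 * (rho p q zs * s) + r / (2 * η) * (gg m p q zs * s))
      hα.2.le (fun s hs => h.D_r htI (hα.1.trans_le hs.1)) (by fun_prop) ?_
    · refine this.trans ?_
      have i1 : IntervalIntegrable (fun s => rho p q zs * s) volume α r :=
        (cr.mul continuous_id).intervalIntegrable _ _
      have i2 : IntervalIntegrable (fun s => gg m p q zs * s) volume α r :=
        ContinuousOn.intervalIntegrable (by rw [uIcc_of_le hα.2.le]; exact cg.mul continuousOn_id)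
      rw [intervalIntegral.integral_add (i1.const_mul _) (i2.const_mul _),
        intervalIntegral.integral_const_mul, intervalIntegral.integral_const_mul]
      have j1 := hg.gg_part h ht hα.1.le hα.2.le
      have j2 : ∫ s in α..r, rho p q zs * s ≤ 2 * Mf p q t r := by
        have : 2 * Mf p q t r = ∫ s in (0:ℝ)..r, rho p q zs * s := by unfold Mf; ring
        rw [this]
        refine intervalIntegral.integral_mono_interval hα.1.le hα.2.le le_rfl ?_ ((cr.mul continuous_id).intervalIntegrable _ _)
        refine (ae_restrict_iff' measurableSet_Ioc).2 (Eventually.of_forall fun s hs => ?_)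
        exact mul_nonneg (rho_nonneg _) hs.1.le
      have k1 := mul_le_mul_of_nonneg_left j1 (show 0 ≤ r / (2 * η) by positivity)
      have k2 := mul_le_mul_of_nonneg_left j2 (show 0 ≤ r * η / 2 by positivity)
      have : r * (η * Mf p q t r + ee m p q t / (2 * η)) = r * η / 2 * (2 * Mf p q t r) + r / (2 * η) * ee m p q t := by
        field_simp
      linarith
    · intro s hs
      have hs0 : 0 < s := hα.1.trans_le hs.1
      rw [abs_mul, abs_of_pos (by positivity : 0 < s ^ 2)]
      have am : |p zs * gv m p q p zs + q zs * gv m p q q zs| ≤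
          η / 2 * rho p q zs + 1 / (2 * η) * gg m p q zs := by
        have e1 : ∀ σ : ℝ, σ ^ 2 = 1 → η / 2 * rho p q zs + 1 / (2 * η) * gg m p q zs
          - σ * (p zs * gv m p q p zs + q zs * gv m p q q zs) =
          η / 2 * ((p zs - σ / η * gv m p q p zs) ^ 2 + (q zs - σ / η * gv m p q q zs) ^ 2) := by
          intro σ hσ
          have : ∀ x y : ℝ, η / 2 * (x - σ / η * y) ^ 2 = η / 2 * x ^ 2 + σ ^ 2 * (1 / (2 * η) * y ^ 2) - σ * (x * y) := by
            intro x y; field_simp; ring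
          rw [mul_add (η / 2), this, this, hσ]; unfold gg rho; ring
        have b1 := e1 1 (by norm_num)
        have b2 := e1 (-1) (by norm_num)
        have c1 : 0 ≤ η / 2 * ((p zs - 1 / η * gv m p q p zs) ^ 2 + (q zs - 1 / η * gv m p q q zs) ^ 2) := by positivity
        have c2 : 0 ≤ η / 2 * ((p zs - -1 / η * gv m p q p zs) ^ 2 + (q zs - -1 / η * gv m p q q zs) ^ 2) := by positivity
        rw [abs_le]; constructor <;> linarith
      have am0 := (abs_nonneg _).trans am
      calc _ ≤ s ^ 2 * (η / 2 * rho p q zs + 1 / (2 * η) * gg m p q zs) := by gcongr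
        _ ≤ r * s * (η / 2 * rho p q zs + 1 / (2 * η) * gg m p q zs) := by
          refine mul_le_mul_of_nonneg_right ?_ am0
          rw [sq]; gcongr; exact hs.2
        _ = _ := by field_simp
  have lim : Tendsto (fun α => |D r - D α|) (𝓝[>] 0) (𝓝 |D r - D 0|) :=
    ((cD.tendsto 0).const_sub _).abs.mono_left nhdsWithin_le_nhds
  rw [D0, sub_zero] at lim
  refine le_of_tendsto lim ?_
  filter_upwards [Ioo_mem_nhdsGT hr] with α hα using step α hα

/-- kinetic energy bounded by sup of density -/
lemma Good.kin (hg : Good p q T0) (h : Dat m p q) {t C2 : ℝ} (ht : t ∈ Ioo T0 0) (hC : 0 ≤ C2)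
    (hr : ∀ r, 0 < r → rpq ≤ C2) :
    ∫ r in Ioi (0:ℝ), ypq * r ≤ ee m p q t + 2 * mm2 * C2 + C2 * mm2 := by
  have htI := hg.mem ht
  have cr := h.cr htI
  have ca := h.ca htI
  have cY := h.cY htI
  have step : ∀ n : ℕ, 1 ≤ n → ∫ r in (1 / (n:ℝ))..(n:ℝ), ypq * r ≤
      ee m p q t + 2 * mm2 * C2 + C2 * mm2 := by
    intro n hn
    have hn1 : (1:ℝ) ≤ n := by exact_mod_cast hn
    have hn0 : (0:ℝ) < n := by linarith
    have h0 : 0 < 1 / (n:ℝ) := by positivity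
    have hab : 1 / (n:ℝ) ≤ n := ((div_le_one hn0).2 hn1).trans hn1
    have hsub : Icc (1 / (n:ℝ)) n ⊆ Ioi 0 := fun s hs => h0.trans_le hs.1
    have cg := (h.cg htI).mono hsub
    have hd : ∀ r ∈ Icc (1 / (n:ℝ)) n, HasDerivAt (fun s => av m p q zs * rho p q zs)
        (ypq * r - gpq * r - 1 / 2 * (rpq ^ 2 * r) + apq ^ 2 * rpq / r) r := by
      intro r hr
      have hr0 : 0 < r := hsub hr
      have := ((h.M_r htI r).const_sub (m:ℝ)).mul (rho_r h.gen htI (mem_univ r))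
      refine this.congr_deriv ?_
      rw [gg_eq hr0]
      simp only [av]; field_simp; ring
    have hle : ∫ r in (1 / (n:ℝ))..(n:ℝ), (ypq * r - gpq * r - C2 / 2 * (rpq * r)) ≤
        av m p q (t, n) * rho p q (t, n) - av m p q (t, 1 / n) * rho p q (t, 1 / n) := by
      refine intervalIntegral.integral_le_sub_of_hasDeriv_right_of_le hab
        (fun r hr => (hd r hr).continuousAt.continuousWithinAt)
        (fun r hr => (hd r (Ioo_subset_Icc_self hr)).hasDerivWithinAt)
        (ContinuousOn.integrableOn_Icc (by fun_prop)) ?_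
      intro r hr'
      have hr0 : 0 < r := h0.trans hr'.1
      have a1 := hr r hr0
      have a0 := rho_nonneg (p := p) (q := q) zr
      have : rpq ^ 2 * r ≤ C2 * (rpq * r) := by
        rw [sq, mul_assoc]; gcongr
      have : 0 ≤ apq ^ 2 * rpq / r := by positivity
      linarith
    have i1 : IntervalIntegrable (fun r => ypq * r) volume (1 / (n:ℝ)) n :=
      (cY.mul continuous_id).intervalIntegrable _ _
    have i2 : IntervalIntegrable (fun r => rpq * r) volume (1 / (n:ℝ)) n :=
      (cr.mul continuous_id).intervalIntegrable _ _
    have i3 : IntervalIntegrable (fun r => gpq * r) volume (1 / (n:ℝ)) n :=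
      ContinuousOn.intervalIntegrable (by rw [uIcc_of_le hab]; exact cg.mul continuousOn_id)
    rw [intervalIntegral.integral_sub (i1.sub i3) (i2.const_mul _), intervalIntegral.integral_sub i1 i3,
      intervalIntegral.integral_const_mul] at hle
    have j1 := hg.gg_part h ht h0.le hab
    have j2 := h.mass_le htI h0.le hab
    have j3 := mul_le_mul_of_nonneg_left j2 (show 0 ≤ C2 / 2 by positivity)
    have bb : ∀ r, 0 < r → |apq * rpq| ≤ mm2 * C2 := by
      intro r hr0
      rw [abs_mul, abs_of_nonneg (rho_nonneg (p := p) (q := q) zr)]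
      exact mul_le_mul (h.a_abs htI hr0.le) (hr r hr0) (rho_nonneg _) (by positivity)
    have b1 := (abs_le.1 (bb n hn0)).2
    have b2 := (abs_le.1 (bb (1 / n) h0)).1
    linarith
  have lim := cut_lim (F := fun _ r => ypq * r) (F0 := fun r => ypq * r)
    (B := fun r => ypq * r) (a := fun n => 1 / (n:ℝ)) (fun n => by positivity)
    (fun n hn => by
      have : (1:ℝ) ≤ n := by exact_mod_cast hn
      exact ((div_le_one (by linarith)).2 this).trans this) tendsto_one_div_atTop_nhds_zero_nat
    (fun n _ => (cY.mul continuous_id).continuousOn) (hg.int t ht)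
    (fun r hr => mul_nonneg (YY_nonneg _) hr.le)
    (fun n _ r hr => by
      have : 0 < r := lt_of_le_of_lt (by positivity) hr.1
      rw [abs_of_nonneg (mul_nonneg (YY_nonneg _) this.le)])
    (fun r _ => tendsto_const_nhds)
  refine le_of_tendsto lim ?_
  filter_upwards [eventually_ge_atTop 1] with n hn using step n hn

/-- concentration -/
lemma Good.conc (hg : Good p q T0) (h : Dat m p q) {ε : ℝ} (hε : 0 < ε) :
    Tendsto (fun t => Mf p q t ε) (𝓝[<] 0) (𝓝 mm2) := by
  have hm1 : (1:ℝ) ≤ m := by exact_mod_cast h.hm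
  have hgood : ∀ᶠ t in 𝓝[<] (0:ℝ), t ∈ Ioo T0 0 := Ioo_mem_nhdsLT hg.h0
  set e0 := ee m p q (T0 / 2) with he0
  have T2 : T0 / 2 ∈ Ioo T0 0 := ⟨by linarith [hg.h0], by linarith [hg.h0]⟩
  have hee : ∀ t ∈ Ioo T0 0, ee m p q t = e0 := by
    intro t ht
    rcases le_total t (T0 / 2) with h1 | h1
    · exact hg.energy h ht.1 h1 T2.2
    · exact (hg.energy h T2.1 h1 ht.2).symm
  rw [Metric.tendsto_nhds]
  intro δ hδ
  obtain ⟨C2, hC2, hb⟩ := Prof.bound (K := 2 * m + 2) (e := e0) (by linarith) (ee_nonneg _) hε hδ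
  have ev := hg.blow.eventually (eventually_gt_atTop (e0 + 2 * mm2 * C2 + C2 * mm2))
  filter_upwards [hgood, ev] with t ht hlt
  have htI := hg.mem ht
  have hle := h.M_le htI hε.le
  have : 2 * m + 2 - δ < Mf p q t ε := by
    by_contra hc
    push Not at hc
    have hp := hg.prof h ht
    rw [hee t ht] at hp
    have := hg.kin h ht hC2 (hb _ _ hp hc)
    rw [hee t ht] at this
    linarith
  rw [Real.dist_eq, abs_lt]; constructor <;> linarith
end
end
end CSSP

namespace CSSP
noncomputable section
open scoped ContDiff Topology

section
variable {p q f : ℝ × ℝ → ℝ} {m : ℕ} {u : ℝ → ℝ → ℂ} {T0 : ℝ}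

lemma Jc_gv {t r : ℝ} (hr : 0 < r) : Jc p q zr = p zr * gv m p q q zr - q zr * gv m p q p zr := by
  unfold Jc gv; field_simp; ring

lemma J_amgm {t r η c : ℝ} (hr : 0 < r) (hη : 0 < η) :
    c * |Jc p q zr| ≤ c ^ 2 * rpq / (2 * η) + η / 2 * gpq := by
  rw [Jc_gv (m := m) hr]
  have hgg : gpq = gv m p q p zr ^ 2 + gv m p q q zr ^ 2 := rfl
  rw [hgg]
  unfold rho
  generalize gv m p q p zr = x
  generalize gv m p q q zr = y
  generalize p zr = a
  generalize q zr = b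
  have key : ∀ σ : ℝ, σ ^ 2 = 1 → c ^ 2 * (a ^ 2 + b ^ 2) / (2 * η) + η / 2 * (x ^ 2 + y ^ 2)
      - c * (σ * (a * y - b * x)) = 1 / (2 * η) * ((σ * c * a - η * y) ^ 2 + (σ * c * b + η * x) ^ 2) := by
    intro σ hσ
    have : 1 / (2 * η) * ((σ * c * a - η * y) ^ 2 + (σ * c * b + η * x) ^ 2) =
      σ ^ 2 * (c ^ 2 * (a ^ 2 + b ^ 2) / (2 * η)) + η / 2 * (x ^ 2 + y ^ 2)
      - c * (σ * (a * y - b * x)) := by field_simp; ring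
    rw [this, hσ, one_mul]
  have k1 := key 1 (by norm_num)
  have k2 := key (-1) (by norm_num)
  have p1 : 0 ≤ 1 / (2 * η) * ((1 * c * a - η * y) ^ 2 + (1 * c * b + η * x) ^ 2) := by positivity
  have p2 : 0 ≤ 1 / (2 * η) * ((-1 * c * a - η * y) ^ 2 + (-1 * c * b + η * x) ^ 2) := by positivity
  rcases abs_cases (a * y - b * x) with ⟨h, _⟩ | ⟨h, _⟩ <;> rw [h] <;> linarith

def Vn (p q : ℝ × ℝ → ℝ) (n t : ℝ) : ℝ := ∫ r in (0:ℝ)..n, (r * rn) ^ 2 * rpq * r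

lemma Vn_nonneg {n : ℝ} (hn : 0 < n) (t : ℝ) : 0 ≤ Vn p q n t :=
  intervalIntegral.integral_nonneg hn.le fun r hr =>
    mul_nonneg (mul_nonneg (sq_nonneg _) (rho_nonneg _)) hr.1

lemma Good.Vn_d (hg : Good p q T0) (h : Dat m p q) {n t : ℝ} (hn : 0 < n) (ht : t ∈ Ioo T0 0) :
    ∃ d, HasDerivAt (Vn p q n) d t ∧ ∀ η, 0 < η → |d| ≤ 2 * Vn p q n t / η + 2 * η * ee m p q t := by
  have htI := hg.mem ht
  have dθ : ∀ r : ℝ, HasDerivAt (fun r : ℝ => (r * rn) ^ 2) (2 * (r * rn) * (1 - 2 * r / n)) r := by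
    intro r
    refine (((hasDerivAt_id r).mul (((hasDerivAt_id r).div_const n).const_sub 1)).pow 2).congr_deriv ?_
    simp only [id, Pi.mul_apply]; norm_num; left; field_simp; ring
  refine ⟨_, h.gen.I1 le_rfl hn.le (subset_univ _) dθ (by fun_prop) htI, fun η hη => ?_⟩
  have e0 : (n * (1 - n / n)) ^ 2 = 0 := by rw [div_self hn.ne']; norm_num
  rw [e0]
  simp only [zero_mul, mul_zero, sub_zero]
  have cr := h.cr htI
  have i1 : IntervalIntegrable (fun r => (r * rn) ^ 2 * rpq * r) volume 0 n :=
    Continuous.intervalIntegrable (by fun_prop) _ _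
  have i2 : IntervalIntegrable (fun r => gpq * r) volume 0 n :=
    (intervalIntegrable_iff_integrableOn_Ioc_of_le hn.le).2 ((hg.gg_int h ht).mono_set Ioc_subset_Ioi_self)
  rw [abs_mul, abs_two]
  have := intervalIntegral.norm_integral_le_of_norm_le hn.le (μ := volume)
    (f := fun r => 2 * (r * rn) * (1 - 2 * r / n) * r * Jc p q zr)
    (g := fun r => 1 / η * ((r * rn) ^ 2 * rpq * r) + η * (gpq * r)) ?_
    ((i1.const_mul _).add (i2.const_mul _))
  · rw [intervalIntegral.integral_add (i1.const_mul _) (i2.const_mul _),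
      intervalIntegral.integral_const_mul, intervalIntegral.integral_const_mul, Real.norm_eq_abs] at this
    have j := mul_le_mul_of_nonneg_left (hg.gg_part h ht le_rfl hn.le) hη.le
    have e1 : 2 * Vn p q n t / η = 2 * (1 / η * Vn p q n t) := by ring
    rw [e1]; unfold Vn
    linarith
  · refine Eventually.of_forall fun r hr => ?_
    have hr0 : 0 < r := hr.1
    have hx : r / n ≤ 1 := (div_le_one hn).2 hr.2
    have hx0 : 0 ≤ r / n := by positivity
    have am := mul_le_mul_of_nonneg_left (J_amgm (m := m) (p := p) (q := q) (t := t) (c := r * rn) hr0 hη) hr0.le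
    have h1 : |1 - 2 * r / n| ≤ 1 := by
      rw [show 2 * r / n = 2 * (r / n) by ring, abs_le]; constructor <;> linarith
    have hh : 0 ≤ r * rn := mul_nonneg hr0.le (by linarith)
    have hJ := abs_nonneg (Jc p q zr)
    rw [Real.norm_eq_abs, show 2 * (r * rn) * (1 - 2 * r / n) * r * Jc p q zr
      = (2 * r * (r * rn)) * (1 - 2 * r / n) * Jc p q zr by ring, abs_mul, abs_mul,
      abs_of_nonneg (by positivity)]
    calc _ ≤ 2 * r * (r * rn) * 1 * |Jc p q zr| := by gcongr
      _ = 2 * (r * (r * rn * |Jc p q zr|)) := by ring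
      _ ≤ 2 * (r * ((r * rn) ^ 2 * rpq / (2 * η) + η / 2 * gpq)) := by linarith
      _ = _ := by field_simp

lemma Good.Vn_lim (hg : Good p q T0) (h : Dat m p q) {n : ℝ} (hn : 0 < n) :
    Tendsto (Vn p q n) (𝓝[<] 0) (𝓝 0) := by
  have hgood : ∀ᶠ t in 𝓝[<] (0:ℝ), t ∈ Ioo T0 0 := Ioo_mem_nhdsLT hg.h0
  rw [Metric.tendsto_nhds]
  intro κ hκ
  have hm0 : (0:ℝ) < 4 * m + 4 := by positivity
  obtain ⟨ε, hε, hεn, hεκ⟩ : ∃ ε : ℝ, 0 < ε ∧ ε ≤ n ∧ ε ^ 2 * (4 * m + 4) ≤ κ / 2 := by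
    refine ⟨min n (Real.sqrt (κ / 2 / (4 * m + 4))), lt_min hn (Real.sqrt_pos.2 (by positivity)), min_le_left _ _, ?_⟩
    have : (min n (Real.sqrt (κ / 2 / (4 * m + 4)))) ^ 2 ≤ κ / 2 / (4 * m + 4) := by
      have hs := Real.sq_sqrt (show 0 ≤ κ / 2 / (4 * m + 4) by positivity)
      have : 0 ≤ min n (Real.sqrt (κ / 2 / (4 * m + 4))) := le_min hn.le (Real.sqrt_nonneg _)
      exact (pow_le_pow_left₀ this (min_le_right n (Real.sqrt (κ / 2 / (4 * m + 4)))) 2).trans_eq hs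
    rwa [le_div_iff₀ hm0] at this
  have ev := (hg.conc h hε).eventually (lt_mem_nhds (show 2 * (m:ℝ) + 2 - κ / (4 * n ^ 2 + 4 ) < 2 * m + 2 by
    have : 0 < κ / (4 * n ^ 2 + 4) := by positivity
    linarith))
  filter_upwards [hgood, ev] with t ht hlt
  have htI := hg.mem ht
  have cr := h.cr htI
  have ic : ∀ a b, IntervalIntegrable (fun r => (r * rn) ^ 2 * rpq * r) volume a b :=
    fun a b => Continuous.intervalIntegrable (by fun_prop) _ _
  have ir : ∀ a b, IntervalIntegrable (fun r => rpq * r) volume a b :=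
    fun a b => Continuous.intervalIntegrable (by fun_prop) _ _
  rw [Real.dist_eq, sub_zero, abs_of_nonneg (Vn_nonneg hn t)]
  unfold Vn
  rw [← intervalIntegral.integral_add_adjacent_intervals (ic 0 ε) (ic ε n)]
  have b : ∀ L, 0 < L → L ≤ n → ∀ r ∈ Icc 0 L, (r * rn) ^ 2 * rpq * r ≤ L ^ 2 * (rpq * r) := by
    intro L hL hLn r hr
    have hr0 : 0 ≤ r := hr.1
    have hx : r / n ≤ 1 := (div_le_one hn).2 (hr.2.trans hLn)
    have hx0 : 0 ≤ r / n := by positivity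
    have h1 : r * rn ≤ L := (mul_le_of_le_one_right hr0 (by linarith)).trans hr.2
    have h2 : 0 ≤ r * rn := mul_nonneg hr0 (by linarith)
    rw [mul_assoc]
    have := rho_nonneg (p := p) (q := q) zr
    gcongr
  have j1 := intervalIntegral.integral_mono_on hε.le (ic 0 ε) ((ir 0 ε).const_mul _) (b ε hε hεn)
  have j2 := intervalIntegral.integral_mono_on hεn (ic ε n) ((ir ε n).const_mul _)
    (fun r hr => b n hn le_rfl r ⟨hε.le.trans hr.1, hr.2⟩)
  rw [intervalIntegral.integral_const_mul] at j1 j2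
  have k1 := mul_le_mul_of_nonneg_left (h.mass_le htI le_rfl hε.le) (sq_nonneg ε)
  have k2 : ∫ r in ε..n, rpq * r ≤ 2 * (κ / (4 * n ^ 2 + 4)) := by
    have e1 : ∫ r in ε..n, rpq * r = 2 * Mf p q t n - 2 * Mf p q t ε := by
      unfold Mf
      rw [← intervalIntegral.integral_add_adjacent_intervals (ir 0 ε) (ir ε n)]; ring
    rw [e1]; linarith [h.M_le htI hn.le]
  have k3 := mul_le_mul_of_nonneg_left k2 (sq_nonneg n)
  have k4 : n ^ 2 * (2 * (κ / (4 * n ^ 2 + 4))) < κ / 2 := by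
    rw [← mul_div_assoc, ← mul_div_assoc, div_lt_iff₀ (by positivity)]
    linarith
  linarith

lemma Good.ee_const (hg : Good p q T0) (h : Dat m p q) {t s : ℝ} (ht : t ∈ Ioo T0 0) (hs : s ∈ Ioo T0 0) :
    ee m p q t = ee m p q s := by
  rcases le_total t s with h1 | h1
  · exact hg.energy h ht.1 h1 hs.2
  · exact (hg.energy h hs.1 h1 ht.2).symm

lemma Good.Vn_le (hg : Good p q T0) (h : Dat m p q) {n t : ℝ} (hn : 0 < n) (ht : t ∈ Ioo T0 0) :
    Vn p q n t ≤ 4 * ee m p q t * t ^ 2 := by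
  have e0 := ee_nonneg (m := m) (p := p) (q := q) t
  have ht0 : t < 0 := ht.2
  have key : ∀ δ, 0 < δ → Real.sqrt (Vn p q n t + δ) ≤ Real.sqrt δ + 2 * Real.sqrt (ee m p q t + δ) * (-t) := by
    intro δ hδ
    have step : ∀ s ∈ Ioo t 0, Real.sqrt (Vn p q n t + δ) ≤ Real.sqrt (Vn p q n s + δ) + 2 * Real.sqrt (ee m p q t + δ) * (-t) := by
      intro s hs
      have hsg : ∀ x ∈ Icc t s, x ∈ Ioo T0 0 := fun x hx => ⟨ht.1.trans_le hx.1, hx.2.trans_lt hs.2⟩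
      have hd : ∀ x ∈ Icc t s, ∃ d, HasDerivAt (fun x => Real.sqrt (Vn p q n x + δ)) d x ∧
          |d| ≤ 2 * Real.sqrt (ee m p q t + δ) := by
        intro x hx
        obtain ⟨d, hd, hb⟩ := hg.Vn_d h hn (hsg x hx)
        have hV := Vn_nonneg (p := p) (q := q) hn x
        have hpos : 0 < Vn p q n x + δ := by linarith
        refine ⟨_, (hd.add_const δ).sqrt hpos.ne', ?_⟩
        set y := Real.sqrt (Vn p q n x + δ) with hy
        set E := Real.sqrt (ee m p q t + δ) with hE
        have hE0 : 0 < E := Real.sqrt_pos.2 (by linarith)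
        have hy0 : 0 < y := Real.sqrt_pos.2 hpos
        have hy2 : y ^ 2 = Vn p q n x + δ := Real.sq_sqrt hpos.le
        have hE2 : E ^ 2 = ee m p q t + δ := Real.sq_sqrt (by linarith)
        have := hb (y / E) (by positivity)
        rw [hg.ee_const h (hsg x hx) ht] at this
        rw [abs_div, abs_of_pos (by positivity : 0 < 2 * y), div_le_iff₀ (by positivity)]
        refine this.trans ?_
        have a1 : 2 * Vn p q n x / (y / E) ≤ 2 * y ^ 2 / (y / E) := by gcongr; linarith
        have a2 : 2 * (y / E) * ee m p q t ≤ 2 * (y / E) * E ^ 2 := by gcongr; linarith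
        have a3 : 2 * y ^ 2 / (y / E) = 2 * y * E := by field_simp
        have a4 : 2 * (y / E) * E ^ 2 = 2 * y * E := by field_simp
        linarith
      choose! d hd1 hd2 using hd
      have := abs_sub_le_int hs.1.le hd1 (continuousOn_const (c := 2 * Real.sqrt (ee m p q t + δ))) hd2
      rw [intervalIntegral.integral_const, smul_eq_mul] at this
      have t1 := (abs_le.1 this).1
      have : (s - t) * (2 * Real.sqrt (ee m p q t + δ)) ≤ (-t) * (2 * Real.sqrt (ee m p q t + δ)) := by
        gcongr; linarith [hs.2]
      linarith
    have lim : Tendsto (fun s => Real.sqrt (Vn p q n s + δ) + 2 * Real.sqrt (ee m p q t + δ) * (-t)) (𝓝[<] 0)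
        (𝓝 (Real.sqrt (0 + δ) + 2 * Real.sqrt (ee m p q t + δ) * (-t))) :=
      (((hg.Vn_lim h hn).add_const δ).sqrt).add_const _
    rw [zero_add] at lim
    refine ge_of_tendsto lim ?_
    filter_upwards [Ioo_mem_nhdsLT ht0] with s hs using step s hs
  have l1 : Tendsto (fun δ => Real.sqrt (Vn p q n t + δ)) (𝓝[>] 0) (𝓝 (Real.sqrt (Vn p q n t + 0))) := by
    refine Tendsto.mono_left ?_ nhdsWithin_le_nhds
    exact Continuous.tendsto (by fun_prop) 0
  have l2 : Tendsto (fun δ => Real.sqrt δ + 2 * Real.sqrt (ee m p q t + δ) * (-t)) (𝓝[>] 0)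
      (𝓝 (Real.sqrt 0 + 2 * Real.sqrt (ee m p q t + 0) * (-t))) := by
    refine Tendsto.mono_left ?_ nhdsWithin_le_nhds
    exact Continuous.tendsto (f := fun δ => Real.sqrt δ + 2 * Real.sqrt (ee m p q t + δ) * (-t)) (by fun_prop) 0
  have := le_of_tendsto_of_tendsto l1 l2 (by filter_upwards [self_mem_nhdsWithin] with δ hδ using key δ hδ)
  simp only [add_zero, Real.sqrt_zero, zero_add] at this
  have hV := Vn_nonneg (p := p) (q := q) hn t
  rw [← Real.sq_sqrt hV]
  calc _ ≤ (2 * Real.sqrt (ee m p q t) * (-t)) ^ 2 := by gcongr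
    _ = 4 * (Real.sqrt (ee m p q t)) ^ 2 * t ^ 2 := by ring
    _ = _ := by rw [Real.sq_sqrt e0]

/-- finite variance -/
lemma Good.var (hg : Good p q T0) (h : Dat m p q) {t : ℝ} (ht : t ∈ Ioo T0 0) :
    IntegrableOn (fun r => r ^ 2 * rpq * r) (Ioi 0) ∧
    ∫ r in Ioi (0:ℝ), r ^ 2 * rpq * r ≤ 4 * ee m p q t * t ^ 2 := by
  have htI := hg.mem ht
  have cr := h.cr htI
  have cV : Continuous (fun r => r ^ 2 * rpq * r) := by fun_prop
  have bd : ∀ L : ℝ, 0 < L → ∫ r in (0:ℝ)..L, r ^ 2 * rpq * r ≤ 4 * ee m p q t * t ^ 2 := by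
    intro L hL
    have lim : Tendsto (fun n : ℕ => (1 - L / (n:ℝ)) ^ 2 * ∫ r in (0:ℝ)..L, r ^ 2 * rpq * r) atTop
        (𝓝 ((1 - 0) ^ 2 * ∫ r in (0:ℝ)..L, r ^ 2 * rpq * r)) :=
      (((tendsto_const_div_atTop_nhds_zero_nat L).const_sub 1).pow 2).mul_const _
    norm_num at lim
    refine le_of_tendsto lim ?_
    filter_upwards [eventually_ge_atTop (max ⌈L⌉₊ 1)] with n hn
    have hnL : L ≤ n := (Nat.le_ceil L).trans (by exact_mod_cast (le_max_left _ _).trans hn)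
    have hn0 : (0:ℝ) < n := by linarith
    refine le_trans ?_ (hg.Vn_le h hn0 ht)
    unfold Vn
    rw [← intervalIntegral.integral_const_mul]
    have ic : ∀ a b, IntervalIntegrable (fun r => (r * rn) ^ 2 * rpq * r) volume a b :=
      fun a b => Continuous.intervalIntegrable (by fun_prop) _ _
    refine le_trans (intervalIntegral.integral_mono_on hL.le ((cV.intervalIntegrable _ _).const_mul _) (ic 0 L) ?_)
      (intervalIntegral.integral_mono_interval le_rfl hL.le hnL ?_ (ic 0 n))
    · intro r hr
      have hr0 : 0 ≤ r := hr.1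
      have hx : L / n ≤ 1 := (div_le_one hn0).2 hnL
      have hx2 : r / n ≤ L / n := by gcongr; exact hr.2
      have e1 : (1 - L / (n:ℝ)) ^ 2 ≤ rn ^ 2 := by
        apply pow_le_pow_left₀ <;> linarith
      have := mul_le_mul_of_nonneg_right e1 (show 0 ≤ r ^ 2 * rpq * r from
        mul_nonneg (mul_nonneg (sq_nonneg _) (rho_nonneg _)) hr0)
      calc _ ≤ _ := this
        _ = _ := by ring
    · refine (ae_restrict_iff' measurableSet_Ioc).2 (Eventually.of_forall fun r hr => ?_)
      exact mul_nonneg (mul_nonneg (sq_nonneg _) (rho_nonneg _)) hr.1.le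
  have hint : IntegrableOn (fun r => r ^ 2 * rpq * r) (Ioi 0) := by
    refine integrableOn_Ioi_of_intervalIntegral_norm_bounded (l := atTop) (b := fun n : ℕ => (n:ℝ))
      (4 * ee m p q t * t ^ 2) 0 (fun n => (cV.integrableOn_Icc (a := 0) (b := (n:ℝ))).mono_set Ioc_subset_Icc_self) tendsto_natCast_atTop_atTop ?_
    filter_upwards [eventually_gt_atTop 0] with n hn
    have hn0 : (0:ℝ) < n := by exact_mod_cast hn
    refine le_trans (le_of_eq ?_) (bd n hn0)
    refine intervalIntegral.integral_congr fun r hr => ?_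
    rw [uIcc_of_le hn0.le] at hr
    exact Real.norm_of_nonneg (mul_nonneg (mul_nonneg (sq_nonneg _) (rho_nonneg _)) hr.1)
  refine ⟨hint, ?_⟩
  refine le_of_tendsto (intervalIntegral_tendsto_integral_Ioi 0 hint tendsto_id) ?_
  filter_upwards [eventually_gt_atTop 0] with L hL using bd L hL
end
end
end CSSP

namespace CSSP
noncomputable section
open scoped ContDiff Topology

section
variable {p q f : ℝ × ℝ → ℝ} {m : ℕ} {u : ℝ → ℝ → ℂ} {T0 : ℝ}

lemma Dat.gg_int' (h : Dat m p q) {t : ℝ} (htI : t ∈ II) (iY : IntegrableOn (fun r => ypq * r) (Ioi 0)) :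
    IntegrableOn (fun r => gpq * r) (Ioi 0) := by
  refine ((iY.const_mul 2).add ((h.rhor_int htI).const_mul (2 * mm2 ^ 2))).mono' ?_ ?_
  · exact ((h.cg htI).mul continuousOn_id).aestronglyMeasurable mI
  · refine aeI (fun r hr => ?_)
    have := h.gg_le htI hr
    rw [Real.norm_of_nonneg (mul_nonneg (gg_nonneg _) (le_of_lt hr))]
    exact this

lemma Dat.r2_int (h : Dat m p q) {t C : ℝ} (htI : t ∈ II) (hC : ∀ r, 0 < r → rpq ≤ C) :
    IntegrableOn (fun r => rpq ^ 2 * r) (Ioi 0) := by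
  have cr := h.cr htI
  refine ((h.int t htI).const_mul C).mono' ?_ ?_
  · exact Continuous.aestronglyMeasurable (by fun_prop)
  · refine aeI (fun r hr => ?_)
    have hr0 : 0 < r := hr
    have h0 := rho_nonneg (p := p) (q := q) zr
    rw [Real.norm_of_nonneg (by positivity), sq, mul_assoc]
    exact mul_le_mul_of_nonneg_right (hC r hr) (by positivity)

lemma Dat.a2_int (h : Dat m p q) {t : ℝ} (htI : t ∈ II) :
    IntegrableOn (fun r => apq ^ 2 * rpq / r) (Ioi 0) := by
  have cr := h.cr htI
  have ca := h.ca htI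
  refine ((h.rhor_int htI).const_mul (mm2 ^ 2)).mono' ?_ ?_
  · refine ContinuousOn.aestronglyMeasurable ?_ mI
    exact ContinuousOn.div (by fun_prop) continuousOn_id fun r hr => ne_of_gt hr
  · refine aeI (fun r hr => ?_)
    have hr0 : 0 < r := hr
    have h0 := rho_nonneg (p := p) (q := q) zr
    have ha := h.a_abs htI hr0.le
    rw [Real.norm_of_nonneg (by positivity), mul_div_assoc]
    refine mul_le_mul_of_nonneg_right ?_ (by positivity)
    rw [← sq_abs]; gcongr

lemma Dat.aρ_r (h : Dat m p q) {t r : ℝ} (htI : t ∈ II) (hr0 : 0 < r) :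
    HasDerivAt (fun s => av m p q zs * rho p q zs)
        (ypq * r + apq ^ 2 * rpq / r - 1 / 2 * (rpq ^ 2 * r)
          - gpq * r) r := by
  have := ((h.M_r htI r).const_sub (m:ℝ)).mul (rho_r h.gen htI (mem_univ r))
  refine this.congr_deriv ?_
  rw [gg_eq hr0]
  simp only [av]; field_simp; ring

/-- Bogomolny identity -/
lemma Dat.bog (h : Dat m p q) {t C : ℝ} (htI : t ∈ II) (iY : IntegrableOn (fun r => ypq * r) (Ioi 0))
    (hC : ∀ r, 0 < r → rpq ≤ C) :
    IntegrableOn (fun r => ypq * r + apq ^ 2 * rpq / r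
      - 1 / 2 * (rpq ^ 2 * r)) (Ioi 0) ∧
    ∫ r in Ioi (0:ℝ), (ypq * r + apq ^ 2 * rpq / r
      - 1 / 2 * (rpq ^ 2 * r)) = ee m p q t := by
  have cr := h.cr htI
  have ca := h.ca htI
  have i1 : IntegrableOn (fun r => ypq * r + apq ^ 2 * rpq / r
      - 1 / 2 * (rpq ^ 2 * r)) (Ioi 0) :=
    (iY.add (h.a2_int htI)).sub ((h.r2_int htI hC).const_mul _)
  have ig := h.gg_int' htI iY
  refine ⟨i1, ?_⟩
  have ifn : IntegrableOn (fun s => av m p q zs * rho p q zs) (Ioi 1) := by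
    refine (((h.int t htI).mono_set (Ioi_subset_Ioi zero_le_one)).const_mul mm2).mono' ?_ ?_
    · exact Continuous.aestronglyMeasurable (by fun_prop)
    · refine aeI (fun r hr => ?_)
      have hr1 : 1 < r := hr
      have h0 := rho_nonneg (p := p) (q := q) zr
      rw [Real.norm_eq_abs, abs_mul, abs_of_nonneg h0]
      exact mul_le_mul (h.a_abs htI (by linarith)) (le_mul_of_one_le_right h0 hr1.le) h0 (by positivity)
  have hd := fun r (hr : r ∈ Ioi (0:ℝ)) => h.aρ_r htI hr
  have lim := tendsto_zero_of_hasDerivAt_of_integrableOn_Ioi (a := 1)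
    (fun r hr => hd r (mem_Ioi.2 (one_pos.trans hr))) ((i1.sub ig).mono_set (Ioi_subset_Ioi zero_le_one)) ifn
  have := integral_Ioi_of_hasDerivAt_of_tendsto (a := (0:ℝ)) (Continuous.continuousWithinAt (by fun_prop)) hd (i1.sub ig) lim
  rw [integral_sub i1 ig] at this
  have z : rho p q (t, 0) = 0 := by unfold rho; rw [h.p0 t htI, h.q0 t htI]; norm_num
  rw [z] at this
  unfold ee
  linarith

def W1v (m : ℕ) (p q : ℝ × ℝ → ℝ) (z : ℝ × ℝ) : ℝ := (av m p q z) ^ 2 / z.2 ^ 2 + Av m p q z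

def Hn (m : ℕ) (p q : ℝ × ℝ → ℝ) (n t r : ℝ) : ℝ :=
  2 * (r * (rn ^ 3 - 3 * (r / n) * rn ^ 2)) * ypq
  + (r / n) * rn * (15 * (r / n) - 9) * (p zr * dR p zr + q zr * dR q zr)
  + 2 * rn ^ 3 * (apq ^ 2 * rpq / r)
  - 1 / 2 * (r * (2 * rn ^ 3 - 3 * (r / n) * rn ^ 2)) * rpq ^ 2

def BH (m : ℕ) (p q : ℝ × ℝ → ℝ) (C t r : ℝ) : ℝ :=
  11 * (ypq * r) + (5 + 2 * mm2 ^ 2) * (rpq / r) + 2 * C * (rpq * r)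

lemma Re_le {t r : ℝ} (hr : 0 < r) : |p zr * dR p zr + q zr * dR q zr| ≤
    1 / 2 * (ypq * r) + 1 / 2 * (rpq / r) := by
  unfold YY rho
  generalize dR p zr = x
  generalize dR q zr = y
  generalize p zr = a
  generalize q zr = b
  have key : ∀ σ : ℝ, σ ^ 2 = 1 → 1 / 2 * ((x ^ 2 + y ^ 2) * r) + 1 / 2 * ((a ^ 2 + b ^ 2) / r)
      - σ * (a * x + b * y) = 1 / (2 * r) * ((r * x - σ * a) ^ 2 + (r * y - σ * b) ^ 2) := by
    intro σ hσ
    have : 1 / (2 * r) * ((r * x - σ * a) ^ 2 + (r * y - σ * b) ^ 2) = 1 / 2 * ((x ^ 2 + y ^ 2) * r)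
      + σ ^ 2 * (1 / 2 * ((a ^ 2 + b ^ 2) / r)) - σ * (a * x + b * y) := by field_simp; ring
    rw [this, hσ, one_mul]
  have k1 := key 1 (by norm_num)
  have k2 := key (-1) (by norm_num)
  have p1 : 0 ≤ 1 / (2 * r) * ((r * x - 1 * a) ^ 2 + (r * y - 1 * b) ^ 2) := by positivity
  have p2 : 0 ≤ 1 / (2 * r) * ((r * x - -1 * a) ^ 2 + (r * y - -1 * b) ^ 2) := by positivity
  rw [abs_le]; constructor <;> linarith

lemma Dat.Hn_le (h : Dat m p q) {t C : ℝ} (htI : t ∈ II) (hC : ∀ r, 0 < r → rpq ≤ C) {n r : ℝ}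
    (hr : r ∈ Ioc 0 n) : |Hn m p q n t r| ≤ BH m p q C t r := by
  have hr0 : 0 < r := hr.1
  have hn : 0 < n := hr0.trans_le hr.2
  have hx1 : r / n ≤ 1 := (div_le_one hn).2 hr.2
  have hx0 : 0 ≤ r / n := by positivity
  have hY := YY_nonneg (p := p) (q := q) zr
  have hρ := rho_nonneg (p := p) (q := q) zr
  have hRe := Re_le (p := p) (q := q) (t := t) hr0
  have ha := h.a_abs htI hr0.le
  have ha2 : apq ^ 2 * rpq / r ≤ mm2 ^ 2 * (rpq / r) := by
    rw [mul_div_assoc]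
    refine mul_le_mul_of_nonneg_right ?_ (by positivity)
    rw [← sq_abs]; gcongr
  have ha3 : 0 ≤ apq ^ 2 * rpq / r := by positivity
  have hr2 : rpq ^ 2 * r ≤ C * (rpq * r) := by
    rw [sq, mul_assoc]; exact mul_le_mul_of_nonneg_right (hC r hr0) (by positivity)
  have hr2' : 0 ≤ rpq ^ 2 * r := by positivity
  have hYr : 0 ≤ ypq * r := by positivity
  have hρr : 0 ≤ rpq / r := by positivity
  unfold Hn BH
  have e1 : 2 * (r * (rn ^ 3 - 3 * (r / n) * rn ^ 2)) * ypq
    = (2 * rn ^ 2 * (1 - 4 * (r / n))) * (ypq * r) := by ring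
  have e4 : 1 / 2 * (r * (2 * rn ^ 3 - 3 * (r / n) * rn ^ 2)) * rpq ^ 2
    = (1 / 2 * rn ^ 2 * (2 - 5 * (r / n))) * (rpq ^ 2 * r) := by ring
  rw [e1, e4]
  generalize r / n = x at *
  generalize ypq * r = Y at *
  generalize rpq / r = R at *
  generalize apq ^ 2 * rpq / r = A at *
  generalize rpq ^ 2 * r = R2 at *
  generalize rpq * r = R1 at *
  generalize p zr * dR p zr + q zr * dR q zr = E at *
  have s0 : 0 ≤ 1 - x := by linarith
  have s1 : (1 - x) ^ 2 ≤ 1 := pow_le_one₀ s0 (by linarith)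
  have s2 : 0 ≤ (1 - x) ^ 2 := sq_nonneg _
  have s3 : (1 - x) ^ 3 ≤ 1 := pow_le_one₀ s0 (by linarith)
  have s4 : 0 ≤ (1 - x) ^ 3 := by positivity
  have c1 : |2 * (1 - x) ^ 2 * (1 - 4 * x)| ≤ 6 := by
    rw [abs_mul, abs_of_nonneg (by positivity)]
    have : |1 - 4 * x| ≤ 3 := by rw [abs_le]; constructor <;> linarith
    calc _ ≤ (2:ℝ) * 1 * 3 := by gcongr
      _ = 6 := by norm_num
  have c2 : |x * (1 - x) * (15 * x - 9)| ≤ 9 := by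
    rw [abs_mul, abs_of_nonneg (by positivity)]
    have : |15 * x - 9| ≤ 9 := by rw [abs_le]; constructor <;> linarith
    calc _ ≤ 1 * 1 * (9:ℝ) := by gcongr; linarith
      _ = 9 := by norm_num
  have c3 : |2 * (1 - x) ^ 3| ≤ 2 := by rw [abs_of_nonneg (by positivity)]; linarith
  have c4 : |1 / 2 * (1 - x) ^ 2 * (2 - 5 * x)| ≤ 2 := by
    rw [abs_mul, abs_of_nonneg (by positivity)]
    have : |2 - 5 * x| ≤ 3 := by rw [abs_le]; constructor <;> linarith
    calc _ ≤ 1 / 2 * 1 * (3:ℝ) := by gcongr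
      _ ≤ 2 := by norm_num
  generalize 2 * (1 - x) ^ 2 * (1 - 4 * x) = k1 at *
  generalize x * (1 - x) * (15 * x - 9) = k2 at *
  generalize 2 * (1 - x) ^ 3 = k3 at *
  generalize 1 / 2 * (1 - x) ^ 2 * (2 - 5 * x) = k4 at *
  have d1 : |k1 * Y| ≤ 6 * Y := by rw [abs_mul, abs_of_nonneg hYr]; gcongr
  have d2 : |k2 * E| ≤ 9 * (1 / 2 * Y + 1 / 2 * R) := by rw [abs_mul]; gcongr
  have d3 : |k3 * A| ≤ 2 * (mm2 ^ 2 * R) := by rw [abs_mul, abs_of_nonneg ha3]; gcongr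
  have d4 : |k4 * R2| ≤ 2 * (C * R1) := by rw [abs_mul, abs_of_nonneg hr2']; gcongr
  have q1 := abs_le.1 d1
  have q2 := abs_le.1 d2
  have q3 := abs_le.1 d3
  have q4 := abs_le.1 d4
  have e5 : (5 + 2 * (2 * (m:ℝ) + 2) ^ 2) * R = 5 * R + 2 * (mm2 ^ 2 * R) := by ring
  have e6 : 2 * C * R1 = 2 * (C * R1) := by ring
  rw [e5, e6, abs_le]; constructor <;> linarith [q1.1, q2.1, q3.1, q4.1, q1.2, q2.2, q3.2, q4.2]

lemma Dat.BH_int (h : Dat m p q) {t : ℝ} (C : ℝ) (htI : t ∈ II) (iY : IntegrableOn (fun r => ypq * r) (Ioi 0)) :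
    IntegrableOn (fun r => BH m p q C t r) (Ioi 0) ∧ ∫ r in Ioi (0:ℝ), BH m p q C t r =
      11 * (∫ r in Ioi (0:ℝ), ypq * r) + (5 + 2 * mm2 ^ 2) * (∫ r in Ioi (0:ℝ), rpq / r)
       + 2 * C * (4 * (m + 1)) := by
  have i1 := iY.const_mul (11:ℝ)
  have i2 := (h.rhor_int htI).const_mul (5 + 2 * (2 * (m:ℝ) + 2) ^ 2)
  have i3 := (h.int t htI).const_mul (2 * C)
  refine ⟨(i1.add i2).add i3, ?_⟩
  unfold BH
  have i12 : Integrable (fun r => 11 * (ypq * r) + (5 + 2 * (2 * (m:ℝ) + 2) ^ 2) * (rpq / r))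
    (volume.restrict (Ioi 0)) := i1.add i2
  rw [integral_add i12 i3, integral_add i1 i2, integral_const_mul, integral_const_mul, integral_const_mul, h.mass t htI]

lemma Dat.Hn_cont (h : Dat m p q) {t : ℝ} (htI : t ∈ II) (n : ℝ) : ContinuousOn (fun r => Hn m p q n t r) (Ioi 0) := by
  have cr := h.cr htI
  have ca := h.ca htI
  have cY := h.cY htI
  have cR : Continuous (fun r => p zr * dR p zr + q zr * dR q zr) := by
    have h1 := (dR_smooth isOpen_IU h.ps).continuousOn
    have h2 := (dR_smooth isOpen_IU h.qs).continuousOn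
    have h3 := h.ps.continuousOn
    have h4 := h.qs.continuousOn
    exact slice_univ (F := fun z => p z * dR p z + q z * dR q z) (by fun_prop) htI
  have c3 : ContinuousOn (fun r => apq ^ 2 * rpq / r) (Ioi 0) :=
    ContinuousOn.div (by fun_prop) continuousOn_id fun r hr => ne_of_gt hr
  unfold Hn
  set F1 := fun r => apq ^ 2 * rpq / r with hF1
  set F2 := fun r => p zr * dR p zr + q zr * dR q zr with hF2
  show ContinuousOn (fun r => 2 * (r * (rn ^ 3 - 3 * (r / n) * rn ^ 2)) * ypq
    + (r / n) * rn * (15 * (r / n) - 9) * F2 r + 2 * rn ^ 3 * F1 r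
    - 1 / 2 * (r * (2 * rn ^ 3 - 3 * (r / n) * rn ^ 2)) * rpq ^ 2) (Ioi 0)
  fun_prop

def psv (n r : ℝ) : ℝ := r ^ 2 * rn ^ 3
def psv' (n r : ℝ) : ℝ := r * (2 * rn ^ 3 - 3 * (r / n) * rn ^ 2)
def psv'' (n r : ℝ) : ℝ := 2 * rn ^ 3 - 12 * (r / n) * rn ^ 2 + 6 * (r / n) ^ 2 * rn

lemma psv_d {n : ℝ} (hn : 0 < n) (r : ℝ) : HasDerivAt (psv n) (psv' n r) r ∧ HasDerivAt (psv' n) (psv'' n r) r := by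
  have d : HasDerivAt (fun r => 1 - r / n) (-(1 / n)) r := ((hasDerivAt_id r).div_const n).const_sub 1
  have dx : HasDerivAt (fun r => r / n) (1 / n) r := (hasDerivAt_id r).div_const n
  constructor
  · refine (((hasDerivAt_id r).pow 2).mul (d.pow 3)).congr_deriv ?_
    simp only [id, Pi.pow_apply, psv']; norm_num; field_simp; ring
  · refine ((hasDerivAt_id r).mul (((d.pow 3).const_mul 2).sub ((dx.const_mul 3).mul (d.pow 2)))).congr_deriv ?_
    simp only [id, Pi.pow_apply, Pi.mul_apply, Pi.sub_apply, psv'']; norm_num; field_simp; ring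

/-- virial derivative -/
lemma Dat.virial_d (h : Dat m p q) {t C n : ℝ} (htI : t ∈ II) (iY : IntegrableOn (fun r => ypq * r) (Ioi 0))
    (hC : ∀ r, 0 < r → rpq ≤ C) (hn : 0 < n) :
    ∫ r in (0:ℝ)..n, psv n r * Jt p q zr = ∫ r in (0:ℝ)..n, Hn m p q n t r := by
  have cr := h.cr htI
  have ca := h.ca htI
  obtain ⟨G, cG, hG, hI⟩ := h.gen.I2' (c0 := 1) (W1 := W1v m p q) hn.le (subset_univ _) (fun r => (psv_d hn r).1)
    (fun r => (psv_d hn r).2) (by unfold psv''; fun_prop)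
    (fun t _ r _ _ => by unfold Wv W1v; ring) htI
  rw [hI]
  have b1 : Bv 1 (psv n) (psv' n) p q (t, n) = 0 := by
    simp [Bv, psv, psv', div_self hn.ne']
  have b2 : Bv 1 (psv n) (psv' n) p q (t, 0) = 0 := by
    simp [Bv, psv, psv']
  rw [b1, b2]
  have iG : IntervalIntegrable G volume 0 n := ContinuousOn.intervalIntegrable (by rwa [uIcc_of_le hn.le])
  have iH : IntervalIntegrable (fun r => Hn m p q n t r) volume 0 n := by
    rw [intervalIntegrable_iff_integrableOn_Ioc_of_le hn.le]
    refine ((h.BH_int C htI iY).1.mono_set Ioc_subset_Ioi_self).mono' ?_ ?_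
    · exact ((h.Hn_cont htI n).mono Ioc_subset_Ioi_self).aestronglyMeasurable measurableSet_Ioc
    · exact (ae_restrict_iff' measurableSet_Ioc).2 (Eventually.of_forall fun r hr => h.Hn_le htI hC hr)
  set N : ℝ → ℝ := fun r => rn ^ 3 * (apq ^ 2 + r ^ 2 * Av m p q zr) * rpq with hN
  have hd : ∀ r ∈ Ioc 0 n, HasDerivAt N (G r - Hn m p q n t r) r := by
    intro r hr
    have hr0 : 0 < r := hr.1
    have d : HasDerivAt (fun r => 1 - r / n) (-(1 / n)) r := ((hasDerivAt_id r).div_const n).const_sub 1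
    have da : HasDerivAt (fun r => apq) (-(1 / 2 * (rpq * r))) r := (h.M_r htI r).const_sub (m:ℝ)
    have := ((d.pow 3).mul ((da.pow 2).add (((hasDerivAt_id r).pow 2).mul (h.A_r htI hr0)))).mul
      (rho_r h.gen htI (mem_univ r))
    refine this.congr_deriv ?_
    rw [hG r ⟨hr0.le, hr.2⟩ hr0]
    simp only [id, Pi.pow_apply, Pi.mul_apply, Pi.add_apply, Gv, Hn, W1v, psv, psv', psv'', YY]
    generalize dR p zr = x
    generalize dR q zr = y
    generalize Av m p q zr = A
    generalize apq = B
    generalize rpq = R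
    generalize p zr * x + q zr * y = E
    norm_num
    field_simp
    ring
  have cN : ContinuousOn N (Icc 0 n) := by
    intro r hr
    rcases hr.1.eq_or_lt with h0 | h0
    · subst h0
      obtain ⟨CA, hCA, hA⟩ := h.A_bdd (t1 := t) (t2 := t) htI.1 htI.2
      have c1 : ContinuousWithinAt (fun r => r ^ 2 * Av m p q zr) (Icc 0 n) 0 := by
        have : Tendsto (fun r : ℝ => CA * r ^ 2) (𝓝[Icc 0 n] 0) (𝓝 (CA * 0 ^ 2)) :=
          (Continuous.tendsto (by fun_prop) 0).mono_left nhdsWithin_le_nhds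
        have t2 : Tendsto (fun r => r ^ 2 * Av m p q zr) (𝓝[Icc 0 n] 0) (𝓝 0) := by
          refine squeeze_zero_norm' ?_ (by simpa using this)
          filter_upwards [self_mem_nhdsWithin] with r hr
          rcases hr.1.eq_or_lt with h1 | h1
          · rw [← h1]; simp
          · rw [Real.norm_eq_abs, abs_mul, abs_of_pos (by positivity), mul_comm]
            have := hA t ⟨le_rfl, le_rfl⟩ r h1
            gcongr
        show Tendsto _ _ (𝓝 _)
        simpa using t2
      have c2 : ContinuousWithinAt (fun r => rn ^ 3) (Icc 0 n) 0 := Continuous.continuousWithinAt (by fun_prop)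
      exact (c2.mul ((ca.pow 2).continuousWithinAt.add c1)).mul cr.continuousWithinAt
    · exact (hd r ⟨h0, hr.2⟩).continuousAt.continuousWithinAt
  have := intervalIntegral.integral_eq_sub_of_hasDerivAt_of_le hn.le cN
    (fun r hr => hd r (Ioo_subset_Ioc_self hr)) (iG.sub iH)
  rw [intervalIntegral.integral_sub iG iH] at this
  have n1 : N n = 0 := by simp [hN, div_self hn.ne']
  have n2 : N 0 = 0 := by simp [hN, rho, h.p0 t htI, h.q0 t htI]
  rw [n1, n2] at this
  linarith
end
end
end CSSP

namespace CSSP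
noncomputable section
open scoped ContDiff Topology

section
variable {p q f : ℝ × ℝ → ℝ} {m : ℕ} {u : ℝ → ℝ → ℂ} {T0 : ℝ}

def pp (p q : ℝ × ℝ → ℝ) (t : ℝ) : ℝ := ∫ r in Ioi (0:ℝ), r ^ 2 * Jc p q zr

def BJ (m : ℕ) (p q : ℝ × ℝ → ℝ) (η t r : ℝ) : ℝ :=
  1 / (2 * η) * (r ^ 2 * rpq * r) + η / 2 * (gpq * r)

lemma J_BJ {t r η : ℝ} (hr : 0 < r) (hη : 0 < η) : |r ^ 2 * Jc p q zr| ≤ BJ m p q η t r := by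
  have := mul_le_mul_of_nonneg_right (J_amgm (p := p) (q := q) (m := m) (t := t) (c := r) hr hη) hr.le
  rw [abs_mul, abs_of_pos (by positivity)]
  unfold BJ
  calc _ = r * |Jc p q zr| * r := by ring
    _ ≤ _ := this
    _ = _ := by field_simp

lemma Good.BJ_int (hg : Good p q T0) (h : Dat m p q) {t : ℝ} (ht : t ∈ Ioo T0 0) {η : ℝ} (hη : 0 < η) :
    IntegrableOn (fun r => BJ m p q η t r) (Ioi 0) ∧
    ∫ r in Ioi (0:ℝ), BJ m p q η t r ≤ 1 / (2 * η) * (4 * ee m p q t * t ^ 2) + η / 2 * ee m p q t := by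
  have i1 := (hg.var h ht).1.const_mul (1 / (2 * η))
  have i2 := (hg.gg_int h ht).const_mul (η / 2)
  refine ⟨i1.add i2, ?_⟩
  unfold BJ
  rw [integral_add i1 i2, integral_const_mul, integral_const_mul]
  have := (hg.var h ht).2
  have h2 : (∫ r in Ioi (0:ℝ), gpq * r) = ee m p q t := rfl
  rw [h2]; gcongr

lemma Dat.cJ (h : Dat m p q) {t : ℝ} (ht : t ∈ II) : Continuous (fun r => Jc p q zr) :=
  slice_univ h.J_sm.continuousOn ht

lemma Good.J_int (hg : Good p q T0) (h : Dat m p q) {t : ℝ} (ht : t ∈ Ioo T0 0) :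
    IntegrableOn (fun r => r ^ 2 * Jc p q zr) (Ioi 0) := by
  have cJ := h.cJ (hg.mem ht)
  refine (hg.BJ_int h ht one_pos).1.mono' (Continuous.aestronglyMeasurable (by fun_prop)) ?_
  exact aeI (fun r hr => J_BJ hr one_pos)

lemma Good.pp_bd (hg : Good p q T0) (h : Dat m p q) {t : ℝ} (ht : t ∈ Ioo T0 0) :
    |pp p q t| ≤ 2 * ee m p q t * (-t) := by
  have hη : 0 < -2 * t := by linarith [ht.2]
  have ht0 : t ≠ 0 := ht.2.ne
  have h1 : |pp p q t| ≤ ∫ r in Ioi (0:ℝ), BJ m p q (-2 * t) t r := by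
    refine norm_integral_le_of_norm_le (f := fun r => r ^ 2 * Jc p q zr) (hg.BJ_int h ht hη).1 ?_
    exact aeI (fun r hr => J_BJ hr hη)
  refine h1.trans ((hg.BJ_int h ht hη).2.trans (le_of_eq ?_))
  field_simp; ring

lemma tn (r : ℝ) : Tendsto (fun n : ℕ => r / (n:ℝ)) atTop (𝓝 0) := tendsto_const_div_atTop_nhds_zero_nat r

lemma Good.pp_lim (hg : Good p q T0) (h : Dat m p q) {t : ℝ} (ht : t ∈ Ioo T0 0) :
    Tendsto (fun n : ℕ => ∫ r in (0:ℝ)..n, psv n r * Jc p q zr) atTop (𝓝 (pp p q t)) := by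
  have cJ := h.cJ (hg.mem ht)
  refine cut_lim (a := fun _ => 0) (B := fun r => BJ m p q 1 t r) (fun _ => le_rfl) (fun n _ => by positivity) tendsto_const_nhds
    (fun n _ => by unfold psv; fun_prop) (hg.BJ_int h ht one_pos).1
    (fun r hr => (abs_nonneg _).trans (J_BJ hr one_pos)) ?_ ?_
  · intro n hn r hr
    refine le_trans ?_ (J_BJ (m := m) (p := p) (q := q) (t := t) hr.1 one_pos)
    have hn0 : (0:ℝ) < n := by exact_mod_cast hn
    have hx : 0 ≤ 1 - r / n := sub_nonneg.2 ((div_le_one hn0).2 hr.2)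
    have hr0 : 0 < r := hr.1
    rw [abs_mul, abs_mul]
    refine mul_le_mul_of_nonneg_right ?_ (abs_nonneg _)
    unfold psv
    rw [abs_mul, abs_of_nonneg (by positivity : 0 ≤ (1 - r / (n:ℝ)) ^ 3)]
    have : (1 - r / (n:ℝ)) ^ 3 ≤ 1 := pow_le_one₀ hx (by linarith [div_nonneg hr0.le hn0.le])
    exact mul_le_of_le_one_right (abs_nonneg _) this
  · intro r hr
    have : Tendsto (fun n : ℕ => r ^ 2 * (1 - r / (n:ℝ)) ^ 3 * Jc p q zr) atTop
      (𝓝 (r ^ 2 * (1 - 0) ^ 3 * Jc p q zr)) :=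
      ((((tendsto_const_nhds (x := (1:ℝ))).sub (tn r)).pow 3).const_mul (r ^ 2)).mul_const _
    simpa [psv] using this

lemma Good.D_lim (hg : Good p q T0) (h : Dat m p q) {t : ℝ} (ht : t ∈ Ioo T0 0) :
    Tendsto (fun n : ℕ => ∫ r in (0:ℝ)..n, psv n r * Jt p q zr) atTop (𝓝 (2 * ee m p q t)) := by
  have htI := hg.mem ht
  obtain ⟨C, hC0, hC⟩ := hg.rho_bdd h ht.1 ht.2
  have hC' : ∀ r, 0 < r → rpq ≤ C := fun r hr => hC t ⟨le_rfl, le_rfl⟩ r hr.le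
  have iY := hg.int t ht
  rw [← (h.bog htI iY hC').2, ← integral_const_mul]
  have hcl := cut_lim (F := fun n r => Hn m p q n t r) (F0 := fun r => 2 * (ypq * r + apq ^ 2 * rpq / r
      - 1 / 2 * (rpq ^ 2 * r)))
    (a := fun _ => 0) (B := fun r => BH m p q C t r) (fun _ => le_rfl) (fun n _ => by positivity) tendsto_const_nhds
    (fun n _ => (h.Hn_cont htI n).mono Ioc_subset_Ioi_self) (h.BH_int C htI iY).1
    (fun r hr => (abs_nonneg _).trans (h.Hn_le htI hC' ⟨hr, le_rfl⟩)) (fun n _ r hr => h.Hn_le htI hC' hr) ?_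
  · refine hcl.congr' ?_
    filter_upwards [eventually_ge_atTop 1] with n hn
    exact (h.virial_d htI iY hC' (by exact_mod_cast hn)).symm
  · intro r hr
    have x := tn r
    have x1 : Tendsto (fun n : ℕ => 1 - r / (n:ℝ)) atTop (𝓝 (1 - 0)) := (tendsto_const_nhds (x := (1:ℝ))).sub x
    have := (((((x1.pow 3).sub ((x.const_mul 3).mul (x1.pow 2))).const_mul r).const_mul 2).mul_const (ypq)).add
      (((x.mul x1).mul ((x.const_mul 15).sub_const 9)).mul_const (p zr * dR p zr + q zr * dR q zr))
    have := this.add (((x1.pow 3).const_mul 2).mul_const (apq ^ 2 * rpq / r))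
    have := this.sub (((((x1.pow 3).const_mul 2).sub ((x.const_mul 3).mul (x1.pow 2))).const_mul r).const_mul (1/2) |>.mul_const (rpq ^ 2))
    unfold Hn
    convert this using 2
    norm_num; ring

lemma Good.pp_sub (hg : Good p q T0) (h : Dat m p q) {t1 t2 : ℝ} (h1 : T0 < t1) (h12 : t1 ≤ t2) (h2 : t2 < 0) :
    pp p q t2 - pp p q t1 = 2 * ee m p q t1 * (t2 - t1) := by
  have hgd : ∀ t ∈ Icc t1 t2, t ∈ Ioo T0 0 := fun t ht => ⟨h1.trans_le ht.1, ht.2.trans_lt h2⟩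
  have hm1 : t1 ∈ Icc t1 t2 := ⟨le_rfl, h12⟩
  have hm2 : t2 ∈ Icc t1 t2 := ⟨h12, le_rfl⟩
  obtain ⟨C, hC0, hC⟩ := hg.rho_bdd h h1 h2
  obtain ⟨C1, hC1⟩ := hg.bdd t1 t2 h1 h2
  obtain ⟨C2, hC20, hC2⟩ := h.rhor_bdd (hg.h1.trans_lt h1) h2
  have cD : ∀ n : ℕ, ContinuousOn (fun t => ∫ r in (0:ℝ)..n, psv n r * Jt p q zr) (Icc t1 t2) := by
    intro n
    refine (param_cont (F' := fun t r => psv n r * Jt p q zr) h.gen.hI (by positivity) ?_).mono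
      (fun t ht => hg.mem (hgd t ht))
    refine ContinuousOn.mul (Continuous.continuousOn (by unfold psv; fun_prop)) (h.gen.Jt_cont.mono (prod_mono le_rfl (subset_univ _)))
  have key : ∀ n : ℕ, ∫ t in t1..t2, ∫ r in (0:ℝ)..n, psv n r * Jt p q zr =
      (∫ r in (0:ℝ)..n, psv n r * Jc p q (t2, r)) - ∫ r in (0:ℝ)..n, psv n r * Jc p q (t1, r) := by
    intro n
    refine intervalIntegral.integral_eq_sub_of_hasDerivAt (f := fun s => ∫ r in (0:ℝ)..n, psv n r * Jc p q (s, r)) ?_ ?_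
    · intro t ht
      rw [uIcc_of_le h12] at ht
      exact h.gen.I2 (by positivity) (subset_univ _) (by unfold psv; fun_prop) (hg.mem (hgd t ht))
    · exact ContinuousOn.intervalIntegrable (by rw [uIcc_of_le h12]; exact cD n)
  have l1 := (hg.pp_lim h (hgd _ hm2)).sub (hg.pp_lim h (hgd _ hm1))
  simp only [← key] at l1
  have l2 : Tendsto (fun n : ℕ => ∫ t in t1..t2, ∫ r in (0:ℝ)..n, psv n r * Jt p q zr) atTop
      (𝓝 (∫ t in t1..t2, 2 * ee m p q t1)) := by
    refine intervalIntegral.tendsto_integral_filter_of_dominated_convergence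
      (fun _ => 11 * C1 + (5 + 2 * (2 * (m:ℝ) + 2) ^ 2) * C2 + 2 * C * (4 * (m + 1))) ?_ ?_ (by simp) ?_
    · refine Eventually.of_forall fun n => ?_
      rw [uIoc_of_le h12]
      exact ((cD n).mono Ioc_subset_Icc_self).aestronglyMeasurable measurableSet_Ioc
    · filter_upwards [eventually_ge_atTop 1] with n hn
      refine Eventually.of_forall fun t ht => ?_
      rw [uIoc_of_le h12] at ht
      have ht' := Ioc_subset_Icc_self ht
      have htI := hg.mem (hgd t ht')
      have hC' : ∀ r, 0 < r → rpq ≤ C := fun r hr => hC t ht' r hr.le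
      have iY := hg.int t (hgd t ht')
      have hn0 : (0:ℝ) < n := by exact_mod_cast hn
      rw [h.virial_d htI iY hC' hn0]
      obtain ⟨iB, eB⟩ := h.BH_int C htI iY
      refine (intervalIntegral.norm_integral_le_of_norm_le hn0.le (g := fun r => BH m p q C t r)
        (Eventually.of_forall fun r hr => h.Hn_le htI hC' hr)
        ((intervalIntegrable_iff_integrableOn_Ioc_of_le hn0.le).2 (iB.mono_set Ioc_subset_Ioi_self))).trans ?_
      rw [intervalIntegral.integral_of_le hn0.le]
      refine (setIntegral_mono_set iB ?_ (LE.le.eventuallyLE Ioc_subset_Ioi_self)).trans ?_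
      · exact aeI (fun r hr =>
          (abs_nonneg _).trans (h.Hn_le htI hC' (n := r) ⟨hr, le_rfl⟩))
      · rw [eB]
        have := hC1 t ht'
        have := hC2 t ht'
        gcongr
    · refine Eventually.of_forall fun t ht => ?_
      rw [uIoc_of_le h12] at ht
      rw [hg.ee_const h (hgd t1 hm1) (hgd t (Ioc_subset_Icc_self ht))]
      exact hg.D_lim h (hgd t (Ioc_subset_Icc_self ht))
  have := tendsto_nhds_unique l1 l2
  rw [this, intervalIntegral.integral_const, smul_eq_mul]; ring

lemma Good.pp_eq (hg : Good p q T0) (h : Dat m p q) {t : ℝ} (ht : t ∈ Ioo T0 0) :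
    pp p q t = 2 * ee m p q t * t := by
  have key : ∀ s ∈ Ioo t 0, |pp p q t - 2 * ee m p q t * t| ≤ 4 * ee m p q t * (-s) := by
    intro s hs
    have hsg : s ∈ Ioo T0 0 := ⟨ht.1.trans hs.1, hs.2⟩
    have h1 := hg.pp_sub h ht.1 hs.1.le hs.2
    have h2 := hg.pp_bd h hsg
    rw [hg.ee_const h hsg ht] at h2
    have e0 := ee_nonneg (m := m) (p := p) (q := q) t
    have : 0 ≤ ee m p q t * (-s) := mul_nonneg e0 (by linarith [hs.2])
    rw [abs_le] at h2 ⊢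
    constructor <;> nlinarith
  have l : Tendsto (fun s : ℝ => 4 * ee m p q t * (-s)) (𝓝[<] 0) (𝓝 (4 * ee m p q t * (-0))) :=
    (Continuous.tendsto (by fun_prop) 0).mono_left nhdsWithin_le_nhds
  have := ge_of_tendsto l (eventually_of_mem (Ioo_mem_nhdsLT ht.2) key)
  rw [neg_zero, mul_zero] at this
  have := abs_nonpos_iff.1 this
  linarith

/-- first-order system at good times -/
lemma Good.rigid (hg : Good p q T0) (h : Dat m p q) {t : ℝ} (ht : t ∈ Ioo T0 0) {r : ℝ} (hr : 0 < r) :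
    gv m p q p zr = -(r / (2 * t) * q zr) ∧ gv m p q q zr = r / (2 * t) * p zr := by
  have htI := hg.mem ht
  have t0 : t ≠ 0 := ht.2.ne
  set F : ℝ → ℝ := fun r => ((gv m p q p zr + r / (2 * t) * q zr) ^ 2
    + (gv m p q q zr - r / (2 * t) * p zr) ^ 2) * r with hF
  have eF : ∀ r ∈ Ioi (0:ℝ), F r = gpq * r + 1 / (4 * t ^ 2) * (r ^ 2 * rpq * r)
      - 1 / t * (r ^ 2 * Jc p q zr) := by
    intro r hr
    rw [Jc_gv (m := m) hr]
    simp only [hF, gg, rho]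
    field_simp; ring
  have i1 := hg.gg_int h ht
  have i2 := (hg.var h ht).1.const_mul (1 / (4 * t ^ 2))
  have i3 := (hg.J_int h ht).const_mul (1 / t)
  have i12 : Integrable (fun r => gpq * r + 1 / (4 * t ^ 2) * (r ^ 2 * rpq * r))
    (volume.restrict (Ioi 0)) := i1.add i2
  have iF : IntegrableOn F (Ioi 0) := (integrableOn_congr_fun eF mI).2 (i12.sub i3)
  have hF0 : ∀ r ∈ Ioi (0:ℝ), 0 ≤ F r := fun r hr => mul_nonneg (by positivity) (le_of_lt hr)
  have vF : ∫ r in Ioi (0:ℝ), F r ≤ 0 := by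
    rw [setIntegral_congr_fun mI eF, integral_sub i12 i3, integral_add i1 i2, integral_const_mul,
      integral_const_mul]
    have e1 : (∫ r in Ioi (0:ℝ), gpq * r) = ee m p q t := rfl
    have e2 : (∫ r in Ioi (0:ℝ), r ^ 2 * Jc p q zr) = pp p q t := rfl
    rw [e1, e2, hg.pp_eq h ht]
    have := mul_le_mul_of_nonneg_left (hg.var h ht).2 (by positivity : 0 ≤ 1 / (4 * t ^ 2))
    have e3 : 1 / (4 * t ^ 2) * (4 * ee m p q t * t ^ 2) = ee m p q t := by field_simp
    have e4 : 1 / t * (2 * ee m p q t * t) = 2 * ee m p q t := by field_simp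
    rw [e4]; linarith
  have z : ∫ r in Ioi (0:ℝ), F r = 0 := le_antisymm vF (setIntegral_nonneg mI hF0)
  have ae := (setIntegral_eq_zero_iff_of_nonneg_ae
    ((ae_restrict_iff' mI).2 (Eventually.of_forall hF0)) iF).1 z
  have c1 := slice_pos (h.gv_sm h.ps).continuousOn htI
  have c2 := slice_pos (h.gv_sm h.qs).continuousOn htI
  have c3 := (slice_univ h.ps.continuousOn htI).continuousOn (s := Ioi (0:ℝ))
  have c4 := (slice_univ h.qs.continuousOn htI).continuousOn (s := Ioi (0:ℝ))
  have cF : ContinuousOn F (Ioi 0) := by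
    have cx : ContinuousOn (fun r : ℝ => r / (2 * t)) (Ioi 0) := Continuous.continuousOn (by fun_prop)
    exact (((c1.add (cx.mul c4)).pow 2).add ((c2.sub (cx.mul c3)).pow 2)).mul continuousOn_id
  have hz : F r = 0 := Measure.eqOn_open_of_ae_eq ae isOpen_Ioi cF continuousOn_const hr
  have hz2 := (mul_eq_zero.1 hz).resolve_right hr.ne'
  constructor <;> nlinarith [sq_nonneg (gv m p q p zr + r / (2 * t) * q zr),
    sq_nonneg (gv m p q q zr - r / (2 * t) * p zr)]
end
end
end CSSP

namespace CSSP
noncomputable section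
open scoped ContDiff Topology

section
variable {p q f : ℝ × ℝ → ℝ} {m : ℕ} {u : ℝ → ℝ → ℂ} {T0 ν c d : ℝ}

def Dn (m : ℕ) (ν : ℝ) (z : ℝ × ℝ) : ℝ := ν * z.1 ^ mm2 + z.2 ^ mm2
def Rr (m : ℕ) (ν : ℝ) (z : ℝ × ℝ) : ℝ :=
  (m + 1) * √(8 * ν) * (-z.1) ^ (m + 1) * z.2 ^ m / Dn m ν z
def aS (m : ℕ) (ν : ℝ) (z : ℝ × ℝ) : ℝ := m - mm2 * z.2 ^ mm2 / Dn m ν z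
def SS (m : ℕ) (ν c d : ℝ) (z : ℝ × ℝ) : ℝ :=
  Rr m ν z * (c * Real.cos (z.2 ^ 2 / (4 * z.1)) - d * Real.sin (z.2 ^ 2 / (4 * z.1)))

lemma ev_pos {x : ℝ} (hx : x ≠ 0) : 0 < x ^ mm2 := by
  have : x ^ mm2 = (x ^ (m + 1)) ^ 2 := by rw [← pow_mul]; congr 1; ring
  rw [this]; positivity
lemma ev_nonneg (x : ℝ) : 0 ≤ x ^ mm2 := by
  have : x ^ mm2 = (x ^ (m + 1)) ^ 2 := by rw [← pow_mul]; congr 1; ring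
  rw [this]; positivity

lemma Dn_pos (hν : 0 < ν) {t : ℝ} (ht : t < 0) (r : ℝ) : 0 < Dn m ν zr := by
  have h1 := ev_pos (m := m) ht.ne
  have h2 := ev_nonneg (m := m) r
  unfold Dn; positivity

lemma pow_d (n : ℕ) {x : ℝ} (hx : x ≠ 0) : HasDerivAt (fun y : ℝ => y ^ n) (n * x ^ n / x) x := by
  refine (hasDerivAt_pow n x).congr_deriv ?_
  rcases n with _ | k
  · simp
  · simp; field_simp; ring

lemma Dn_r {t r : ℝ} (hr : r ≠ 0) : HasDerivAt (fun s => Dn m ν zs) (mm2 * r ^ mm2 / r) r := by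
  have := (pow_d mm2 hr).const_add (ν * t ^ mm2)
  push_cast at this; exact this

lemma Dn_t {t r : ℝ} (ht : t ≠ 0) : HasDerivAt (fun s => Dn m ν (s, r)) (ν * (mm2 * t ^ mm2 / t)) t := by
  have := ((pow_d mm2 ht).const_mul ν).add_const (r ^ mm2)
  push_cast at this; exact this

lemma SS_r (hν : 0 < ν) {t r : ℝ} (ht : t < 0) (hr : r ≠ 0) : HasDerivAt (fun s => SS m ν c d zs)
    (aS m ν zr / r * SS m ν c d zr - r / (2 * t) * SS m ν d (-c) zr) r := by
  have hD := (Dn_pos (m := m) hν ht r).ne'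
  have t0 := ht.ne
  have dφ : HasDerivAt (fun s : ℝ => s ^ 2 / (4 * t)) (2 * r / (4 * t)) r := by
    refine (((hasDerivAt_id r).pow 2).div_const (4 * t)).congr_deriv ?_
    simp
  have := (((pow_d m hr).const_mul ((m + 1) * √(8 * ν) * (-t) ^ (m + 1))).div (Dn_r (m := m) (ν := ν) (t := t) hr) hD).mul
    ((dφ.cos.const_mul c).sub (dφ.sin.const_mul d))
  refine this.congr_deriv ?_
  simp only [Pi.div_apply, Pi.sub_apply, SS, Rr, aS]
  generalize Dn m ν zr = D at *
  generalize Real.cos (r ^ 2 / (4 * t)) = C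
  generalize Real.sin (r ^ 2 / (4 * t)) = S
  field_simp
  ring

lemma SS_t (hν : 0 < ν) {t r : ℝ} (ht : t < 0) : HasDerivAt (fun s => SS m ν c d (s, r))
    (-(aS m ν zr + 1) / t * SS m ν c d zr + r ^ 2 / (4 * t ^ 2) * SS m ν d (-c) zr) t := by
  have hD := (Dn_pos (m := m) hν ht r).ne'
  have t0 := ht.ne
  have dφ : HasDerivAt (fun s : ℝ => r ^ 2 / (4 * s)) (-(r ^ 2 / (4 * t ^ 2))) t := by
    refine ((hasDerivAt_const t (r ^ 2)).div ((hasDerivAt_id t).const_mul 4) (by simpa using t0)).congr_deriv ?_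
    simp; field_simp
  have dn : HasDerivAt (fun s : ℝ => (-s) ^ (m + 1)) ((m + 1) * (-t) ^ (m + 1) / t) t := by
    refine ((hasDerivAt_id t).neg.pow (m + 1)).congr_deriv ?_
    simp; field_simp; ring
  have := (((dn.const_mul ((m + 1) * √(8 * ν))).mul_const (r ^ m)).div (Dn_t (m := m) (ν := ν) (r := r) t0) hD).mul
    ((dφ.cos.const_mul c).sub (dφ.sin.const_mul d))
  refine this.congr_deriv ?_
  have e : r ^ mm2 = Dn m ν zr - ν * t ^ mm2 := by unfold Dn; ring
  simp only [Pi.div_apply, Pi.sub_apply, SS, Rr, aS, e]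
  generalize Dn m ν zr = D at *
  generalize Real.cos (r ^ 2 / (4 * t)) = C
  generalize Real.sin (r ^ 2 / (4 * t)) = S
  field_simp
  ring

lemma SS_sm (hν : 0 < ν) : ContDiffOn ℝ (⊤ : ℕ∞) (SS m ν c d) (II ×ˢ univ) := by
  have h1 : ∀ z ∈ II ×ˢ (univ : Set ℝ), Dn m ν z ≠ 0 := fun z hz => (Dn_pos hν hz.1.2 z.2).ne'
  have h2 : ∀ z ∈ II ×ˢ (univ : Set ℝ), 4 * z.1 ≠ 0 := fun z hz => by have := hz.1.2.ne; simpa using this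
  have hφ : ContDiffOn ℝ (⊤ : ℕ∞) (fun z : ℝ × ℝ => z.2 ^ 2 / (4 * z.1)) (II ×ˢ univ) :=
    ContDiffOn.div (by fun_prop) (by fun_prop) h2
  have hD : ContDiffOn ℝ (⊤ : ℕ∞) (Dn m ν) (II ×ˢ univ) := by unfold Dn; fun_prop
  have hR : ContDiffOn ℝ (⊤ : ℕ∞) (Rr m ν) (II ×ˢ univ) := ContDiffOn.div (by fun_prop) hD h1
  unfold SS
  exact hR.mul ((contDiffOn_const.mul hφ.cos).sub (contDiffOn_const.mul hφ.sin))

lemma SS_neg (z : ℝ × ℝ) : SS m ν (-c) (-d) z = -SS m ν c d z := by unfold SS; ring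

lemma rho_SS (hcd : c ^ 2 + d ^ 2 = 1) (z : ℝ × ℝ) : rho (SS m ν c d) (SS m ν d (-c)) z = Rr m ν z ^ 2 := by
  unfold rho SS
  have h1 := Real.sin_sq_add_cos_sq (z.2 ^ 2 / (4 * z.1))
  generalize Real.cos (z.2 ^ 2 / (4 * z.1)) = C at *
  generalize Real.sin (z.2 ^ 2 / (4 * z.1)) = S at *
  calc _ = Rr m ν z ^ 2 * ((c ^ 2 + d ^ 2) * (S ^ 2 + C ^ 2)) := by ring
    _ = _ := by rw [hcd, h1]; ring

lemma Rr_sq (hν : 0 < ν) (t r : ℝ) : Rr m ν zr ^ 2 =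
    2 * mm2 ^ 2 * ν * t ^ mm2 * r ^ (2 * m) / Dn m ν zr ^ 2 := by
  unfold Rr
  have : √(8 * ν) ^ 2 = 8 * ν := Real.sq_sqrt (by positivity)
  have e1 : ((-t) ^ (m + 1)) ^ 2 = t ^ mm2 := by
    rw [← pow_mul, mul_comm, Even.neg_pow ⟨m + 1, by ring⟩]; congr 1
  simp only
  rw [div_pow, mul_pow, mul_pow, mul_pow, this, e1, ← pow_mul, mul_comm m 2]; ring

lemma MS_r (hν : 0 < ν) {t : ℝ} (ht : t < 0) (r : ℝ) :
    HasDerivAt (fun s => mm2 * s ^ mm2 / Dn m ν zs) (1 / 2 * (Rr m ν zr ^ 2 * r)) r := by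
  have hD := (Dn_pos (m := m) hν ht r).ne'
  have hp : HasDerivAt (fun s : ℝ => s ^ mm2) (mm2 * (r ^ (2 * m) * r)) r := by
    refine (hasDerivAt_pow mm2 r).congr_deriv ?_
    have : 2 * m + 2 - 1 = 2 * m + 1 := rfl
    rw [this, pow_succ]; push_cast; ring
  have := (hp.const_mul (2 * (m:ℝ) + 2)).div (hp.const_add (ν * t ^ mm2)) hD
  refine this.congr_deriv ?_
  rw [Rr_sq hν]
  simp only [Dn] at *
  field_simp
  ring

lemma Rr_cont (hν : 0 < ν) {t : ℝ} (ht : t < 0) : Continuous (fun r => Rr m ν zr) := by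
  unfold Rr
  refine Continuous.div (by fun_prop) (by unfold Dn; fun_prop) fun r => (Dn_pos hν ht r).ne'

lemma MS_eq (hν : 0 < ν) (hcd : c ^ 2 + d ^ 2 = 1) {t : ℝ} (ht : t < 0) (r : ℝ) :
    av m (SS m ν c d) (SS m ν d (-c)) zr = aS m ν zr := by
  have cR := Rr_cont (m := m) hν ht
  unfold av Mf aS
  simp only [rho_SS hcd]
  rw [← intervalIntegral.integral_const_mul,
    intervalIntegral.integral_eq_sub_of_hasDerivAt (fun s _ => MS_r hν ht s) (Continuous.intervalIntegrable (by fun_prop) _ _)]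
  simp

lemma MS_lim (t : ℝ) :
    Tendsto (fun s => (2 * (m:ℝ) + 2) * s ^ mm2 / Dn m ν zs) atTop (𝓝 mm2) := by
  have h1 : Tendsto (fun s : ℝ => s ^ mm2) atTop atTop := tendsto_pow_atTop (by omega)
  have h2 : Tendsto (fun s : ℝ => ν * t ^ mm2 / s ^ mm2 + 1) atTop (𝓝 (0 + 1)) :=
    (h1.const_div_atTop _).add_const 1
  have h3 := (tendsto_const_nhds (x := 2 * (m:ℝ) + 2)).div h2 (by norm_num)
  rw [zero_add, div_one] at h3
  refine h3.congr' ?_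
  filter_upwards [eventually_gt_atTop 0] with s hs
  have : 0 < s ^ mm2 := by positivity
  simp only [Pi.div_apply, Dn]
  generalize s ^ mm2 = x at *
  field_simp

lemma mass_SS (hν : 0 < ν) {t : ℝ} (ht : t < 0) : IntegrableOn (fun r => Rr m ν zr ^ 2 * r) (Ioi 0) ∧
    ∫ r in Ioi (0:ℝ), Rr m ν zr ^ 2 * r = 4 * (m + 1) := by
  have hd := fun r (_ : r ∈ Ici (0:ℝ)) => (MS_r (m := m) hν ht r).const_mul 2
  have h0 : ∀ r ∈ Ioi (0:ℝ), 0 ≤ 2 * (1 / 2 * (Rr m ν zr ^ 2 * r)) := fun r hr => by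
    have : 0 < r := hr
    positivity
  have l := (MS_lim (m := m) (ν := ν) t).const_mul 2
  have i := integrableOn_Ioi_deriv_of_nonneg' hd h0 l
  have e := integral_Ioi_of_hasDerivAt_of_nonneg' hd h0 l
  have ee : ∀ r : ℝ, 2 * (1 / 2 * (Rr m ν zr ^ 2 * r)) = Rr m ν zr ^ 2 * r := fun r => by ring
  simp only [ee] at i e
  refine ⟨i, e.trans ?_⟩
  simp; ring

lemma AS_eq (hν : 0 < ν) (hcd : c ^ 2 + d ^ 2 = 1) {t r : ℝ} (ht : t < 0) (hr : 0 < r) :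
    Av m (SS m ν c d) (SS m ν d (-c)) zr = 1 / 2 * Rr m ν zr ^ 2 := by
  have cR := Rr_cont (m := m) hν ht
  unfold Av
  simp only [rho_SS hcd, MS_eq hν hcd ht]
  have hd : ∀ s ∈ Ici r, HasDerivAt (fun s => 1 / 2 * Rr m ν zs ^ 2) (aS m ν zs * Rr m ν zs ^ 2 / s) s := by
    intro s hs
    have hs0 : 0 < s := hr.trans_le hs
    have hD := (Dn_pos (m := m) hν ht s).ne'
    have := ((((pow_d m hs0.ne').const_mul ((m + 1) * √(8 * ν) * (-t) ^ (m + 1))).div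
      (Dn_r (m := m) (ν := ν) (t := t) hs0.ne') hD).pow 2).const_mul (1 / 2)
    refine this.congr_deriv ?_
    simp only [Pi.div_apply, Rr, aS]
    generalize Dn m ν zs = D at *
    norm_num
    field_simp
  have a_le : ∀ s, |aS m ν zs| ≤ 2 * m + 2 := by
    intro s
    have hD := Dn_pos (m := m) hν ht s
    have h1 : 0 ≤ s ^ mm2 / Dn m ν zs := div_nonneg (ev_nonneg s) hD.le
    have h2 : s ^ mm2 / Dn m ν zs ≤ 1 := by
      rw [div_le_one hD]; unfold Dn
      have := mul_nonneg hν.le (ev_nonneg (m := m) t)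
      simp only; linarith
    unfold aS
    simp only
    rw [mul_div_assoc, abs_le]
    have m0 : (0:ℝ) ≤ m := by positivity
    constructor <;> nlinarith
  have i1 := (mass_SS (m := m) hν ht).1.mono_set (Ioi_subset_Ioi hr.le)
  have ia : IntegrableOn (fun s => aS m ν zs * Rr m ν zs ^ 2 / s) (Ioi r) := by
    refine (i1.const_mul (mm2 / r ^ 2)).mono' ?_ ?_
    · refine ContinuousOn.aestronglyMeasurable ?_ mI
      have ca : Continuous fun s => aS m ν zs := by
        simp only [← MS_eq hν hcd ht]
        exact continuous_const.sub (continuous_iff_continuousAt.2 fun s => by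
          have := (MS_r (m := m) hν ht s).continuousAt
          have e : ∀ x, Mf (SS m ν c d) (SS m ν d (-c)) t x = mm2 * x ^ mm2 / Dn m ν (t, x) := fun x => by
            have := MS_eq (m := m) hν hcd ht x
            simp only [av, aS] at this; linarith
          simp only [e]; exact this)
      exact ContinuousOn.div (by fun_prop) continuousOn_id fun s hs => (hr.trans hs).ne'
    · refine aeI (fun s hs => ?_)
      have hs0 : 0 < s := hr.trans hs
      have hs' : r ≤ s := le_of_lt hs
      rw [Real.norm_eq_abs, abs_div, abs_mul, abs_of_pos hs0, abs_of_nonneg (sq_nonneg (Rr m ν zs)), div_le_iff₀ hs0]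
      have : 1 ≤ s ^ 2 / r ^ 2 := by rw [one_le_div (by positivity)]; gcongr
      calc _ ≤ mm2 * Rr m ν zs ^ 2 * 1 := by rw [mul_one]; gcongr; exact a_le s
        _ ≤ mm2 * Rr m ν zs ^ 2 * (s ^ 2 / r ^ 2) := by gcongr
        _ = _ := by field_simp
  have iR : IntegrableOn (fun s => 1 / 2 * Rr m ν zs ^ 2) (Ioi r) := by
    refine (i1.const_mul (1 / (2 * r))).mono' (Continuous.aestronglyMeasurable (by fun_prop)) ?_
    refine aeI (fun s hs => ?_)
    have hs' : r ≤ s := le_of_lt hs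
    rw [Real.norm_of_nonneg (by positivity)]
    calc 1 / 2 * Rr m ν zs ^ 2 = 1 / (2 * r) * (Rr m ν zs ^ 2 * r) := by field_simp
      _ ≤ _ := by gcongr
  have lim := tendsto_zero_of_hasDerivAt_of_integrableOn_Ioi (fun s hs => hd s (mem_Ici.2 (le_of_lt hs))) ia iR
  rw [integral_Ioi_of_hasDerivAt_of_tendsto' hd ia lim]; ring

lemma dR_SS (hν : 0 < ν) {t r : ℝ} (ht : t ∈ II) (hr : 0 < r) : dR (SS m ν c d) zr =
    aS m ν zr / r * SS m ν c d zr - r / (2 * t) * SS m ν d (-c) zr :=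
  (hdR isOpen_IU (SS_sm hν) ⟨ht, trivial⟩).unique (SS_r hν ht.2 hr.ne')

lemma dRR_SS (hν : 0 < ν) {t r : ℝ} (ht : t ∈ II) (hr : 0 < r) :
    dR (dR (SS m ν c d)) zr + dR (SS m ν c d) zr / r =
    SS m ν c d zr * (aS m ν zr ^ 2 / r ^ 2 - 1 / 2 * Rr m ν zr ^ 2 - r ^ 2 / (4 * t ^ 2))
     - (aS m ν zr + 1) / t * SS m ν d (-c) zr := by
  have t0 := ht.2.ne
  have ha : HasDerivAt (fun s => aS m ν zs) (-(1 / 2 * (Rr m ν zr ^ 2 * r))) r :=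
    (MS_r (m := m) hν ht.2 r).const_sub (m:ℝ)
  have h1 := ((ha.div (hasDerivAt_id r) hr.ne').mul (SS_r (m := m) (c := c) (d := d) hν ht.2 hr.ne')).sub
    (((hasDerivAt_id r).div_const (2 * t)).mul (SS_r (m := m) (c := d) (d := -c) hν ht.2 hr.ne'))
  have h2 : HasDerivAt (fun s => dR (SS m ν c d) zs) _ r := h1.congr_of_eventuallyEq (by
    filter_upwards [Ioi_mem_nhds hr] with s hs
    simp only [Pi.sub_apply, Pi.mul_apply, Pi.div_apply, id]
    exact dR_SS hν ht hs)
  rw [(hdR isOpen_IU (dR_smooth isOpen_IU (SS_sm hν)) ⟨ht, trivial⟩).unique h2, dR_SS hν ht hr]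
  simp only [Pi.div_apply, id, SS_neg]
  field_simp
  ring

lemma dat_SS (hm : 1 ≤ m) (hν : 0 < ν) (hcd : c ^ 2 + d ^ 2 = 1) : Dat m (SS m ν c d) (SS m ν d (-c)) where
  hm := hm
  ps := SS_sm hν
  qs := SS_sm hν
  p0 t _ := by simp [SS, Rr, Nat.pos_iff_ne_zero.1 hm]
  q0 t _ := by simp [SS, Rr, Nat.pos_iff_ne_zero.1 hm]
  int t ht := by simp only [rho_SS hcd]; exact (mass_SS hν ht.2).1
  mass t ht := by simp only [rho_SS hcd]; exact (mass_SS hν ht.2).2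
  eqp t ht r hr := by
    rw [(hdT isOpen_IU (SS_sm hν) ⟨ht, trivial⟩).unique (SS_t (m := m) (c := c) (d := d) hν ht.2)]
    have := dRR_SS (m := m) (c := d) (d := -c) hν ht hr
    unfold Wv
    rw [MS_eq hν hcd ht.2, AS_eq hν hcd ht.2 hr, rho_SS hcd]
    rw [SS_neg] at this
    simp only at this ⊢
    have e : -dR (dR (SS m ν d (-c))) zr - dR (SS m ν d (-c)) zr / r =
      -(dR (dR (SS m ν d (-c))) zr + dR (SS m ν d (-c)) zr / r) := by ring
    rw [e, this]; ring
  eqq t ht r hr := by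
    rw [(hdT isOpen_IU (SS_sm hν) ⟨ht, trivial⟩).unique (SS_t (m := m) (c := d) (d := -c) hν ht.2)]
    have := dRR_SS (m := m) (c := c) (d := d) hν ht hr
    unfold Wv
    rw [MS_eq hν hcd ht.2, AS_eq hν hcd ht.2 hr, rho_SS hcd, SS_neg, this]
    simp only
    ring
end
end
end CSSP

namespace CSSP
noncomputable section
open scoped ContDiff Topology

section
variable {p q f : ℝ × ℝ → ℝ} {m : ℕ} {u : ℝ → ℝ → ℂ} {T0 ν c d : ℝ}

lemma const_pos {F : ℝ → ℝ} (hF : ∀ r, 0 < r → HasDerivAt F 0 r) {r s : ℝ} (hr : 0 < r) (hs : 0 < s) : F r = F s :=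
  isOpen_Ioi.is_const_of_deriv_eq_zero isPreconnected_Ioi
    (fun x hx => (hF x hx).differentiableAt.differentiableWithinAt) (fun x hx => (hF x hx).deriv) hr hs

lemma Rr_r (hν : 0 < ν) {t r : ℝ} (ht : t < 0) (hr : r ≠ 0) :
    HasDerivAt (fun s => Rr m ν zs) (aS m ν zr / r * Rr m ν zr) r := by
  have hD := (Dn_pos (m := m) hν ht r).ne'
  have := ((pow_d m hr).const_mul ((m + 1) * √(8 * ν) * (-t) ^ (m + 1))).div (Dn_r (m := m) (ν := ν) (t := t) hr) hD
  refine this.congr_deriv ?_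
  simp only [Rr, aS]
  generalize Dn m ν zr = D at *
  field_simp

lemma Good.M_form (hg : Good p q T0) (h : Dat m p q) {t : ℝ} (ht : t ∈ Ioo T0 0) :
    ∃ ν, 0 < ν ∧ ∀ r, 0 < r → apq = aS m ν zr ∧ rpq = Rr m ν zr ^ 2 := by
  have htI := hg.mem ht
  have cr := h.cr htI
  have cM := h.cM htI
  set K : ℝ := 2 * m + 2 with hK
  have hK0 : 0 < K := by positivity
  have e1 : ∀ r, 0 < r → 1 / 2 * r ^ 2 * rpq = Mf p q t r * (K - Mf p q t r) := by
    intro r hr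
    set G : ℝ → ℝ := fun s => 1 / 2 * s ^ 2 * rho p q zs - Mf p q t s * (K - Mf p q t s) with hG
    have hd : ∀ s, 0 < s → HasDerivAt G 0 s := by
      intro s hs
      refine (h.D_r htI hs).congr_deriv ?_
      obtain ⟨g1, g2⟩ := hg.rigid h ht hs
      rw [g1, g2]; ring
    have cG : Continuous G := by fun_prop
    have l : Tendsto G (𝓝[>] 0) (𝓝 (G 0)) := cG.continuousAt.tendsto.mono_left nhdsWithin_le_nhds
    have l2 : Tendsto G (𝓝[>] 0) (𝓝 (G r)) := by
      refine tendsto_const_nhds.congr' ?_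
      filter_upwards [self_mem_nhdsWithin] with s hs
      exact const_pos hd hr hs
    have := tendsto_nhds_unique l l2
    have z : G 0 = 0 := by simp [hG, M_zero]
    rw [z] at this
    simp only [hG] at this; linarith
  have dM : ∀ r, 0 < r → HasDerivAt (Mf p q t) (Mf p q t r * (K - Mf p q t r) / r) r := by
    intro r hr
    refine (h.M_r htI r).congr_deriv ?_
    rw [← e1 r hr]; field_simp
  have hM0 := fun r (hr : 0 < r) => h.M_nonneg htI hr.le
  have hMK := fun r (hr : 0 < r) => h.M_le htI hr.le
  have pe : ∀ r : ℝ, 0 < r → HasDerivAt (fun s : ℝ => s ^ mm2) (K * r ^ mm2 / r) r := by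
    intro r hr
    have := pow_d mm2 hr.ne'
    push_cast at this; exact this
  have Mpos : ∀ r, 0 < r → 0 < Mf p q t r := by
    intro r hr
    by_contra hc
    have hz : Mf p q t r = 0 := le_antisymm (not_lt.1 hc) (hM0 r hr)
    have anti : AntitoneOn (fun s => Mf p q t s / s ^ mm2) (Ici r) := by
      refine antitoneOn_of_hasDerivWithinAt_nonpos (f' := fun s => -(Mf p q t s ^ 2 / s ^ mm2 / s)) (convex_Ici r) ?_ ?_ ?_
      · exact cM.continuousOn.div (by fun_prop) fun s hs => (pow_pos (hr.trans_le hs) _).ne'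
      · intro s hs
        rw [interior_Ici] at hs
        have hs0 : 0 < s := hr.trans hs
        have hp : (s ^ mm2) ≠ 0 := (pow_pos hs0 _).ne'
        refine (((dM s hs0).div (pe s hs0) hp).congr_deriv ?_).hasDerivWithinAt
        generalize s ^ mm2 = x at *
        field_simp; ring
      · intro s hs
        rw [interior_Ici] at hs
        have hs0 : 0 < s := hr.trans hs
        have : 0 ≤ Mf p q t s ^ 2 / s ^ mm2 / s := by positivity
        linarith
    have hz2 : ∀ s, r ≤ s → Mf p q t s = 0 := by
      intro s hs
      have hs0 := hr.trans_le hs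
      have := anti (mem_Ici.2 le_rfl) hs hs
      simp only [hz, zero_div] at this
      have hp : 0 < s ^ mm2 := pow_pos hs0 _
      rw [div_le_iff₀ hp, zero_mul] at this
      exact le_antisymm this (hM0 s hs0)
    have l := h.M_lim htI
    have l2 : Tendsto (fun s => Mf p q t s) atTop (𝓝 0) :=
      tendsto_const_nhds.congr' (by filter_upwards [eventually_ge_atTop r] with s hs; exact (hz2 s hs).symm)
    have := tendsto_nhds_unique l l2
    linarith
  have Lc : ∀ r, 0 < r → HasDerivAt (fun s => s ^ mm2 * (K - Mf p q t s) / Mf p q t s) 0 r := by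
    intro r hr
    have := (((pe r hr).mul ((dM r hr).const_sub K)).div (dM r hr) (Mpos r hr).ne')
    refine this.congr_deriv ?_
    have := (Mpos r hr).ne'
    simp only [Pi.mul_apply]
    generalize Mf p q t r = M at *
    generalize r ^ mm2 = x at *
    field_simp; ring
  set ℓ : ℝ := 1 ^ mm2 * (K - Mf p q t 1) / Mf p q t 1 with hℓ
  have hL : ∀ r, 0 < r → r ^ mm2 * (K - Mf p q t r) = ℓ * Mf p q t r := by
    intro r hr
    have := const_pos Lc hr one_pos
    rw [div_eq_iff (Mpos r hr).ne'] at this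
    rw [this]
  have ℓ0 : 0 ≤ ℓ := div_nonneg (mul_nonneg (by norm_num) (by linarith [hMK 1 one_pos])) (hM0 1 one_pos)
  have ℓpos : 0 < ℓ := by
    rcases ℓ0.eq_or_lt with h0 | h0
    · exfalso
      have e : ∀ r, 0 < r → Mf p q t r = K := by
        intro r hr
        have := hL r hr
        rw [← h0, zero_mul] at this
        have := (mul_eq_zero.1 this).resolve_left (pow_pos hr _).ne'
        linarith
      have l : Tendsto (Mf p q t) (𝓝[>] 0) (𝓝 (Mf p q t 0)) := cM.continuousAt.tendsto.mono_left nhdsWithin_le_nhds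
      have l2 : Tendsto (Mf p q t) (𝓝[>] 0) (𝓝 K) :=
        tendsto_const_nhds.congr' (by filter_upwards [self_mem_nhdsWithin] with s hs; exact (e s hs).symm)
      have := tendsto_nhds_unique l l2
      rw [M_zero] at this; linarith
    · exact h0
  have tp : 0 < t ^ mm2 := ev_pos ht.2.ne
  have νpos : 0 < ℓ / t ^ mm2 := by positivity
  refine ⟨ℓ / t ^ mm2, νpos, fun r hr => ?_⟩
  have hp : 0 < r ^ mm2 := pow_pos hr _
  have hMf : Mf p q t r = K * r ^ mm2 / (ℓ + r ^ mm2) := by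
    rw [eq_div_iff (by positivity)]; linarith [hL r hr]
  have hD : Dn m (ℓ / t ^ mm2) zr = ℓ + r ^ mm2 := by
    unfold Dn; simp only; field_simp
  constructor
  · unfold av aS; simp only; rw [hMf, hD]
  · rw [Rr_sq νpos, hD]
    have := e1 r hr
    rw [hMf] at this
    have er : r ^ (2 * m) * r ^ 2 = r ^ mm2 := by rw [← pow_add]
    rw [← er] at this hp ⊢
    generalize r ^ (2 * m) = y at *
    generalize t ^ mm2 = T at *
    have hy : 0 < ℓ + y * r ^ 2 := by positivity
    have e : K = 2 * m + 2 := hK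
    rw [e] at this
    have h2 : rpq = 2 / r ^ 2 * (1 / 2 * r ^ 2 * rpq) := by field_simp
    rw [h2, this]
    generalize hx : ℓ + y * r ^ 2 = x at *
    have e3 : ℓ = x - y * r ^ 2 := by linarith
    rw [e3]
    have tz := tp.ne'
    have xz := hy.ne'
    field_simp

lemma Good.form (hg : Good p q T0) (h : Dat m p q) {t : ℝ} (ht : t ∈ Ioo T0 0) :
    ∃ ν c d, 0 < ν ∧ c ^ 2 + d ^ 2 = 1 ∧ ∀ r, 0 < r → p zr = SS m ν c d zr ∧ q zr = SS m ν d (-c) zr := by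
  have htI := hg.mem ht
  have t0 := ht.2.ne
  obtain ⟨ν, hν, hf⟩ := hg.M_form h ht
  have Rpos : ∀ r, 0 < r → 0 < Rr m ν zr := by
    intro r hr
    have := Dn_pos (m := m) hν ht.2 r
    have : 0 < -t := by linarith [ht.2]
    unfold Rr; positivity
  set C : ℝ → ℝ := fun r => Real.cos (r ^ 2 / (4 * t)) with hC
  set S : ℝ → ℝ := fun r => Real.sin (r ^ 2 / (4 * t)) with hS
  have dφ : ∀ r : ℝ, HasDerivAt (fun s : ℝ => s ^ 2 / (4 * t)) (2 * r / (4 * t)) r := fun r => by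
    refine (((hasDerivAt_id r).pow 2).div_const (4 * t)).congr_deriv ?_
    simp
  have dp : ∀ r, 0 < r → HasDerivAt (fun s => p zs) (aS m ν zr / r * p zr - r / (2 * t) * q zr) r := by
    intro r hr
    refine (hdR isOpen_IU h.ps ⟨htI, trivial⟩).congr_deriv ?_
    have := (hg.rigid h ht hr).1
    unfold gv at this
    rw [(hf r hr).1] at this
    simp only at this
    linear_combination this
  have dq : ∀ r, 0 < r → HasDerivAt (fun s => q zs) (aS m ν zr / r * q zr + r / (2 * t) * p zr) r := by
    intro r hr
    refine (hdR isOpen_IU h.qs ⟨htI, trivial⟩).congr_deriv ?_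
    have := (hg.rigid h ht hr).2
    unfold gv at this
    rw [(hf r hr).1] at this
    simp only at this
    linear_combination this
  have h1 : ∀ r, 0 < r → HasDerivAt (fun s => (p zs * C s + q zs * S s) / Rr m ν zs) 0 r := by
    intro r hr
    have R0 := (Rpos r hr).ne'
    refine ((((dp r hr).mul (dφ r).cos).add ((dq r hr).mul (dφ r).sin)).div (Rr_r hν ht.2 hr.ne') R0).congr_deriv ?_
    simp only [Pi.add_apply, Pi.mul_apply]
    field_simp; ring
  have h2 : ∀ r, 0 < r → HasDerivAt (fun s => (q zs * C s - p zs * S s) / Rr m ν zs) 0 r := by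
    intro r hr
    have R0 := (Rpos r hr).ne'
    refine ((((dq r hr).mul (dφ r).cos).sub ((dp r hr).mul (dφ r).sin)).div (Rr_r hν ht.2 hr.ne') R0).congr_deriv ?_
    simp only [Pi.sub_apply, Pi.mul_apply]
    field_simp; ring
  set c := (p (t, 1) * C 1 + q (t, 1) * S 1) / Rr m ν (t, 1) with hc
  set d := (q (t, 1) * C 1 - p (t, 1) * S 1) / Rr m ν (t, 1) with hd
  have cs : ∀ r, C r ^ 2 + S r ^ 2 = 1 := fun r => Real.cos_sq_add_sin_sq _
  have k1 : ∀ r, 0 < r → p zr * C r + q zr * S r = c * Rr m ν zr := fun r hr => by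
    have := const_pos h1 hr one_pos
    rwa [div_eq_iff (Rpos r hr).ne'] at this
  have k2 : ∀ r, 0 < r → q zr * C r - p zr * S r = d * Rr m ν zr := fun r hr => by
    have := const_pos h2 hr one_pos
    rwa [div_eq_iff (Rpos r hr).ne'] at this
  refine ⟨ν, c, d, hν, ?_, fun r hr => ⟨?_, ?_⟩⟩
  · have a1 := k1 1 one_pos
    have a2 := k2 1 one_pos
    have a3 := (hf 1 one_pos).2
    unfold rho at a3
    have a4 := cs 1
    have R0 : Rr m ν (t, 1) ^ 2 ≠ 0 := pow_ne_zero _ (Rpos 1 one_pos).ne'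
    refine mul_right_cancel₀ R0 ?_
    calc (c ^ 2 + d ^ 2) * Rr m ν (t, 1) ^ 2 = (c * Rr m ν (t, 1)) ^ 2 + (d * Rr m ν (t, 1)) ^ 2 := by ring
      _ = (p (t, 1) ^ 2 + q (t, 1) ^ 2) * (C 1 ^ 2 + S 1 ^ 2) := by rw [← a1, ← a2]; ring
      _ = _ := by rw [a4, a3]; ring
  · show _ = Rr m ν zr * (c * C r - d * S r)
    linear_combination -(p zr) * cs r + C r * k1 r hr - S r * k2 r hr
  · show _ = Rr m ν zr * (d * C r - (-c) * S r)
    linear_combination -(q zr) * cs r + S r * k1 r hr + C r * k2 r hr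
end
end
end CSSP

namespace CSSP
noncomputable section
open scoped ContDiff Topology

def w2 (p q P Q : ℝ × ℝ → ℝ) (z : ℝ × ℝ) : ℝ := (p z - P z) ^ 2 + (q z - Q z) ^ 2
def Yc (p q P Q : ℝ × ℝ → ℝ) (z : ℝ × ℝ) : ℝ := q z * P z - p z * Q z

structure Bd (p q P Q : ℝ × ℝ → ℝ) (t B : ℝ) : Prop where
  ht : t ∈ II
  hB : 1 ≤ B
  nu : ∀ r ∈ Icc (0:ℝ) 1, rpq ≤ B * r ^ 2
  nS : ∀ r ∈ Icc (0:ℝ) 1, rPQ ≤ B * r ^ 2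
  tail : ∀ r, 0 < r → r ^ 2 * rPQ ≤ B
  i3 : IntegrableOn (fun r => r ^ 3 * rPQ) (Ioi 0)
  b3 : ∫ r in Ioi (0:ℝ), r ^ 3 * rPQ ≤ B
  iY : IntegrableOn (fun r => YY P Q zr * r) (Ioi 0)
  bY : ∫ r in Ioi (0:ℝ), YY P Q zr * r ≤ B

section
variable {p q P Q : ℝ × ℝ → ℝ} {m : ℕ} {t B s : ℝ}

lemma w2_nonneg (z : ℝ × ℝ) : 0 ≤ w2 p q P Q z := by unfold w2; positivity

lemma Dat.M4 (h : Dat m p q) (ht : t ∈ II) (hB : 1 ≤ B)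
    (nu : ∀ r ∈ Icc (0:ℝ) 1, rpq ≤ B * r ^ 2) {r : ℝ} (hr : 0 < r) :
    Mf p q t r ≤ (B + 2 * m + 2) * r ^ 4 := by
  by_cases h1 : r ≤ 1
  · have cr := h.cr ht
    have : ∫ x in (0:ℝ)..r, rho p q (t, x) * x ≤ ∫ x in (0:ℝ)..r, B * r ^ 3 := by
      refine intervalIntegral.integral_mono_on hr.le (Continuous.intervalIntegrable (by fun_prop) _ _)
        (Continuous.intervalIntegrable (by fun_prop) _ _) fun x hx => ?_
      have a := nu x ⟨hx.1, hx.2.trans h1⟩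
      have b : x ^ 2 * x ≤ r ^ 2 * r := mul_le_mul (pow_le_pow_left₀ hx.1 hx.2 2) hx.2 hx.1 (by positivity)
      have c := mul_le_mul_of_nonneg_right a hx.1
      have d := mul_le_mul_of_nonneg_left b (by linarith : 0 ≤ B)
      linarith
    rw [intervalIntegral.integral_const, smul_eq_mul] at this
    unfold Mf
    have e : (r - 0) * (B * r ^ 3) = B * r ^ 4 := by ring
    have : 0 ≤ B * r ^ 4 := by positivity
    have : 0 ≤ (2 * (m:ℝ) + 2) * r ^ 4 := by positivity
    linarith
  · push Not at h1
    have a := h.M_le ht hr.le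
    have b : (1:ℝ) ≤ r ^ 4 := one_le_pow₀ h1.le
    have : (0:ℝ) ≤ B + 2 * m + 2 := by positivity
    have := mul_le_mul_of_nonneg_left b this
    linarith

/-- weighted bound of the density difference -/
lemma drho_le {l : ℝ} (hl : 0 < l) (z : ℝ × ℝ) :
    |rho p q z - rho P Q z| ≤ l / 2 * w2 p q P Q z + (rho p q z + rho P Q z) / l := by
  unfold rho w2
  generalize p z = a; generalize q z = b; generalize P z = c; generalize Q z = d
  have k : ∀ x y v w : ℝ, |x * v + y * w| ≤ l / 2 * (x ^ 2 + y ^ 2) + (v ^ 2 + w ^ 2) / (2 * l) := by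
    intro x y v w
    rw [abs_le]
    constructor
    · have : l / 2 * (x ^ 2 + y ^ 2) + (v ^ 2 + w ^ 2) / (2 * l) + (x * v + y * w)
        = ((l * x + v) ^ 2 + (l * y + w) ^ 2) / (2 * l) := by field_simp; ring
      have : 0 ≤ ((l * x + v) ^ 2 + (l * y + w) ^ 2) / (2 * l) := by positivity
      linarith
    · have : l / 2 * (x ^ 2 + y ^ 2) + (v ^ 2 + w ^ 2) / (2 * l) - (x * v + y * w)
        = ((l * x - v) ^ 2 + (l * y - w) ^ 2) / (2 * l) := by field_simp; ring
      have : 0 ≤ ((l * x - v) ^ 2 + (l * y - w) ^ 2) / (2 * l) := by positivity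
      linarith
  have e : a ^ 2 + b ^ 2 - (c ^ 2 + d ^ 2) = (a - c) * (a + c) + (b - d) * (b + d) := by ring
  rw [e]
  refine (k _ _ _ _).trans ?_
  have : (a ^ 2 + b ^ 2 + (c ^ 2 + d ^ 2)) / l - ((a + c) ^ 2 + (b + d) ^ 2) / (2 * l)
    = ((a - c) ^ 2 + (b - d) ^ 2) / (2 * l) := by field_simp; ring
  have : 0 ≤ ((a - c) ^ 2 + (b - d) ^ 2) / (2 * l) := by positivity
  linarith

lemma Yc_le {x : ℝ} (hx : 0 ≤ x) (z : ℝ × ℝ) :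
    2 * (x * |Yc p q P Q z|) ≤ w2 p q P Q z + x ^ 2 * rho P Q z := by
  have e : Yc p q P Q z = (q z - Q z) * P z - (p z - P z) * Q z := by unfold Yc; ring
  rw [e]; unfold w2 rho
  generalize p z - P z = a; generalize q z - Q z = b; generalize P z = c; generalize Q z = d
  rcases abs_cases (b * c - a * d) with ⟨h, _⟩ | ⟨h, _⟩ <;> rw [h]
  · nlinarith [sq_nonneg (b - x * c), sq_nonneg (a + x * d)]
  · nlinarith [sq_nonneg (b + x * c), sq_nonneg (a - x * d)]

lemma cw (h : Dat m p q) (h' : Dat m P Q) (ht : t ∈ II) :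
    Continuous (fun r => w2 p q P Q zr) := by
  have a := h.ps.continuousOn
  have b := h.qs.continuousOn
  have c := h'.ps.continuousOn
  have d := h'.qs.continuousOn
  exact slice_univ (F := w2 p q P Q) (by unfold w2; fun_prop) ht

lemma iw (h : Dat m p q) (h' : Dat m P Q) (ht : t ∈ II) :
    IntegrableOn (fun r => w2 p q P Q zr * r) (Ioi 0) := by
  refine (((h.int t ht).add (h'.int t ht)).const_mul 2).mono' ?_ ?_
  · have := cw h h' ht
    exact (Continuous.continuousOn (by fun_prop)).aestronglyMeasurable mI
  · refine aeI (fun r hr => ?_)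
    have hr : 0 < r := hr
    rw [Real.norm_eq_abs, abs_of_nonneg (mul_nonneg (w2_nonneg _) hr.le)]
    have : w2 p q P Q zr ≤ 2 * (rpq + rPQ) := by
      unfold w2 rho; nlinarith [sq_nonneg (p zr + P zr), sq_nonneg (q zr + Q zr)]
    simp only [Pi.add_apply]
    have := mul_le_mul_of_nonneg_right this hr.le
    linarith

lemma da_le (h : Dat m p q) (h' : Dat m P Q) (hb : Bd p q P Q t B) (hs : 0 < s)
    (hy : ∫ r in Ioi (0:ℝ), w2 p q P Q zr * r ≤ s ^ 2) {r : ℝ} (hr : 0 < r) :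
    |apq - av m P Q zr| ≤ (2 * B + 4 * m + 5) * s * r ^ 2 := by
  have ht := hb.ht
  have c1 := h.cr ht
  have c2 := h'.cr ht
  have c3 := cw h h' ht
  have e : apq - av m P Q zr = -(1 / 2 * ∫ x in (0:ℝ)..r, (rho p q (t, x) - rho P Q (t, x)) * x) := by
    unfold av Mf; simp only
    have : ∀ x, (rho p q (t, x) - rho P Q (t, x)) * x = rho p q (t, x) * x - rho P Q (t, x) * x := fun x => by ring
    simp_rw [this]
    rw [intervalIntegral.integral_sub (Continuous.intervalIntegrable (by fun_prop) _ _)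
      (Continuous.intervalIntegrable (by fun_prop) _ _)]
    ring
  have k : |∫ x in (0:ℝ)..r, (rho p q (t, x) - rho P Q (t, x)) * x|
      ≤ ∫ x in (0:ℝ)..r, (r ^ 2 / s / 2 * (w2 p q P Q (t, x) * x)
        + s / r ^ 2 * (rho p q (t, x) * x + rho P Q (t, x) * x)) := by
    rw [← Real.norm_eq_abs]
    refine intervalIntegral.norm_integral_le_of_norm_le hr.le (Eventually.of_forall fun x hx => ?_)
      (Continuous.intervalIntegrable (by fun_prop) _ _)
    rw [Real.norm_eq_abs, abs_mul, abs_of_pos hx.1]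
    have := mul_le_mul_of_nonneg_right
      (drho_le (p := p) (q := q) (P := P) (Q := Q) (l := r ^ 2 / s) (by positivity) (t, x)) hx.1.le
    refine this.trans (le_of_eq ?_)
    field_simp
  rw [intervalIntegral.integral_add (Continuous.intervalIntegrable (by fun_prop) _ _)
      (Continuous.intervalIntegrable (by fun_prop) _ _), intervalIntegral.integral_const_mul,
      intervalIntegral.integral_const_mul, intervalIntegral.integral_add (Continuous.intervalIntegrable (by fun_prop) _ _)
      (Continuous.intervalIntegrable (by fun_prop) _ _)] at k
  have k1 : ∫ x in (0:ℝ)..r, w2 p q P Q (t, x) * x ≤ s ^ 2 := by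
    refine le_trans ?_ hy
    rw [intervalIntegral.integral_of_le hr.le]
    refine setIntegral_mono_set (iw h h' ht) ?_ (LE.le.eventuallyLE Ioc_subset_Ioi_self)
    exact aeI (fun x hx =>
      mul_nonneg (w2_nonneg _) (le_of_lt hx))
  have k2 := h.M4 ht hb.hB hb.nu hr
  have k3 := h'.M4 ht hb.hB hb.nS hr
  unfold Mf at k2 k3
  have k4 := mul_le_mul_of_nonneg_left k1 (by positivity : 0 ≤ r ^ 2 / s / 2)
  have k5 := mul_le_mul_of_nonneg_left (add_le_add k2 k3) (by positivity : 0 ≤ 2 * (s / r ^ 2))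
  rw [e, abs_neg, abs_mul, abs_of_pos (by norm_num : (0:ℝ) < 1 / 2)]
  have e4 : r ^ 2 / s / 2 * s ^ 2 = r ^ 2 * s / 2 := by field_simp
  have e5 : 2 * (s / r ^ 2) * ((B + 2 * m + 2) * r ^ 4 + (B + 2 * m + 2) * r ^ 4)
    = 4 * (B + 2 * m + 2) * s * r ^ 2 := by field_simp; ring
  have : 0 ≤ s * r ^ 2 := by positivity
  nlinarith

lemma maj2 (hC : ∀ r ∈ Icc (0:ℝ) 1, rpq ≤ B * r ^ 2) {x : ℝ} (hx : 0 < x) :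
    rho p q (t, x) / x ^ 2 ≤ (Ioc (0:ℝ) 1).indicator (fun _ => B) x + rho p q (t, x) * x := by
  have h0 := rho_nonneg (p := p) (q := q) (t, x)
  by_cases hs1 : x ≤ 1
  · rw [indicator_of_mem (show x ∈ Ioc (0:ℝ) 1 from ⟨hx, hs1⟩)]
    have := hC x ⟨hx.le, hs1⟩
    have h2 : rho p q (t, x) / x ^ 2 ≤ B := by
      rwa [div_le_iff₀ (by positivity)]
    have := mul_nonneg h0 hx.le
    linarith
  · rw [indicator_of_notMem (by simp [hs1])]
    push Not at hs1
    rw [zero_add, div_le_iff₀ (by positivity), mul_assoc]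
    refine le_mul_of_one_le_right h0 ?_
    rw [← pow_succ']; exact one_le_pow₀ hs1.le

end

end

end CSSP

namespace CSSP
noncomputable section
open scoped ContDiff Topology

def LC (m : ℕ) (B : ℝ) : ℝ := (2 * B + 4 * m + 5) * (4 * (m + 1)) + mm2 * (2 * B + 8 * (m + 1) + 1)

section
variable {p q P Q : ℝ × ℝ → ℝ} {m : ℕ} {t B s : ℝ}

lemma dA_le (h : Dat m p q) (h' : Dat m P Q) (hb : Bd p q P Q t B) (hs : 0 < s)
    (hy : ∫ r in Ioi (0:ℝ), w2 p q P Q zr * r ≤ s ^ 2) {r : ℝ} (hr : 0 < r) :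
    |Av m p q zr - Av m P Q zr| ≤ LC m B * s * (1 + 1 / r) := by
  have ht := hb.ht
  have hB := hb.hB
  set K := 2 * B + 4 * m + 5 with hK
  have K0 : 0 < K := by positivity
  have hsub : Ioi r ⊆ Ioi 0 := Ioi_subset_Ioi hr.le
  have e : Av m p q zr - Av m P Q zr = -∫ x in Ioi r, (av m p q (t, x) * rho p q (t, x) / x
      - av m P Q (t, x) * rho P Q (t, x) / x) := by
    rw [integral_sub ((h.arho_int ht).mono_set hsub) ((h'.arho_int ht).mono_set hsub)]
    unfold Av; ring
  set F1 : ℝ → ℝ := fun x => K * s * (rho p q (t, x) * x) with hF1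
  set F2 : ℝ → ℝ := fun x => mm2 * (1 / (2 * s * r)) * (w2 p q P Q (t, x) * x) with hF2
  set F3 : ℝ → ℝ := fun x => mm2 * s * ((Ioc (0:ℝ) 1).indicator (fun _ => B) x + rho p q (t, x) * x) with hF3
  set F4 : ℝ → ℝ := fun x => mm2 * s * ((Ioc (0:ℝ) 1).indicator (fun _ => B) x + rho P Q (t, x) * x) with hF4
  have i1 : IntegrableOn F1 (Ioi 0) := (h.int t ht).const_mul _
  have i2 : IntegrableOn F2 (Ioi 0) := (iw h h' ht).const_mul _
  have i3 : IntegrableOn F3 (Ioi 0) := (maj_int h ht B).1.const_mul _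
  have i4 : IntegrableOn F4 (Ioi 0) := (maj_int h' ht B).1.const_mul _
  have i12 : IntegrableOn (fun x => F1 x + F2 x) (Ioi 0) := i1.add i2
  have i34 : IntegrableOn (fun x => F3 x + F4 x) (Ioi 0) := i3.add i4
  have ind : ∀ x, 0 ≤ (Ioc (0:ℝ) 1).indicator (fun _ => B) x :=
    indicator_nonneg (fun _ _ => by linarith)
  have pw : ∀ x, r < x → |av m p q (t, x) * rho p q (t, x) / x - av m P Q (t, x) * rho P Q (t, x) / x|
      ≤ (F1 x + F2 x) + (F3 x + F4 x) := by
    intro x hrx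
    have hx : 0 < x := hr.trans hrx
    have a1 := da_le h h' hb hs hy hx
    have a2 := h'.a_abs ht hx.le
    have a3 := drho_le (p := p) (q := q) (P := P) (Q := Q) (l := x / s) (by positivity) (t, x)
    have e1 : av m p q (t, x) * rho p q (t, x) / x - av m P Q (t, x) * rho P Q (t, x) / x
      = (av m p q (t, x) - av m P Q (t, x)) * (rho p q (t, x) / x)
        + av m P Q (t, x) * ((rho p q (t, x) - rho P Q (t, x)) / x) := by field_simp; ring
    rw [e1]
    have r0 := rho_nonneg (p := p) (q := q) (t, x)
    have b1 : |(av m p q (t, x) - av m P Q (t, x)) * (rho p q (t, x) / x)| ≤ F1 x := by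
      rw [abs_mul, abs_of_nonneg (div_nonneg r0 hx.le)]
      refine (mul_le_mul_of_nonneg_right a1 (div_nonneg r0 hx.le)).trans (le_of_eq ?_)
      rw [hF1]; field_simp; rw [hK]; ring
    have b2 : |av m P Q (t, x) * ((rho p q (t, x) - rho P Q (t, x)) / x)| ≤ F2 x + (F3 x + F4 x) := by
      rw [abs_mul, abs_div, abs_of_pos hx]
      have c1 : |rho p q (t, x) - rho P Q (t, x)| / x ≤ 1 / (2 * s * r) * (w2 p q P Q (t, x) * x)
          + s * (rho p q (t, x) / x ^ 2 + rho P Q (t, x) / x ^ 2) := by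
        have d1 : |rho p q (t, x) - rho P Q (t, x)| / x ≤ 1 / (2 * s) * w2 p q P Q (t, x)
          + s * (rho p q (t, x) / x ^ 2 + rho P Q (t, x) / x ^ 2) := by
          rw [div_le_iff₀ hx]; refine a3.trans (le_of_eq ?_); field_simp
        have d2 : 1 / (2 * s * r) * (w2 p q P Q (t, x) * x) - 1 / (2 * s) * w2 p q P Q (t, x)
          = 1 / (2 * s * r) * (w2 p q P Q (t, x) * (x - r)) := by field_simp
        have : 0 ≤ 1 / (2 * s * r) * (w2 p q P Q (t, x) * (x - r)) :=
          mul_nonneg (by positivity) (mul_nonneg (w2_nonneg _) (by linarith))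
        linarith
      have c2 := maj2 hb.nu hx
      have c3 := maj2 hb.nS hx
      have c4 := mul_le_mul_of_nonneg_left (add_le_add c2 c3) hs.le
      have c5 := mul_le_mul a2 (c1.trans (add_le_add_right c4 _)) (by positivity) (by positivity)
      refine c5.trans (le_of_eq ?_)
      rw [hF2, hF3, hF4]; ring
    refine (abs_add_le _ _).trans ?_
    linarith
  have nn : ∀ x, 0 < x → 0 ≤ (F1 x + F2 x) + (F3 x + F4 x) := by
    intro x hx
    have r0 := rho_nonneg (p := p) (q := q) (t, x)
    have r1 := rho_nonneg (p := P) (q := Q) (t, x)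
    have r2 := w2_nonneg (p := p) (q := q) (P := P) (Q := Q) (t, x)
    have := ind x
    simp only [hF1, hF2, hF3, hF4]
    positivity
  rw [e, abs_neg, ← Real.norm_eq_abs]
  have k : ‖∫ x in Ioi r, (av m p q (t, x) * rho p q (t, x) / x
      - av m P Q (t, x) * rho P Q (t, x) / x)‖ ≤ ∫ x in Ioi (0:ℝ), ((F1 x + F2 x) + (F3 x + F4 x)) := by
    refine (norm_integral_le_of_norm_le ((i12.add i34).mono_set hsub) ?_).trans
      (setIntegral_mono_set (i12.add i34) ?_ (LE.le.eventuallyLE hsub))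
    · exact aeI (fun x hx => pw x hx)
    · exact aeI (fun x hx => nn x hx)
  refine k.trans ?_
  rw [integral_add i12 i34, integral_add i1 i2, integral_add i3 i4]
  simp only [hF1, hF2, hF3, hF4]
  rw [integral_const_mul, integral_const_mul, integral_const_mul, integral_const_mul, (maj_int h ht B).2,
    (maj_int h' ht B).2, h.mass t ht]
  have d := mul_le_mul_of_nonneg_left hy (by positivity : 0 ≤ (2 * (m:ℝ) + 2) * (1 / (2 * s * r)))
  have e2 : (2 * (m:ℝ) + 2) * (1 / (2 * s * r)) * s ^ 2 = (m + 1) * s * (1 / r) := by field_simp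
  have e3 : LC m B * s * (1 + 1 / r) - (K * s * (4 * (m + 1)) + (m + 1) * s * (1 / r) +
    (mm2 * s * (B + 4 * (m + 1)) + mm2 * s * (B + 4 * (m + 1)))) =
     (K * (4 * (m + 1)) + mm2 * (2 * B + 8 * (m + 1))) * s * (1 / r) + (m + 1) * s * (1 / r)
      + mm2 * s := by
    unfold LC; rw [← hK]; ring
  have : 0 ≤ (K * (4 * (m + 1)) + mm2 * (2 * B + 8 * (m + 1))) * s * (1 / r) + (m + 1) * s * (1 / r)
      + mm2 * s := by positivity
  linarith

lemma LC_pos (hB : 1 ≤ B) : 0 < LC m B := by unfold LC; positivity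

lemma dW_le (h : Dat m p q) (h' : Dat m P Q) (hb : Bd p q P Q t B) (hs : 0 < s)
    (hy : ∫ r in Ioi (0:ℝ), w2 p q P Q zr * r ≤ s ^ 2) {r κ : ℝ} (hr : 0 < r)
    (hκ : |(rpq - rPQ) * Yc p q P Q zr| ≤ κ * w2 p q P Q zr) :
    |(Wv m p q zr - Wv m P Q zr) * Yc p q P Q zr * r| ≤
      (LC m B + κ) * (w2 p q P Q zr * r) + 2 * LC m B * s ^ 2 * (rPQ * r + rPQ / r) := by
  have a1 := da_le h h' hb hs hy hr
  have a2 := dA_le h h' hb hs hy hr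
  have b1 := h.a_abs hb.ht hr.le
  have b2 := h'.a_abs hb.ht hr.le
  have L0 := LC_pos (m := m) hb.hB
  have hK : 0 < 2 * B + 4 * (m:ℝ) + 5 := by have := hb.hB; positivity
  have LK : (2 * B + 4 * m + 5) * (4 * (m + 1)) ≤ LC m B := by
    unfold LC; have := hb.hB
    have : 0 ≤ (2 * (m:ℝ) + 2) * (2 * B + 8 * (m + 1) + 1) := by positivity
    linarith
  set L := LC m B
  set D := (apq ^ 2 - av m P Q zr ^ 2) / r ^ 2 + (Av m p q zr - Av m P Q zr) with hD
  have hDle : |D| ≤ 2 * L * (s * (1 + 1 / r)) := by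
    have c1 : |(apq ^ 2 - av m P Q zr ^ 2) / r ^ 2| ≤ L * s := by
      rw [sq_sub_sq, abs_div, abs_mul, abs_of_pos (by positivity : 0 < r ^ 2), div_le_iff₀ (by positivity)]
      have : |apq + av m P Q zr| ≤ 4 * (m + 1) := (abs_add_le _ _).trans (by linarith)
      have := mul_le_mul this a1 (abs_nonneg _) (by positivity)
      have := mul_le_mul_of_nonneg_right LK (by positivity : 0 ≤ s * r ^ 2)
      linarith
    have : 0 ≤ L * s * (1 / r) := by positivity
    refine (abs_add_le _ _).trans ?_
    linarith
  have y1 := Yc_le (p := p) (q := q) (P := P) (Q := Q) (x := s * (1 + 1 / r)) (by positivity) zr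
  have e : (Wv m p q zr - Wv m P Q zr) * Yc p q P Q zr * r = (D * Yc p q P Q zr
    - (rpq - rPQ) * Yc p q P Q zr) * r := by
    rw [hD]; unfold Wv; simp only; field_simp; ring
  rw [e, abs_mul, abs_of_pos hr]
  have r1 := rho_nonneg (p := P) (q := Q) zr
  have f1 : |D * Yc p q P Q zr - (rpq - rPQ) * Yc p q P Q zr|
      ≤ L * (w2 p q P Q zr + (s * (1 + 1 / r)) ^ 2 * rPQ) + κ * w2 p q P Q zr := by
    refine (abs_sub _ _).trans (add_le_add ?_ hκ)
    rw [abs_mul]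
    have := mul_le_mul_of_nonneg_right hDle (abs_nonneg (Yc p q P Q zr))
    have := mul_le_mul_of_nonneg_left y1 L0.le
    linarith
  refine (mul_le_mul_of_nonneg_right f1 hr.le).trans ?_
  have g : 2 * L * s ^ 2 * (rPQ * r + rPQ / r) - L * ((s * (1 + 1 / r)) ^ 2 * rPQ) * r
    = L * s ^ 2 * rPQ * ((1 - r) ^ 2 / r) := by field_simp; ring
  have : 0 ≤ L * s ^ 2 * rPQ * ((1 - r) ^ 2 / r) := by positivity
  linarith

end

end

end CSSP

namespace CSSP
noncomputable section
open scoped ContDiff Topology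

def Xc (p q P Q : ℝ × ℝ → ℝ) (z : ℝ × ℝ) : ℝ := p z * P z + q z * Q z
def XT (p q P Q : ℝ × ℝ → ℝ) (z : ℝ × ℝ) : ℝ :=
  dT p z * P z + p z * dT P z + (dT q z * Q z + q z * dT Q z)
def Fc (p q P Q : ℝ × ℝ → ℝ) (z : ℝ × ℝ) : ℝ := dR p z * Q z - dR q z * P z + q z * dR P z - p z * dR Q z
def Fr (p q P Q : ℝ × ℝ → ℝ) (z : ℝ × ℝ) : ℝ :=
  dR (dR p) z * Q z - dR (dR q) z * P z + q z * dR (dR P) z - p z * dR (dR Q) z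
def Gc (q' p' P Q : ℝ × ℝ → ℝ) (z : ℝ × ℝ) : ℝ := q' z * dR P z - p' z * dR Q z
def Zn (p q P Q : ℝ × ℝ → ℝ) (n t : ℝ) : ℝ := ∫ r in (0:ℝ)..n, rn ^ 2 * Xc p q P Q zr * r
def Dd (p q P Q : ℝ × ℝ → ℝ) (n : ℝ) (z : ℝ × ℝ) : ℝ :=
  (1 - z.2 / n) ^ 2 * (Fc p q P Q z + z.2 * Fr p q P Q z) + 2 * (-2 / n * (1 - z.2 / n)) * z.2 * Gc q p P Q z
    + -2 / n * (1 - 2 * z.2 / n) * Yc p q P Q z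

section
variable {p q P Q : ℝ × ℝ → ℝ} {m : ℕ} {t B s : ℝ}

lemma conts (h : Dat m p q) (h' : Dat m P Q) (n : ℝ) :
    ContinuousOn (Xc p q P Q) (II ×ˢ univ) ∧ ContinuousOn (XT p q P Q) (II ×ˢ univ) ∧
    ContinuousOn (Dd p q P Q n) (II ×ˢ univ) := by
  obtain ⟨c1, c2, c3, c4, c5, c6, c7, c8, -⟩ := h.gen.cont
  obtain ⟨d1, d2, d3, d4, d5, d6, d7, d8, -⟩ := h'.gen.cont
  refine ⟨by unfold Xc; fun_prop, by unfold XT; fun_prop, ?_⟩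
  unfold Dd Fc Fr Gc Yc; fun_prop

lemma Zn_deriv (h : Dat m p q) (h' : Dat m P Q) {n : ℝ} (hn : 0 < n) (ht : t ∈ II) :
    HasDerivAt (Zn p q P Q n) (∫ r in (0:ℝ)..n, rn ^ 2 * XT p q P Q zr * r) t := by
  obtain ⟨c1, c2, -⟩ := conts h h' n
  refine param_deriv (F := fun s r => rn ^ 2 * Xc p q P Q (s, r) * r)
    (F' := fun s r => rn ^ 2 * XT p q P Q (s, r) * r) isOpen_Ioo hn.le ?_ ?_ ?_ ht
  · intro s hs
    have := slice_univ c1 hs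
    exact Continuous.continuousOn (by fun_prop)
  · refine ContinuousOn.mono (s := II ×ˢ univ) ?_ (prod_mono le_rfl (subset_univ _))
    show ContinuousOn (fun z : ℝ × ℝ => (1 - z.2 / n) ^ 2 * XT p q P Q z * z.2) _
    fun_prop
  · intro s hs r _
    have hz : (s, r) ∈ II ×ˢ (univ : Set ℝ) := ⟨hs, trivial⟩
    have a := ((hdT isOpen_IU h.ps hz).mul (hdT isOpen_IU h'.ps hz)).add
      ((hdT isOpen_IU h.qs hz).mul (hdT isOpen_IU h'.qs hz))
    exact (a.const_mul (rn ^ 2)).mul_const r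

lemma Dd_zero (h : Dat m p q) (h' : Dat m P Q) {n : ℝ} (hn : 0 < n) (ht : t ∈ II) :
    ∫ r in (0:ℝ)..n, Dd p q P Q n zr = 0 := by
  obtain ⟨-, -, c3⟩ := conts h h' n
  have := slice_univ c3 ht
  rw [intervalIntegral.integral_eq_sub_of_hasDerivAt (f := fun r => rn ^ 2 * (r * Fc p q P Q zr)
    + -2 / n * rn * r * Yc p q P Q zr) ?_ (this.intervalIntegrable _ _)]
  · field_simp; ring
  · intro r _
    have hz : zr ∈ II ×ˢ (univ : Set ℝ) := ⟨ht, trivial⟩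
    have a1 := hdR isOpen_IU h.ps hz
    have a2 := hdR isOpen_IU h.qs hz
    have a3 := hdR isOpen_IU h'.ps hz
    have a4 := hdR isOpen_IU h'.qs hz
    have b1 := hdR isOpen_IU (dR_smooth isOpen_IU h.ps) hz
    have b2 := hdR isOpen_IU (dR_smooth isOpen_IU h.qs) hz
    have b3 := hdR isOpen_IU (dR_smooth isOpen_IU h'.ps) hz
    have b4 := hdR isOpen_IU (dR_smooth isOpen_IU h'.qs) hz
    have e1 : HasDerivAt (fun r => Fc p q P Q zr) (Fr p q P Q zr) r :=
      ((((b1.mul a4).sub (b2.mul a3)).add (a2.mul b3)).sub (a1.mul b4)).congr_deriv (by unfold Fr; ring)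
    have e2 : HasDerivAt (fun r => Yc p q P Q zr) (2 * Gc q p P Q zr - Fc p q P Q zr) r :=
      ((a2.mul a3).sub (a1.mul a4)).congr_deriv (by unfold Fc Gc; ring)
    have e3 : HasDerivAt (fun r : ℝ => 1 - r / n) (-(1 / n)) r :=
      (((hasDerivAt_id r).div_const n).const_sub 1).congr_deriv rfl
    have := ((e3.pow 2).mul ((hasDerivAt_id r).mul e1)).add ((((e3.const_mul (-2 / n)).mul (hasDerivAt_id r))).mul e2)
    refine this.congr_deriv ?_
    unfold Dd
    simp only [id, Pi.mul_apply, Pi.pow_apply]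
    generalize Fc p q P Q zr = a; generalize Fr p q P Q zr = b; generalize Gc q p P Q zr = c
    generalize Yc p q P Q zr = d
    push_cast; field_simp; ring

lemma XT_eq (h : Dat m p q) (h' : Dat m P Q) {r : ℝ} (hr : 0 < r) (ht : t ∈ II) :
    XT p q P Q zr * r = Fc p q P Q zr + r * Fr p q P Q zr
      + (Wv m p q zr - Wv m P Q zr) * Yc p q P Q zr * r := by
  unfold XT
  rw [h.eqp t ht r hr, h.eqq t ht r hr, h'.eqp t ht r hr, h'.eqq t ht r hr]
  unfold Fc Fr Yc
  field_simp; ring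

lemma Zn_bound (h : Dat m p q) (h' : Dat m P Q) (hb : Bd p q P Q t B) (hs : 0 < s)
    (hy : ∫ r in Ioi (0:ℝ), w2 p q P Q zr * r ≤ s ^ 2) {n κ : ℝ} (hn : 0 < n) (hκ0 : 0 ≤ κ)
    (hκ : ∀ r ∈ Ioc 0 n, |(rpq - rPQ) * Yc p q P Q zr| ≤ κ * w2 p q P Q zr) :
    |∫ r in (0:ℝ)..n, rn ^ 2 * XT p q P Q zr * r| ≤
      (3 * B + 16 * (m + 1)) / n + (LC m B * (2 * B + 16 * (m + 1) + 1) + κ) * s ^ 2 := by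
  have ht := hb.ht
  obtain ⟨-, c2, c3⟩ := conts h h' n
  have c2 := slice_univ c2 ht
  have c3 := slice_univ c3 ht
  have L0 := LC_pos (m := m) hb.hB
  set L := LC m B
  have e : ∫ r in (0:ℝ)..n, rn ^ 2 * XT p q P Q zr * r =
      ∫ r in (0:ℝ)..n, (rn ^ 2 * XT p q P Q zr * r - Dd p q P Q n zr) := by
    rw [intervalIntegral.integral_sub (Continuous.intervalIntegrable (by fun_prop) _ _)
      (c3.intervalIntegrable _ _), Dd_zero h h' hn ht, sub_zero]
  set F1 : ℝ → ℝ := fun r => 3 / n * (rpq * r) with hF1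
  set F2 : ℝ → ℝ := fun r => (1 / n + 2 * L * s ^ 2) * (rPQ / r) with hF2
  set F3 : ℝ → ℝ := fun r => 2 / n * (YY P Q zr * r) with hF3
  set F4 : ℝ → ℝ := fun r => (L + κ) * (w2 p q P Q zr * r) with hF4
  set F5 : ℝ → ℝ := fun r => 2 * L * s ^ 2 * (rPQ * r) with hF5
  have i1 : IntegrableOn F1 (Ioi 0) := (h.int t ht).const_mul _
  have i2 : IntegrableOn F2 (Ioi 0) := (h'.rhor_int ht).const_mul _
  have i3 : IntegrableOn F3 (Ioi 0) := hb.iY.const_mul _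
  have i4 : IntegrableOn F4 (Ioi 0) := (iw h h' ht).const_mul _
  have i5 : IntegrableOn F5 (Ioi 0) := (h'.int t ht).const_mul _
  have i12 : IntegrableOn (fun x => F1 x + F2 x) (Ioi 0) := i1.add i2
  have i34 : IntegrableOn (fun x => F3 x + F4 x) (Ioi 0) := i3.add i4
  have i14 : IntegrableOn (fun x => F1 x + F2 x + (F3 x + F4 x)) (Ioi 0) := i12.add i34
  have i15 : IntegrableOn (fun x => F1 x + F2 x + (F3 x + F4 x) + F5 x) (Ioi 0) := i14.add i5
  have nn : ∀ r, 0 < r → 0 ≤ F1 r + F2 r + (F3 r + F4 r) + F5 r := by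
    intro r hr
    have r0 := rho_nonneg (p := p) (q := q) zr
    have r1 := rho_nonneg (p := P) (q := Q) zr
    have r2 := w2_nonneg (p := p) (q := q) (P := P) (Q := Q) zr
    have r3 := YY_nonneg (p := P) (q := Q) zr
    simp only [hF1, hF2, hF3, hF4, hF5]
    positivity
  have pw : ∀ r ∈ Ioc 0 n, |rn ^ 2 * XT p q P Q zr * r - Dd p q P Q n zr|
      ≤ F1 r + F2 r + (F3 r + F4 r) + F5 r := by
    intro r ⟨hr, hrn⟩
    have x1 : r / n ≤ 1 := (div_le_one hn).2 hrn
    have x0 : 0 ≤ r / n := by positivity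
    have e1 : rn ^ 2 * XT p q P Q zr * r - Dd p q P Q n zr
      = rn ^ 2 * ((Wv m p q zr - Wv m P Q zr) * Yc p q P Q zr * r)
        + (4 / n * rn * (Gc q p P Q zr * r) + 2 / n * (1 - 2 * (r / n)) * Yc p q P Q zr) := by
      rw [mul_assoc, XT_eq h h' hr ht]; unfold Dd; simp only; ring
    have a1 := dW_le h h' hb hs hy hr (hκ r ⟨hr, hrn⟩)
    have a2 : |rn ^ 2 * ((Wv m p q zr - Wv m P Q zr) * Yc p q P Q zr * r)| ≤
        |(Wv m p q zr - Wv m P Q zr) * Yc p q P Q zr * r| := by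
      rw [abs_mul, abs_of_nonneg (sq_nonneg rn)]
      exact mul_le_of_le_one_left (abs_nonneg _) (pow_le_one₀ (by linarith) (by linarith))
    have a3 : |Gc q p P Q zr| ≤ 1 / 2 * (rpq + YY P Q zr) := by
      unfold Gc rho YY
      generalize p zr = a; generalize q zr = b; generalize dR P zr = c; generalize dR Q zr = d
      rw [abs_le]; constructor
      · nlinarith [sq_nonneg (b + c), sq_nonneg (a - d)]
      · nlinarith [sq_nonneg (b - c), sq_nonneg (a + d)]
    have a4 : |Yc p q P Q zr| ≤ 1 / 2 * (rpq * r + rPQ / r) := by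
      have k : r * |Yc p q P Q zr| ≤ 1 / 2 * (r ^ 2 * rpq + rPQ) := by
        unfold Yc rho
        generalize p zr = a; generalize q zr = b; generalize P zr = c; generalize Q zr = d
        rw [← abs_of_pos hr, ← abs_mul, abs_of_pos hr, abs_le]; constructor
        · nlinarith [sq_nonneg (r * b + c), sq_nonneg (r * a - d)]
        · nlinarith [sq_nonneg (r * b - c), sq_nonneg (r * a + d)]
      have e : 1 / 2 * (rpq * r + rPQ / r) =
        1 / 2 * (r ^ 2 * rpq + rPQ) / r := by field_simp
      rw [e, le_div_iff₀ hr]; linarith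
    have a5 : |4 / n * rn * (Gc q p P Q zr * r)| ≤
        4 / n * (1 / 2 * (rpq + YY P Q zr) * r) := by
      rw [abs_mul, abs_mul (Gc q p P Q zr), abs_of_pos hr, abs_of_nonneg (mul_nonneg (by positivity) (by linarith))]
      refine mul_le_mul ?_ (mul_le_mul_of_nonneg_right a3 hr.le) (by positivity) (by positivity)
      exact mul_le_of_le_one_right (by positivity) (by linarith)
    have a6 : |2 / n * (1 - 2 * (r / n)) * Yc p q P Q zr| ≤
        2 / n * (1 / 2 * (rpq * r + rPQ / r)) := by
      rw [abs_mul, abs_mul, abs_of_pos (by positivity : 0 < 2 / n)]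
      refine mul_le_mul ?_ a4 (abs_nonneg _) (by positivity)
      exact mul_le_of_le_one_right (by positivity) (abs_le.2 ⟨by linarith, by linarith⟩)
    rw [e1]
    refine (abs_add_le _ _).trans ?_
    refine (add_le_add (a2.trans a1) ((abs_add_le _ _).trans (add_le_add a5 a6))).trans (le_of_eq ?_)
    simp only [hF1, hF2, hF3, hF4, hF5]; field_simp; ring
  rw [e, ← Real.norm_eq_abs]
  have k : ‖∫ r in (0:ℝ)..n, (rn ^ 2 * XT p q P Q zr * r - Dd p q P Q n zr)‖
      ≤ ∫ r in Ioi (0:ℝ), (F1 r + F2 r + (F3 r + F4 r) + F5 r) := by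
    rw [intervalIntegral.integral_of_le hn.le]
    refine (norm_integral_le_of_norm_le (i15.mono_set Ioc_subset_Ioi_self) ?_).trans
      (setIntegral_mono_set i15 ?_ (LE.le.eventuallyLE Ioc_subset_Ioi_self))
    · exact (ae_restrict_iff' measurableSet_Ioc).2 (Eventually.of_forall fun x hx => pw x hx)
    · exact aeI (fun x hx => nn x hx)
  refine k.trans ?_
  rw [integral_add i14 i5, integral_add i12 i34, integral_add i1 i2, integral_add i3 i4]
  simp only [hF1, hF2, hF3, hF4, hF5]
  simp only [integral_const_mul]
  rw [h.mass t ht, h'.mass t ht]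
  have g1 : ∫ r in Ioi (0:ℝ), rPQ / r ≤ B + 4 * (m + 1) := by
    rw [← (maj_int h' ht B).2]
    exact setIntegral_mono_on (h'.rhor_int ht) (maj_int h' ht B).1 mI
      fun r hr => maj_le hb.nS hr
  have g2 := mul_le_mul_of_nonneg_left g1 (by positivity : 0 ≤ 1 / n + 2 * L * s ^ 2)
  have g3 := mul_le_mul_of_nonneg_left hb.bY (by positivity : 0 ≤ 2 / n)
  have g4 := mul_le_mul_of_nonneg_left hy (by positivity : 0 ≤ L + κ)
  have e2 : (3 * B + 16 * ((m:ℝ) + 1)) / n = 3 / n * (4 * (m + 1)) + 1 / n * (B + 4 * (m + 1)) + 2 / n * B := by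
    field_simp; ring
  rw [e2]
  linarith

end

end

end CSSP

namespace CSSP
noncomputable section
open scoped ContDiff Topology

def kap (p q : ℝ × ℝ → ℝ) (n : ℕ) (t : ℝ) : ℝ := ∑ k ∈ Finset.Icc 2 (2 * n + 1), Kn p q k t / (k:ℝ) ^ 2

section
variable {p q P Q : ℝ × ℝ → ℝ} {m : ℕ} {t B s : ℝ}

lemma dY_le {k : ℝ} (hk : 0 < k) (z : ℝ × ℝ) : |(rho p q z - rho P Q z) * Yc p q P Q z| ≤
    ((rho p q z + rho P Q z) / k ^ 2 + k ^ 2 * rho P Q z / 2) * w2 p q P Q z := by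
  have e : Yc p q P Q z = (q z - Q z) * P z - (p z - P z) * Q z := by unfold Yc; ring
  rw [e]; unfold w2 rho
  generalize p z = a; generalize q z = b; generalize P z = c; generalize Q z = d
  set x := a ^ 2 + b ^ 2 - (c ^ 2 + d ^ 2) with hx
  set y := (b - d) * c - (a - c) * d with hy
  set w := (a - c) ^ 2 + (b - d) ^ 2 with hw
  have h1 : x ^ 2 ≤ w * (2 * (a ^ 2 + b ^ 2 + (c ^ 2 + d ^ 2))) := by
    have : w * (2 * (a ^ 2 + b ^ 2 + (c ^ 2 + d ^ 2))) - x ^ 2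
      = ((a - c) * (b + d) - (b - d) * (a + c)) ^ 2 + w ^ 2 := by rw [hw, hx]; ring
    nlinarith [sq_nonneg ((a - c) * (b + d) - (b - d) * (a + c)), sq_nonneg w]
  have h2 : y ^ 2 ≤ w * (c ^ 2 + d ^ 2) := by
    have : w * (c ^ 2 + d ^ 2) - y ^ 2 = ((a - c) * c + (b - d) * d) ^ 2 := by rw [hw, hy]; ring
    nlinarith [sq_nonneg ((a - c) * c + (b - d) * d)]
  have h3 : |x * y| ≤ 1 / 2 * (x ^ 2 / k ^ 2 + k ^ 2 * y ^ 2) := by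
    have i1 : 1 / 2 * (x ^ 2 / k ^ 2 + k ^ 2 * y ^ 2) - x * y = 1 / 2 * (x / k - k * y) ^ 2 := by field_simp; ring
    have i2 : 1 / 2 * (x ^ 2 / k ^ 2 + k ^ 2 * y ^ 2) + x * y = 1 / 2 * (x / k + k * y) ^ 2 := by field_simp; ring
    have := sq_nonneg (x / k - k * y)
    have := sq_nonneg (x / k + k * y)
    rw [abs_le]; constructor <;> linarith
  have h4 : x ^ 2 / k ^ 2 ≤ w * (2 * (a ^ 2 + b ^ 2 + (c ^ 2 + d ^ 2))) / k ^ 2 := by gcongr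
  have h5 : k ^ 2 * y ^ 2 ≤ k ^ 2 * (w * (c ^ 2 + d ^ 2)) := by gcongr
  refine h3.trans ?_
  have e5 : w * (2 * (a ^ 2 + b ^ 2 + (c ^ 2 + d ^ 2))) / k ^ 2 =
    2 * ((a ^ 2 + b ^ 2 + (c ^ 2 + d ^ 2)) / k ^ 2 * w) := by ring
  rw [e5] at h4
  linarith

lemma kap_le (h : Dat m p q) (hb : Bd p q P Q t B) (n : ℕ) {r : ℝ} (hr : r ∈ Ioc (0:ℝ) n) :
    |(rpq - rPQ) * Yc p q P Q zr| ≤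
      (6 * B + 48 * (m + 1) + 6 * kap p q n t) * w2 p q P Q zr := by
  have hB := hb.hB
  have r0 := rho_nonneg (p := p) (q := q) zr
  have r1 := rho_nonneg (p := P) (q := Q) zr
  have hterm : ∀ k ∈ Finset.Icc 2 (2 * n + 1), 0 ≤ Kn p q k t / (k:ℝ) ^ 2 := by
    intro k hk
    have h2 : 2 ≤ k := (Finset.mem_Icc.1 hk).1
    have h3 : (1:ℝ) ≤ k := by exact_mod_cast (by omega : 1 ≤ k)
    exact div_nonneg (Kn_nonneg h3 t) (by positivity)
  have K0 : 0 ≤ kap p q n t := Finset.sum_nonneg hterm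
  by_cases h1 : r ≤ 1
  · refine (dY_le one_pos zr).trans (mul_le_mul_of_nonneg_right ?_ (w2_nonneg _))
    have a := hb.nu r ⟨hr.1.le, h1⟩
    have b := hb.nS r ⟨hr.1.le, h1⟩
    have c : B * r ^ 2 ≤ B := mul_le_of_le_one_right (by linarith) (pow_le_one₀ hr.1.le h1)
    have : (0:ℝ) ≤ 48 * (m + 1) := by positivity
    norm_num
    linarith
  · push Not at h1
    set k := ⌈2 * r⌉₊ with hk
    have k1 : 2 * r ≤ k := Nat.le_ceil _
    have k2 : (k:ℝ) < 2 * r + 1 := Nat.ceil_lt_add_one (by linarith)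
    have k3 : 2 ≤ k := by
      have : (1:ℝ) < k := by linarith
      have : 1 < k := by exact_mod_cast this
      omega
    have k4 : k ≤ 2 * n + 1 := by
      have : (k:ℝ) < ((2 * n + 1 : ℕ) : ℝ) := by push_cast; linarith [hr.2]
      have : k < 2 * n + 1 := by exact_mod_cast this
      omega
    have kp : (0:ℝ) < k := by linarith
    refine (dY_le kp zr).trans (mul_le_mul_of_nonneg_right ?_ (w2_nonneg _))
    have a1 := Finset.single_le_sum hterm (Finset.mem_Icc.2 ⟨k3, k4⟩)
    have a2 := ptw h.gen (subset_univ _) hb.ht (n := (k:ℝ)) (by linarith) one_pos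
      (h.mass_le hb.ht zero_le_one (by linarith : (1:ℝ) ≤ k)) (r := r) ⟨h1.le, by linarith⟩
    have a3 : 1 / 6 * rpq ≤ (1 - r / k) / k * r * rpq := by
      refine mul_le_mul_of_nonneg_right ?_ r0
      have b1 : 1 / 2 ≤ 1 - r / (k:ℝ) := by
        have : r / (k:ℝ) ≤ 1 / 2 := by rw [div_le_div_iff₀ kp two_pos]; linarith
        linarith
      have b2 : 1 / 3 ≤ r / (k:ℝ) := by rw [div_le_div_iff₀ three_pos kp]; linarith
      have := mul_le_mul b1 b2 (by norm_num) (by linarith)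
      have e : (1 - r / (k:ℝ)) / k * r = (1 - r / k) * (r / k) := by ring
      rw [e]; linarith
    have kk : (1:ℝ) ≤ (k:ℝ) ^ 2 := one_le_pow₀ (by linarith)
    have a4 : rpq / (k:ℝ) ^ 2 ≤ 48 * (m + 1) + 6 * kap p q n t + 0 := by
      have c1 : rpq ≤ 48 * (m + 1) + 6 * Kn p q k t := by linarith
      have c2 : rpq / (k:ℝ) ^ 2 ≤ (48 * (m + 1) + 6 * Kn p q k t) / (k:ℝ) ^ 2 := by gcongr
      have c3 : 48 * ((m:ℝ) + 1) / (k:ℝ) ^ 2 ≤ 48 * (m + 1) := div_le_self (by positivity) kk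
      have e : (48 * ((m:ℝ) + 1) + 6 * Kn p q k t) / (k:ℝ) ^ 2 = 48 * (m + 1) / (k:ℝ) ^ 2 + 6 * (Kn p q k t / (k:ℝ) ^ 2) := by ring
      unfold kap
      linarith
    have a5 := hb.tail r hr.1
    have rr : (1:ℝ) ≤ r ^ 2 := one_le_pow₀ h1.le
    have a6 : rPQ / (k:ℝ) ^ 2 ≤ B := (div_le_self r1 kk).trans ((le_mul_of_one_le_left r1 rr).trans a5)
    have a7 : (k:ℝ) ^ 2 * rPQ ≤ 9 * B := by
      have : (k:ℝ) ^ 2 ≤ (3 * r) ^ 2 := pow_le_pow_left₀ kp.le (by linarith) 2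
      have := mul_le_mul_of_nonneg_right this r1
      nlinarith
    rw [add_div]
    linarith

lemma kap_int (h : Dat m p q) {t1 t2 : ℝ} (h1 : -1 < t1) (h12 : t1 ≤ t2) (h2 : t2 < 0) :
    ∃ C, ∀ n, ∫ t in t1..t2, kap p q n t ≤ C := by
  set s1 := (t1 - 1) / 2
  set s2 := t2 / 2
  have a0 : -1 < s1 := by simp only [s1]; linarith
  have a1 : s1 < t1 := by simp only [s1]; linarith
  have a3 : t2 < s2 := by simp only [s2]; linarith
  have a4 : s2 < 0 := by simp only [s2]; linarith
  have hIcc : Icc s1 s2 ⊆ II := Icc_subset_Ioo a0 a4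
  obtain ⟨CA, hCA, hA⟩ := h.A_bdd a0 a4
  obtain ⟨C, hC, hK⟩ := morawetz (W1 := W1v m p q) (c0 := 1) h.gen (subset_univ _) zero_le_one le_rfl a1 h12 a3 hIcc
    (fun t _ r _ _ => by unfold Wv W1v; ring) (μ := 4 * (m + 1)) (by positivity) (C1 := mm2 ^ 2 + CA) (by positivity)
    (fun t ht n hn => h.mass_le (hIcc ht) zero_le_one hn)
    (by
      intro t ht r hr
      have hr0 : 0 < r := by linarith
      have b1 := h.a_abs (hIcc ht) hr0.le
      have b2 := hA t ht r hr0
      have b5 : apq ^ 2 / r ^ 2 ≤ mm2 ^ 2 :=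
        (div_le_self (sq_nonneg _) (one_le_pow₀ hr)).trans (sq_le_sq' (abs_le.1 b1).1 (abs_le.1 b1).2)
      have b6 : 0 ≤ apq ^ 2 / r ^ 2 := by positivity
      unfold W1v
      refine (abs_add_le _ _).trans ?_
      rw [abs_of_nonneg b6]; linarith)
  have hsum : Summable (fun k : ℕ => 1 / (k:ℝ) ^ 2) := Real.summable_one_div_nat_pow.2 one_lt_two
  refine ⟨C * ∑' k : ℕ, 1 / (k:ℝ) ^ 2, fun n => ?_⟩
  unfold kap
  have k1 : ∀ k ∈ Finset.Icc 2 (2 * n + 1), (2:ℝ) ≤ k := fun k hk => by exact_mod_cast (Finset.mem_Icc.1 hk).1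
  rw [intervalIntegral.integral_finsetSum]
  · calc _ ≤ ∑ k ∈ Finset.Icc 2 (2 * n + 1), C * (1 / (k:ℝ) ^ 2) := by
          refine Finset.sum_le_sum fun k hk => ?_
          rw [intervalIntegral.integral_div, mul_one_div]
          have := hK k (k1 k hk)
          gcongr
      _ ≤ _ := by
          rw [← Finset.mul_sum]
          exact mul_le_mul_of_nonneg_left (hsum.sum_le_tsum _ fun k _ => by positivity) hC
  · intro k hk
    refine ContinuousOn.intervalIntegrable ?_
    rw [uIcc_of_le h12]
    exact ((Kn_cont h.gen (subset_univ _) (by linarith [k1 k hk])).mono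
      (Icc_subset_Ioo h1 h2)).div_const _

lemma y_cut (h : Dat m p q) (h' : Dat m P Q) (hb : Bd p q P Q t B) {n : ℝ} (hn : 0 < n) :
    |(∫ r in Ioi (0:ℝ), w2 p q P Q zr * r) - (8 * (m + 1) - 2 * Zn p q P Q n t)| ≤ (8 * (m + 1) + 2 * B) / n := by
  have ht := hb.ht
  obtain ⟨c1, -, -⟩ := conts h h' n
  have c1 := slice_univ c1 ht
  have iX : IntegrableOn (fun r => Xc p q P Q zr * r) (Ioi 0) := by
    have := (((h.int t ht).add (h'.int t ht)).sub (iw h h' ht)).const_mul (1 / 2)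
    refine (integrableOn_congr_fun (fun r _ => ?_) mI).1 this
    simp only [Pi.add_apply, Pi.sub_apply]; unfold rho w2 Xc; ring
  have e : ∫ r in Ioi (0:ℝ), w2 p q P Q zr * r = 8 * (m + 1) - 2 * ∫ r in Ioi (0:ℝ), Xc p q P Q zr * r := by
    have e1 : ∀ r, w2 p q P Q zr * r = rpq * r + rPQ * r - 2 * (Xc p q P Q zr * r) := by
      intro r; unfold rho w2 Xc; ring
    simp_rw [e1]
    have i12 : IntegrableOn (fun r => rpq * r + rPQ * r) (Ioi 0) := (h.int t ht).add (h'.int t ht)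
    rw [integral_sub i12 (iX.const_mul 2), integral_add (h.int t ht) (h'.int t ht), h.mass t ht, h'.mass t ht,
      integral_const_mul]
    ring
  set F : ℝ → ℝ := fun r => rn ^ 2 * Xc p q P Q zr * r with hF
  have eZ : Zn p q P Q n t = ∫ r in Ioi (0:ℝ), (Ioc 0 n).indicator F r := by
    unfold Zn
    rw [intervalIntegral.integral_of_le hn.le, setIntegral_indicator measurableSet_Ioc,
      inter_eq_right.2 Ioc_subset_Ioi_self]
  have iF : IntegrableOn ((Ioc 0 n).indicator F) (Ioi 0) := by
    rw [integrableOn_indicator_iff measurableSet_Ioc, inter_eq_left.2 Ioc_subset_Ioi_self]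
    have : Continuous F := by simp only [hF]; fun_prop
    exact this.integrableOn_Ioc
  have hG : IntegrableOn (fun r => 1 / n * (rpq * r + r ^ 3 * rPQ)) (Ioi 0) :=
    ((h.int t ht).add hb.i3).const_mul _
  have k : ‖∫ r in Ioi (0:ℝ), (Xc p q P Q zr * r - (Ioc 0 n).indicator F r)‖ ≤
      ∫ r in Ioi (0:ℝ), 1 / n * (rpq * r + r ^ 3 * rPQ) := by
    refine norm_integral_le_of_norm_le hG ?_
    refine aeI (fun r hr => ?_)
    have hr : 0 < r := hr
    have a1 : |Xc p q P Q zr| * r ^ 2 ≤ 1 / 2 * (rpq * r + r ^ 3 * rPQ) := by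
      have : |Xc p q P Q zr| * r ≤ 1 / 2 * (rpq + r ^ 2 * rPQ) := by
        unfold Xc rho
        generalize p zr = a; generalize q zr = b; generalize P zr = c; generalize Q zr = d
        rw [← abs_of_pos hr, ← abs_mul, abs_of_pos hr, abs_le]; constructor
        · nlinarith [sq_nonneg (a + r * c), sq_nonneg (b + r * d)]
        · nlinarith [sq_nonneg (a - r * c), sq_nonneg (b - r * d)]
      have := mul_le_mul_of_nonneg_right this hr.le
      linarith
    have a2 : ‖Xc p q P Q zr * r - (Ioc 0 n).indicator F r‖ ≤ 2 / n * (|Xc p q P Q zr| * r ^ 2) := by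
      have X0 := abs_nonneg (Xc p q P Q zr)
      rw [Real.norm_eq_abs]
      by_cases hm : r ∈ Ioc 0 n
      · rw [indicator_of_mem hm]
        have x1 : r / n ≤ 1 := (div_le_one hn).2 hm.2
        have x0 : 0 < r / n := by positivity
        have e1 : Xc p q P Q zr * r - F r = Xc p q P Q zr * ((2 - r / n) * (r / n) * r) := by simp only [hF]; ring
        rw [e1, abs_mul, abs_of_nonneg (mul_nonneg (mul_nonneg (by linarith) x0.le) hr.le)]
        have : (2 - r / n) * (r / n) * r ≤ 2 * (r / n) * r :=
          mul_le_mul_of_nonneg_right (mul_le_mul_of_nonneg_right (by linarith) x0.le) hr.le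
        refine (mul_le_mul_of_nonneg_left this X0).trans (le_of_eq (by ring))
      · rw [indicator_of_notMem hm, sub_zero, abs_mul, abs_of_pos hr]
        have : n < r := by by_contra hc; exact hm ⟨hr, not_lt.1 hc⟩
        have x1 : 1 ≤ 2 * (r / n) := by
          have := (one_le_div hn).2 this.le; linarith
        have := mul_le_mul_of_nonneg_left x1 (mul_nonneg X0 hr.le)
        refine le_trans (by linarith) (this.trans (le_of_eq (by ring)))
    refine a2.trans ?_
    refine (mul_le_mul_of_nonneg_left a1 (by positivity : 0 ≤ 2 / n)).trans (le_of_eq (by ring))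
  rw [integral_sub iX iF, ← eZ, integral_const_mul, integral_add (h.int t ht) hb.i3, h.mass t ht, Real.norm_eq_abs] at k
  have b := mul_le_mul_of_nonneg_left (add_le_add_right hb.b3 (4 * ((m:ℝ) + 1))) (by positivity : 0 ≤ 1 / n)
  have e2 : (8 * ((m:ℝ) + 1) + 2 * B) / n = 2 * (1 / n * (4 * (m + 1) + B)) := by ring
  rw [e, e2]
  have e3 : ∀ x z : ℝ, (8 * ((m:ℝ) + 1) - 2 * x) - (8 * (m + 1) - 2 * z) = -2 * (x - z) := fun x z => by ring
  rw [e3, abs_mul, abs_neg, abs_two]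
  linarith

lemma uniq (h : Dat m p q) (h' : Dat m P Q) {t1 t2 : ℝ} (h1 : -1 < t1) (h12 : t1 ≤ t2) (h2 : t2 < 0)
    (hb : ∀ t ∈ Icc t1 t2, Bd p q P Q t B) (he : ∀ r, 0 < r → w2 p q P Q (t2, r) = 0) :
    ∀ r, 0 < r → w2 p q P Q (t1, r) = 0 := by
  have hI : Icc t1 t2 ⊆ II := Icc_subset_Ioo h1 h2
  have m1 : t1 ∈ Icc t1 t2 := ⟨le_rfl, h12⟩
  have m2 : t2 ∈ Icc t1 t2 := ⟨h12, le_rfl⟩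
  have hB := (hb t1 m1).hB
  obtain ⟨C, hC⟩ := kap_int h h1 h12 h2
  set y : ℝ → ℝ := fun t => ∫ r in Ioi (0:ℝ), w2 p q P Q zr * r with hy
  set C' : ℝ := 8 * (m + 1) + 2 * B with hC'
  have C'0 : 0 < C' := by positivity
  set L' : ℝ := LC m B * (2 * B + 16 * (m + 1) + 1) + (6 * B + 48 * (m + 1)) with hL'
  set E : ℝ := (4 + 2 * L') * (t2 - t1) + 12 * C with hE
  have y0 : ∀ t, 0 ≤ y t := fun t => setIntegral_nonneg mI fun r hr =>
    mul_nonneg (w2_nonneg _) (le_of_lt hr)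
  have key : ∀ n : ℕ, 1 ≤ n → y t1 ≤ 3 * C' * Real.exp E / n := by
    intro n hn
    have hn0 : (0:ℝ) < n := by exact_mod_cast hn
    set f : ℝ → ℝ := fun t => 8 * (m + 1) - 2 * Zn p q P Q n t + 2 * (C' / n) with hf
    have c0 : 0 < C' / n := by positivity
    have fl : ∀ t ∈ Icc t1 t2, y t + C' / n ≤ f t ∧ f t ≤ y t + 3 * (C' / n) := by
      intro t ht
      have := abs_le.1 (y_cut h h' (hb t ht) hn0)
      simp only [hf]
      constructor <;> linarith [this.1, this.2]
    have fp : ∀ t ∈ Icc t1 t2, 0 < f t := fun t ht => by linarith [(fl t ht).1, y0 t]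
    have ck : ContinuousOn (kap p q n) (Icc t1 t2) := by
      unfold kap
      refine continuousOn_finsetSum _ fun k hk => ?_
      have : (2:ℝ) ≤ k := by exact_mod_cast (Finset.mem_Icc.1 hk).1
      exact ((Kn_cont h.gen (subset_univ _) (by linarith)).mono hI).div_const _
    have k0 : ∀ t, 0 ≤ kap p q n t := fun t => Finset.sum_nonneg fun k hk => by
      have : (2:ℝ) ≤ k := by exact_mod_cast (Finset.mem_Icc.1 hk).1
      exact div_nonneg (Kn_nonneg (by linarith) t) (by positivity)
    have D : ∀ t ∈ Icc t1 t2, HasDerivAt (fun t => Real.log (f t))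
        ((0 - 2 * (∫ r in (0:ℝ)..n, rn ^ 2 * XT p q P Q zr * r)) / f t) t := by
      intro t ht
      have := ((Zn_deriv h h' hn0 (hI ht)).const_mul 2).const_sub (8 * ((m:ℝ) + 1))
      have := (this.add_const (2 * (C' / n))).log (fp t ht).ne'
      exact this.congr_deriv (by simp [hf])
    have bound : ∀ t ∈ Icc t1 t2, |(0 - 2 * (∫ r in (0:ℝ)..n, rn ^ 2 * XT p q P Q zr * r)) / f t|
        ≤ 4 + 2 * L' + 12 * kap p q n t := by
      intro t ht
      have f0 := fp t ht
      have hs : Real.sqrt (f t) ^ 2 = f t := Real.sq_sqrt f0.le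
      have := Zn_bound h h' (hb t ht) (Real.sqrt_pos.2 f0) (by rw [hs]; linarith [(fl t ht).1]) hn0
        (κ := 6 * B + 48 * (m + 1) + 6 * kap p q n t) (by have := k0 t; positivity)
        (fun r hr => kap_le h (hb t ht) n hr)
      rw [hs] at this
      rw [zero_sub, abs_div, abs_neg, abs_mul, abs_two, abs_of_pos f0, div_le_iff₀ f0]
      have b1 : (3 * B + 16 * ((m:ℝ) + 1)) / n ≤ 2 * (C' / n) := by
        rw [← mul_div_assoc]; gcongr; rw [hC']; linarith
      have b2 : C' / n ≤ f t := by linarith [(fl t ht).1, y0 t]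
      rw [hL']
      linarith
    have G := abs_sub_le_int h12 D (by fun_prop) bound
    have iK : IntervalIntegrable (fun t => 12 * kap p q n t) volume t1 t2 :=
      ContinuousOn.intervalIntegrable (by rw [uIcc_of_le h12]; fun_prop)
    rw [intervalIntegral.integral_add (by simp) iK, intervalIntegral.integral_const,
      intervalIntegral.integral_const_mul, smul_eq_mul] at G
    have g1 := (abs_le.1 G).1
    have g2 := hC n
    have g3 : Real.log (f t1) ≤ Real.log (f t2) + E := by rw [hE]; linarith
    have g4 : f t1 ≤ f t2 * Real.exp E := by
      have := Real.exp_le_exp.2 g3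
      rwa [Real.exp_add, Real.exp_log (fp t1 m1), Real.exp_log (fp t2 m2)] at this
    have yz : y t2 = 0 := by
      rw [hy]; simp only
      rw [setIntegral_congr_fun (g := fun _ => (0:ℝ)) mI fun r hr => by simp [he r hr]]
      simp
    have g5 : f t2 ≤ 3 * (C' / n) := by linarith [(fl t2 m2).2]
    have g6 := mul_le_mul_of_nonneg_right g5 (Real.exp_pos E).le
    have e : 3 * C' * Real.exp E / n = 3 * (C' / n) * Real.exp E := by ring
    rw [e]; linarith [(fl t1 m1).1]
  have yz : y t1 = 0 := by
    refine le_antisymm ?_ (y0 t1)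
    refine ge_of_tendsto (tendsto_const_div_atTop_nhds_zero_nat (3 * C' * Real.exp E)) ?_
    filter_upwards [eventually_ge_atTop 1] with n hn using key n hn
  intro r hr
  have ae := (setIntegral_eq_zero_iff_of_nonneg_ae ((ae_restrict_iff' mI).2
    (Eventually.of_forall fun r hr => mul_nonneg (w2_nonneg _) (le_of_lt hr))) (iw h h' (hI m1))).1 yz
  have cc := cw h h' (hI m1)
  have hz := Measure.eqOn_open_of_ae_eq ae isOpen_Ioi (Continuous.continuousOn (by fun_prop)) continuousOn_const hr
  exact (mul_eq_zero.1 hz).resolve_right hr.ne'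

end

end

end CSSP

namespace CSSP
noncomputable section
open scoped ContDiff Topology

section
variable {p q : ℝ × ℝ → ℝ} {m : ℕ} {u : ℝ → ℝ → ℂ} {T0 ν c d : ℝ}

lemma S_tail (hν : 0 < ν) (hcd : c ^ 2 + d ^ 2 = 1) {t r : ℝ} (ht : t < 0) (hr : 0 < r) :
    r ^ 2 * SSr ≤ 2 * mm2 ^ 2 := by
  rw [rho_SS hcd, Rr_sq hν]
  have hD := Dn_pos (m := m) hν ht r
  have h1 := ev_pos (m := m) ht.ne
  have h2 := ev_pos (m := m) hr.ne'
  have e : r ^ 2 * (2 * (2 * (m:ℝ) + 2) ^ 2 * ν * t ^ mm2 * r ^ (2 * m) / Dn m ν zr ^ 2)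
      = 2 * (2 * (m:ℝ) + 2) ^ 2 * ((ν * t ^ mm2) * r ^ mm2 / Dn m ν zr ^ 2) := by
    rw [pow_add r]; ring
  rw [e]
  have h3 : (ν * t ^ mm2) * r ^ mm2 / Dn m ν zr ^ 2 ≤ 1 := by
    rw [div_le_one (by positivity)]
    unfold Dn
    simp only
    have : 0 < ν * t ^ mm2 := by positivity
    nlinarith
  calc _ ≤ 2 * (2 * (m:ℝ) + 2) ^ 2 * 1 := mul_le_mul_of_nonneg_left h3 (by positivity)
    _ = _ := by ring

lemma S_far (hm : 1 ≤ m) (hν : 0 < ν) (hcd : c ^ 2 + d ^ 2 = 1) {t r : ℝ} (ht : t ∈ II) (hr : 1 ≤ r) :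
    r ^ 5 * SSr ≤ 2 * mm2 ^ 2 * ν := by
  rw [rho_SS hcd, Rr_sq hν]
  have ht0 : t < 0 := ht.2
  have hD := Dn_pos (m := m) hν ht0 r
  have h1 := ev_pos (m := m) ht0.ne
  have h1' : t ^ mm2 ≤ 1 := by
    have : t ^ mm2 = (t ^ 2) ^ (m + 1) := by rw [← pow_mul]; congr 1
    rw [this]
    exact pow_le_one₀ (by positivity) (by nlinarith [ht.1])
  have hr0 : 0 < r := by linarith
  have h3 : t ^ mm2 * r ^ (2 * m + 5) / Dn m ν zr ^ 2 ≤ 1 := by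
    rw [div_le_one (by positivity)]
    have k1 : r ^ mm2 ≤ Dn m ν zr := by
      unfold Dn; simp only
      have : 0 < ν * t ^ mm2 := by positivity
      linarith
    calc t ^ mm2 * r ^ (2 * m + 5) ≤ 1 * r ^ (2 * m + 5) :=
          mul_le_mul_of_nonneg_right h1' (by positivity)
      _ ≤ r ^ (2 * mm2) := by rw [one_mul]; exact pow_le_pow_right₀ hr (by omega)
      _ = (r ^ mm2) ^ 2 := by rw [← pow_mul]; congr 1; ring
      _ ≤ _ := pow_le_pow_left₀ (by positivity) k1 2
  calc _ = 2 * (2 * (m:ℝ) + 2) ^ 2 * ν * (t ^ mm2 * r ^ (2 * m + 5) / Dn m ν zr ^ 2) := by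
        rw [pow_add r]; ring
    _ ≤ 2 * (2 * (m:ℝ) + 2) ^ 2 * ν * 1 := mul_le_mul_of_nonneg_left h3 (by positivity)
    _ = _ := by ring

lemma S_YY (hν : 0 < ν) {t r : ℝ} (ht : t ∈ II) (hr : 0 < r) :
    YY (SS m ν c d) (SS m ν d (-c)) zr * r = aS m ν zr ^ 2 * (SSr / r)
      + 1 / (4 * t ^ 2) * (r ^ 3 * SSr) := by
  have ht0 : t ≠ 0 := ht.2.ne
  unfold YY rho
  rw [dR_SS hν ht hr, dR_SS hν ht hr, SS_neg]
  field_simp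
  ring

lemma S_gg (hν : 0 < ν) (hcd : c ^ 2 + d ^ 2 = 1) {t r : ℝ} (ht : t ∈ II) (hr : 0 < r) :
    gg m (SS m ν c d) (SS m ν d (-c)) zr * r =
      1 / (4 * t ^ 2) * (r ^ 3 * SSr) := by
  have ht0 : t ≠ 0 := ht.2.ne
  unfold gg
  unfold rho gv
  rw [dR_SS hν ht hr, dR_SS hν ht hr, SS_neg, MS_eq hν hcd ht.2]
  field_simp
  ring

lemma S_Bd (h : Dat m p q) (hν : 0 < ν) (hcd : c ^ 2 + d ^ 2 = 1) {t1 t2 : ℝ} (h1 : -1 < t1) (h2 : t2 < 0) :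
    ∃ B, ∀ t ∈ Icc t1 t2, Bd p q (SS m ν c d) (SS m ν d (-c)) t B := by
  have h' := dat_SS h.hm hν hcd
  obtain ⟨B1, hB1, b1⟩ := h.rho_near h1 h2
  obtain ⟨B2, hB2, b2⟩ := h'.rho_near h1 h2
  obtain ⟨B3, hB3, b3⟩ := h'.rhor_bdd h1 h2
  set K : ℝ := 2 * (2 * (m:ℝ) + 2) ^ 2 with hK
  have hK0 : 0 ≤ K := by positivity
  set C : ℝ := 2 * B2 + 2 * (K * ν) with hC
  have hC0 : 0 ≤ C := by positivity
  set X : ℝ := ∫ r in Ioi (0:ℝ), (1 + r ^ 2)⁻¹ with hX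
  have hX0 : 0 ≤ X := setIntegral_nonneg mI fun r _ => by positivity
  have iX : IntegrableOn (fun r : ℝ => C * (1 + r ^ 2)⁻¹) (Ioi 0) :=
    (integrable_inv_one_add_sq.integrableOn).const_mul C
  set D : ℝ := 1 / (4 * t2 ^ 2) with hD
  have hD0 : 0 ≤ D := by positivity
  refine ⟨1 + B1 + B2 + K + C * X + (mm2 ^ 2 * B3 + D * (C * X)), fun t ht => ?_⟩
  have htI : t ∈ II := Icc_subset_Ioo h1 h2 ht
  have hY0 : 0 ≤ (2 * (m:ℝ) + 2) ^ 2 * B3 + D * (C * X) := by positivity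
  have hCX : 0 ≤ C * X := by positivity
  have cr := h'.cr htI
  have hpt : ∀ r ∈ Ioi (0:ℝ), r ^ 3 * SSr ≤ C * (1 + r ^ 2)⁻¹ := by
    intro r hr
    have hr0 : 0 < r := hr
    have hn := rho_nonneg (p := SS m ν c d) (q := SS m ν d (-c)) zr
    rw [← div_eq_mul_inv, le_div_iff₀ (by positivity)]
    rcases le_total r 1 with h5 | h5
    · have k := b2 t ht r ⟨hr0.le, h5⟩
      have k1 : SSr ≤ B2 :=
        k.trans (mul_le_of_le_one_right hB2 (pow_le_one₀ hr0.le h5))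
      have k2 : r ^ 3 * SSr ≤ 1 * B2 :=
        mul_le_mul (pow_le_one₀ hr0.le h5) k1 hn (by norm_num)
      calc _ ≤ 1 * B2 * 2 := mul_le_mul k2 (by nlinarith) (by positivity) (by positivity)
        _ ≤ C := by rw [hC]; nlinarith [mul_nonneg hK0 hν.le]
    · have k := S_far h.hm hν hcd htI h5
      have k2 : r ^ 3 * SSr ≤ r ^ 5 * SSr :=
        mul_le_mul_of_nonneg_right (pow_le_pow_right₀ h5 (by norm_num)) hn
      have k3 : r ^ 3 * SSr * (1 + r ^ 2)
        = r ^ 3 * SSr + r ^ 5 * SSr := by ring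
      rw [k3, hC]; linarith
  have i3 : IntegrableOn (fun r => r ^ 3 * SSr) (Ioi 0) := by
    refine Integrable.mono' iX (Continuous.aestronglyMeasurable (by fun_prop)) ?_
    refine aeI (fun r hr => ?_)
    have hr0 : 0 < r := hr
    rw [Real.norm_of_nonneg (mul_nonneg (by positivity) (rho_nonneg _))]
    exact hpt r hr
  have b3' : ∫ r in Ioi (0:ℝ), r ^ 3 * SSr ≤ C * X := by
    rw [hX, ← integral_const_mul]
    exact setIntegral_mono_on i3 iX mI hpt
  have iS : IntegrableOn (fun r => (2 * (m:ℝ) + 2) ^ 2 * (SSr / r)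
      + D * (r ^ 3 * SSr)) (Ioi 0) :=
    ((h'.rhor_int htI).const_mul _).add (i3.const_mul _)
  have hY : ∀ r ∈ Ioi (0:ℝ), YY (SS m ν c d) (SS m ν d (-c)) zr * r ≤
      (2 * (m:ℝ) + 2) ^ 2 * (SSr / r)
      + D * (r ^ 3 * SSr) := by
    intro r hr
    have hr0 : 0 < r := hr
    have hn := rho_nonneg (p := SS m ν c d) (q := SS m ν d (-c)) zr
    rw [S_YY hν htI hr0]
    have ha := h'.a_abs htI hr0.le
    rw [MS_eq hν hcd htI.2] at ha
    have ha2 : aS m ν zr ^ 2 ≤ (2 * (m:ℝ) + 2) ^ 2 := by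
      rw [← sq_abs]; exact pow_le_pow_left₀ (abs_nonneg _) ha 2
    have hd : 1 / (4 * t ^ 2) ≤ D := by
      rw [hD]
      have : 0 < t2 ^ 2 := by nlinarith
      exact one_div_le_one_div_of_le (by positivity) (by nlinarith [ht.2])
    exact add_le_add (mul_le_mul_of_nonneg_right ha2 (by positivity)) (mul_le_mul_of_nonneg_right hd (by positivity))
  have iY : IntegrableOn (fun r => YY (SS m ν c d) (SS m ν d (-c)) zr * r) (Ioi 0) := by
    have cY := h'.cY htI
    refine Integrable.mono' iS (Continuous.aestronglyMeasurable (by fun_prop)) ?_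
    refine aeI (fun r hr => ?_)
    rw [Real.norm_of_nonneg (mul_nonneg (YY_nonneg _) (le_of_lt hr))]
    exact hY r hr
  refine ⟨htI, by linarith, fun r hr => (b1 t ht r hr).trans ?_, fun r hr => (b2 t ht r hr).trans ?_,
    fun r hr => (S_tail hν hcd htI.2 hr).trans (by linarith), i3, b3'.trans (by linarith), iY, ?_⟩
  · exact mul_le_mul_of_nonneg_right (by linarith) (by positivity)
  · exact mul_le_mul_of_nonneg_right (by linarith) (by positivity)
  · have := setIntegral_mono_on iY iS mI hY
    rw [integral_add ((h'.rhor_int htI).const_mul _) (i3.const_mul _), integral_const_mul, integral_const_mul] at this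
    have k1 := mul_le_mul_of_nonneg_left (b3 t ht) (sq_nonneg (2 * (m:ℝ) + 2))
    have k2 := mul_le_mul_of_nonneg_left b3' hD0
    linarith

lemma S_final (hm : 1 ≤ m) (hν : 0 < ν) (hcd : c ^ 2 + d ^ 2 = 1)
    (hl : Link (SS m ν c d) (SS m ν d (-c)) u) {t : ℝ} (ht : t ∈ II) :
    IntegrableOn (fun r => r ^ 2 * ‖u t r‖ ^ 2 * r) (Set.Ioi (0:ℝ)) ∧
      2 * Real.pi * ∫ r in Set.Ioi (0:ℝ), r ^ 2 * ‖u t r‖ ^ 2 * r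
        = 8 * Energy m (u t) * t ^ 2 := by
  have h' := dat_SS hm hν hcd
  obtain ⟨B, hB⟩ := S_Bd h' hν hcd ht.1 ht.2
  have hb := hB t ⟨le_rfl, le_rfl⟩
  have ht0 : t ≠ 0 := ht.2.ne
  have e1 : ∀ r ∈ Ioi (0:ℝ), r ^ 2 * ‖u t r‖ ^ 2 * r = r ^ 3 * SSr := by
    intro r hr
    rw [hl.norm t ht r hr]; ring
  refine ⟨(integrableOn_congr_fun e1 mI).2 hb.i3, ?_⟩
  rw [setIntegral_congr_fun mI e1]
  have hC : ∀ r, 0 < r → SSr ≤ B := by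
    intro r hr
    have hn := rho_nonneg (p := SS m ν c d) (q := SS m ν d (-c)) zr
    rcases le_total r 1 with h5 | h5
    · exact (hb.nS r ⟨hr.le, h5⟩).trans
        (mul_le_of_le_one_right (by linarith [hb.hB]) (pow_le_one₀ hr.le h5))
    · refine le_trans ?_ (hb.tail r hr)
      exact le_mul_of_one_le_left hn (one_le_pow₀ h5)
  have hbog := (h'.bog ht hb.iY hC).2
  have hee : ee m (SS m ν c d) (SS m ν d (-c)) t =
      1 / (4 * t ^ 2) * ∫ r in Ioi (0:ℝ), r ^ 3 * SSr := by
    unfold ee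
    rw [← integral_const_mul]
    exact setIntegral_congr_fun mI fun r hr => S_gg hν hcd ht hr
  have hE : Energy m (u t) = Real.pi * ee m (SS m ν c d) (SS m ν d (-c)) t := by
    unfold Energy
    rw [← hbog]
    have : ∀ r ∈ Ioi (0:ℝ), ((1 / 2) * ‖deriv (u t) r‖ ^ 2
      + (1 / 2) * (((m : ℝ) + Atheta (u t) r) / r) ^ 2 * ‖u t r‖ ^ 2
      - (1 / 4) * ‖u t r‖ ^ 4) * r = 1 / 2 * (YY (SS m ν c d) (SS m ν d (-c)) zr * r
        + av m (SS m ν c d) (SS m ν d (-c)) zr ^ 2 * SSr / r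
        - 1 / 2 * (SSr ^ 2 * r)) := by
      intro r hr
      have hr0 : r ≠ 0 := (mem_Ioi.1 hr).ne'
      have e4 : ‖u t r‖ ^ 4 = (‖u t r‖ ^ 2) ^ 2 := by ring
      rw [e4, hl.norm t ht r hr, hl.norm_deriv h'.ps h'.qs t ht r hr, hl.Atheta t ht r hr]
      unfold YY
      field_simp
      ring
    rw [setIntegral_congr_fun mI this, integral_const_mul]
    ring
  rw [hE, hee]
  field_simp
  ring

lemma main (hm : 1 ≤ m) (hu : IsCSS m (Set.Ioo (-1 : ℝ) 0) u)
    (hmass : ∀ t ∈ Set.Ioo (-1 : ℝ) 0, L2sq (u t) = 8 * Real.pi * (m + 1))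
    (hblow : Tendsto
      (fun t => Real.sqrt (2 * Real.pi * ∫ r in Set.Ioi (0:ℝ), ‖deriv (u t) r‖ ^ 2 * r))
      (nhdsWithin 0 (Set.Ioo (-1 : ℝ) 0)) atTop) {t : ℝ} (ht : t ∈ II) :
    IntegrableOn (fun r => r ^ 2 * ‖u t r‖ ^ 2 * r) (Set.Ioi (0:ℝ)) ∧
      2 * Real.pi * ∫ r in Set.Ioi (0:ℝ), r ^ 2 * ‖u t r‖ ^ 2 * r
        = 8 * Energy m (u t) * t ^ 2 := by
  obtain ⟨p, q, h, hl⟩ := exists_dat hm hu hmass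
  obtain ⟨T0, hg⟩ := exists_good h hl hu hblow
  have hM : max t T0 < 0 := max_lt ht.2 hg.h0
  set t0 := max t T0 / 2 with ht0
  have k1 : t ≤ t0 := by linarith [le_max_left t T0]
  have k2 : T0 < t0 := by linarith [le_max_right t T0]
  have k3 : t0 < 0 := by linarith
  obtain ⟨ν, c, d, hν, hcd, hf⟩ := hg.form h ⟨k2, k3⟩
  obtain ⟨B, hB⟩ := S_Bd h hν hcd (t1 := t) (t2 := t0) ht.1 k3
  have key := uniq h (dat_SS hm hν hcd) ht.1 k1 k3 hB (fun r hr => by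
    unfold w2; rw [(hf r hr).1, (hf r hr).2]; ring)
  let u2 : ℝ → ℝ → ℂ := fun s r => if s = t then u t r else
    (SS m ν c d (s, r) : ℂ) + (SS m ν d (-c) (s, r) : ℂ) * Complex.I
  have hu2 : u2 t = u t := by funext r; simp [u2]
  have hl2 : Link (SS m ν c d) (SS m ν d (-c)) u2 := by
    refine ⟨fun s hs r hr => ?_⟩
    by_cases hst : s = t
    · subst hst
      rw [hu2, hl.eq s hs r hr]
      have k := key r hr
      unfold w2 at k
      have kp : p (s, r) = SS m ν c d (s, r) := by nlinarith [sq_nonneg (p (s, r) - SS m ν c d (s, r)), sq_nonneg (q (s, r) - SS m ν d (-c) (s, r))]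
      have kq : q (s, r) = SS m ν d (-c) (s, r) := by nlinarith [sq_nonneg (p (s, r) - SS m ν c d (s, r)), sq_nonneg (q (s, r) - SS m ν d (-c) (s, r))]
      rw [kp, kq]
    · simp [u2, hst]
  have := S_final hm hν hcd hl2 ht
  rwa [hu2] at this

end
end
end CSSP

/-- the exact variance identity `2π ∫₀^∞ r² |u(t,r)|² r dr = 8 E[u(t)] t²`. -/
theorem stmt12 (m : ℕ) (hm : 1 ≤ m) (u : ℝ → ℝ → ℂ)
    (hu : IsCSS m (Set.Ioo (-1 : ℝ) 0) u)
    (hmass : ∀ t ∈ Set.Ioo (-1 : ℝ) 0, L2sq (u t) = 8 * Real.pi * (m + 1))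
    (hblow : Tendsto
      (fun t => Real.sqrt (2 * Real.pi * ∫ r in Set.Ioi (0:ℝ), ‖deriv (u t) r‖ ^ 2 * r))
      (nhdsWithin 0 (Set.Ioo (-1 : ℝ) 0)) atTop) :
    ∀ t ∈ Set.Ioo (-1 : ℝ) 0,
      IntegrableOn (fun r => r ^ 2 * ‖u t r‖ ^ 2 * r) (Set.Ioi (0:ℝ)) ∧
      2 * Real.pi * ∫ r in Set.Ioi (0:ℝ), r ^ 2 * ‖u t r‖ ^ 2 * r
        = 8 * Energy m (u t) * t ^ 2 := by
  exact fun t ht => CSSP.main hm hu hmass hblow ht
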